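/- arXiv:2510.06792 — 4 statements merged into one kernel-verified Lean document; each statement's English description precedes it below -/
import Mathlib

section
/- Let m ≥ 0 be an integer and, for b, c ∈ ℂ, let f_{b,c} : ℂ × ℂ × ℂ^m → ℂ, f_{b,c}(x,y,z) = x³ + b x² y³ + y⁹ + c x y⁷ + z₁² + ⋯ + z_m². Let (b₁,c₁), (b₂,c₂) ∈ ℂ² satisfy b_i ≠ 0, c_i ≠ 0 and 4b_i³ + 27 ≠ 0 for i = 1, 2. If the germs at 0 of f_{b₁,c₁} and f_{b₂,c₂} are bi-Lipschitz right equivalent, then either (b₁³ = b₂³ and c₁⁹ = c₂⁹), or both ((4/27)·b₁³ + 1)·((4/27)·b₂³ + 1) = 1 and (b₁c₁)⁹ = −((4/27)·b₁³ + 1)^{19}·(b₂c₂)⁹. -/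
open Filter

/-- The germ `f_{b,c}(x,y,z) = x³ + b x² y³ + y⁹ + c x y⁷ + z₁² + ⋯ + z_m²`,
where `x = p 0`, `y = p 1` and `z i = p (i+2)`. -/
noncomputable def fJ (b c : ℂ) (m : ℕ) (p : EuclideanSpace ℂ (Fin (m + 2))) : ℂ :=
  (p 0) ^ 3 + b * (p 0) ^ 2 * (p 1) ^ 3 + (p 1) ^ 9 + c * (p 0) * (p 1) ^ 7 +
    ∑ i : Fin m, (p i.succ.succ) ^ 2

/-- The germs at `0` of `f` and `g` are bi-Lipschitz right equivalent: there are `r > 0`,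
`L ≥ 1` and a map `h` defined on `B(0,r)` with `h 0 = 0`, bi-Lipschitz with constant `L`
on `B(0,r)`, whose image is a neighborhood of `0`, such that `f = g ∘ h` on `B(0,r)`. -/
def BiLipREquiv {E : Type*} [NormedAddCommGroup E] (f g : E → ℂ) : Prop :=
  ∃ (r L : ℝ) (h : E → E), 0 < r ∧ 1 ≤ L ∧ h 0 = 0 ∧
    (∀ p ∈ Metric.ball (0 : E) r, ∀ q ∈ Metric.ball (0 : E) r,
      L⁻¹ * ‖p - q‖ ≤ ‖h p - h q‖ ∧ ‖h p - h q‖ ≤ L * ‖p - q‖) ∧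
    h '' Metric.ball (0 : E) r ∈ nhds (0 : E) ∧
    ∀ p ∈ Metric.ball (0 : E) r, f p = g (h p)

open Asymptotics Topology

/-- Derivatives at corresponding points of bi-Lipschitz equivalent functions are comparable. -/
lemma norm_fderiv_le_of_biLip {E : Type*} [NormedAddCommGroup E] [NormedSpace ℂ E]
    {f g : E → ℂ} {h : E → E} {U : Set E} {L C : ℝ} {p : E} {f' g' : E →L[ℂ] ℂ} (hL : 0 < L)
    (hp : p ∈ U) (hlip : ∀ q ∈ U, L⁻¹ * ‖q - p‖ ≤ ‖h q - h p‖) (hU : h '' U ∈ 𝓝 (h p))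
    (hfg : ∀ q ∈ U, f q = g (h q)) (hf : HasFDerivAt f f' p) (hg : HasFDerivAt g g' (h p))
    (hC : ‖f'‖ < C) : ‖g'‖ ≤ C * L := by
  have hC0 : 0 < C := (norm_nonneg _).trans_lt hC
  have hev : ∀ᶠ q in 𝓝 p, ‖f q - f p‖ ≤ C * ‖q - p‖ := by
    have h1 := hf.isLittleO.def (sub_pos.2 hC)
    filter_upwards [h1] with q hq
    calc ‖f q - f p‖ = ‖(f q - f p - f' (q - p)) + f' (q - p)‖ := by congr 1; ring
      _ ≤ (C - ‖f'‖) * ‖q - p‖ + ‖f'‖ * ‖q - p‖ :=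
        (norm_add_le _ _).trans (add_le_add hq (f'.le_opNorm _))
      _ = C * ‖q - p‖ := by ring
  obtain ⟨δ, hδ, hball⟩ := Metric.eventually_nhds_iff.1 hev
  refine hg.le_of_lip' (by positivity) ?_
  filter_upwards [hU, Metric.ball_mem_nhds (h p) (div_pos hδ hL)] with q' hq' hq'δ
  obtain ⟨q, hq, rfl⟩ := hq'
  have h2 : ‖q - p‖ ≤ L * ‖h q - h p‖ := by
    have := mul_le_mul_of_nonneg_left (hlip q hq) hL.le
    rwa [← mul_assoc, mul_inv_cancel₀ hL.ne', one_mul] at this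
  have h3 : ‖q - p‖ < δ := by
    rw [mem_ball_iff_norm, lt_div_iff₀ hL] at hq'δ
    linarith
  rw [← hfg q hq, ← hfg p hp]
  calc ‖f q - f p‖ ≤ C * ‖q - p‖ := hball (by rwa [dist_eq_norm])
    _ ≤ C * (L * ‖h q - h p‖) := by gcongr
    _ = C * L * ‖h q - h p‖ := by ring

/-- The derivative of `fJ b c m` at `p`. -/
noncomputable def fJDeriv (b c : ℂ) (m : ℕ) (p : EuclideanSpace ℂ (Fin (m + 2))) :
    EuclideanSpace ℂ (Fin (m + 2)) →L[ℂ] ℂ :=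
  (3 * p 0 ^ 2 + 2 * b * p 0 * p 1 ^ 3 + c * p 1 ^ 7) • EuclideanSpace.proj 0 +
    (3 * b * p 0 ^ 2 * p 1 ^ 2 + 9 * p 1 ^ 8 + 7 * c * p 0 * p 1 ^ 6) • EuclideanSpace.proj 1 +
    ∑ i : Fin m, (2 * p i.succ.succ) • EuclideanSpace.proj i.succ.succ

lemma hasFDerivAt_fJ (b c : ℂ) (m : ℕ) (p : EuclideanSpace ℂ (Fin (m + 2))) :
    HasFDerivAt (fJ b c m) (fJDeriv b c m p) p := by
  have hproj (i : Fin (m + 2)) : HasFDerivAt (fun p : EuclideanSpace ℂ (Fin (m + 2)) => p i)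
      (EuclideanSpace.proj i : EuclideanSpace ℂ (Fin (m + 2)) →L[ℂ] ℂ) p :=
    (EuclideanSpace.proj i : EuclideanSpace ℂ (Fin (m + 2)) →L[ℂ] ℂ).hasFDerivAt
  have hx := hproj 0
  have hy := hproj 1
  have hsum := HasFDerivAt.fun_sum (u := Finset.univ)
    (fun (i : Fin m) _ => (hproj i.succ.succ).pow 2)
  have := ((((hx.pow 3).add (((hx.pow 2).const_mul b).mul (hy.pow 3))).add (hy.pow 9)).add
    ((hx.const_mul c).mul (hy.pow 7))).add hsum
  refine this.congr_fderiv ?_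
  ext v
  simp [fJDeriv]
  ring

lemma fJDeriv_single_zero (b c : ℂ) (m : ℕ) (p : EuclideanSpace ℂ (Fin (m + 2))) :
    fJDeriv b c m p (EuclideanSpace.single 0 1) =
      3 * p 0 ^ 2 + 2 * b * p 0 * p 1 ^ 3 + c * p 1 ^ 7 := by
  simp [fJDeriv]

lemma fJDeriv_single_succ_succ (b c : ℂ) (m : ℕ) (p : EuclideanSpace ℂ (Fin (m + 2)))
    (i : Fin m) :
    fJDeriv b c m p (EuclideanSpace.single i.succ.succ 1) = 2 * p i.succ.succ := by
  have h1 : (1 : Fin (m + 2)) ≠ i.succ.succ := by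
    rw [← Fin.succ_zero_eq_one]; exact fun h => (Fin.succ_ne_zero i) (Fin.succ_injective _ h).symm
  have h0 : (0 : Fin (m + 2)) ≠ i.succ.succ := (Fin.succ_ne_zero _).symm
  simp [fJDeriv, h1, h0]

/-- The point `(x, y, 0)`. -/
noncomputable def planePoint (m : ℕ) (x y : ℂ) : EuclideanSpace ℂ (Fin (m + 2)) :=
  EuclideanSpace.single 0 x + EuclideanSpace.single 1 y

@[simp] lemma planePoint_zero (m : ℕ) (x y : ℂ) : planePoint m x y 0 = x := by
  simp [planePoint]

@[simp] lemma planePoint_one (m : ℕ) (x y : ℂ) : planePoint m x y 1 = y := by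
  simp [planePoint]

@[simp] lemma planePoint_succ_succ (m : ℕ) (x y : ℂ) (i : Fin m) :
    planePoint m x y i.succ.succ = 0 := by
  have h1 : i.succ.succ ≠ (1 : Fin (m + 2)) := by
    rw [← Fin.succ_zero_eq_one]; exact fun h => (Fin.succ_ne_zero i) (Fin.succ_injective _ h)
  simp [planePoint, h1]

lemma norm_planePoint_le (m : ℕ) (x y : ℂ) : ‖planePoint m x y‖ ≤ ‖x‖ + ‖y‖ :=
  (norm_add_le _ _).trans (by simp)

lemma fJ_planePoint (b c : ℂ) (m : ℕ) (x y : ℂ) :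
    fJ b c m (planePoint m x y) = x ^ 3 + b * x ^ 2 * y ^ 3 + y ^ 9 + c * x * y ^ 7 := by
  simp [fJ]

lemma norm_fJDeriv_planePoint_le (b c : ℂ) (m : ℕ) (x y : ℂ) :
    ‖fJDeriv b c m (planePoint m x y)‖ ≤ ‖3 * x ^ 2 + 2 * b * x * y ^ 3 + c * y ^ 7‖ +
      ‖3 * b * x ^ 2 * y ^ 2 + 9 * y ^ 8 + 7 * c * x * y ^ 6‖ := by
  refine ContinuousLinearMap.opNorm_le_bound _ (by positivity) fun v => ?_
  have hv : fJDeriv b c m (planePoint m x y) v = (3 * x ^ 2 + 2 * b * x * y ^ 3 + c * y ^ 7) * v 0 +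
      (3 * b * x ^ 2 * y ^ 2 + 9 * y ^ 8 + 7 * c * x * y ^ 6) * v 1 := by
    simp [fJDeriv]
  rw [hv, add_mul ‖_‖]
  refine (norm_add_le _ _).trans (add_le_add ?_ ?_) <;> rw [norm_mul] <;> gcongr <;>
    exact PiLp.norm_apply_le v _

lemma norm_le_sum_norm_apply {ι : Type*} [Fintype ι] [DecidableEq ι] (v : EuclideanSpace ℂ ι) :
    ‖v‖ ≤ ∑ i, ‖v i‖ := by
  have hv : v = ∑ i, EuclideanSpace.single i (v i) := by
    ext j
    simp [Pi.single_apply]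
  calc ‖v‖ = ‖∑ i, EuclideanSpace.single i (v i)‖ := by rw [← hv]
    _ ≤ ∑ i, ‖v i‖ := (norm_sum_le _ _).trans (by simp)

lemma Ultrafilter.exists_tendsto_of_isBigO_one {α : Type*} (l : Ultrafilter α) {u : α → ℂ}
    (hu : u =O[l] (fun _ => (1 : ℂ))) : ∃ u₀, Tendsto u l (𝓝 u₀) := by
  obtain ⟨K, hK⟩ := hu.bound
  obtain ⟨u₀, -, h⟩ := (isCompact_closedBall (0 : ℂ) K).ultrafilter_le_nhds' (l.map u)
    (Ultrafilter.mem_map.2 (by filter_upwards [hK] with y hy; simpa using hy))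
  exact ⟨u₀, h⟩

/-- If a product is small and its factors do not vanish simultaneously, one factor is small. -/
lemma isBigO_or_isBigO_of_mul {l : Ultrafilter ℂ} {ξ η : ℂ → ℂ} {ξ₀ η₀ : ℂ}
    (hξ : Tendsto ξ l (𝓝 ξ₀)) (hη : Tendsto η l (𝓝 η₀))
    (h : (fun y => ξ y * η y) =O[l] (fun y => y)) (hne : ξ₀ ≠ 0 ∨ η₀ ≠ 0) :
    ξ =O[l] (fun y => y) ∨ η =O[l] (fun y => y) := by
  have key : ∀ {α β : ℂ → ℂ} {β₀ : ℂ}, Tendsto β l (𝓝 β₀) → β₀ ≠ 0 →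
      (fun y => α y * β y) =O[l] (fun y => y) → α =O[l] (fun y => y) := by
    intro α β β₀ hβ hβ₀ hαβ
    have h1 := hαβ.mul ((hβ.inv₀ hβ₀).isBigO_one ℂ)
    refine (h1.congr' ?_ ?_)
    · filter_upwards [hβ.eventually_ne hβ₀] with y hy
      field_simp
    · exact Eventually.of_forall fun y => by simp
  rcases hne with h0 | h0
  · exact Or.inr (key hξ h0 (by simpa only [mul_comm] using h))
  · exact Or.inl (key hη h0 h)

lemma isBigO_pow_pow_of_le {l : Filter ℂ} (hl : l ≤ 𝓝[≠] 0) {k n : ℕ} (hkn : k ≤ n) :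
    (fun y : ℂ => y ^ n) =O[l] (fun y => y ^ k) := by
  have h0 : Tendsto (fun y : ℂ => y ^ (n - k)) l (𝓝 (0 ^ (n - k))) :=
    (tendsto_id.mono_left (hl.trans nhdsWithin_le_nhds)).pow _
  refine ((isBigO_refl (fun y : ℂ => y ^ k) l).mul (h0.isBigO_one ℂ)).congr (fun y => ?_)
    (fun y => mul_one _)
  rw [← pow_add, Nat.add_sub_cancel' hkn]

/-- A bound on the `x`-derivative forces `x = ξ y³` to lie close to one of the polar arcs. -/
lemma isBigO_of_polar_bound {l : Ultrafilter ℂ} (hl : (l : Filter ℂ) ≤ 𝓝[≠] 0) {b : ℂ}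
    (hb : b ≠ 0) {K : ℝ} {ξ u : ℂ → ℂ} {T : ℂ → ℝ} (hu : u =O[l] (fun _ => (1 : ℂ)))
    (hgrad : (fun y => ξ y * (3 * ξ y + 2 * b * u y ^ 3)) =O[l] (fun y => y))
    (hT : Tendsto T l (𝓝 0)) (hlow : ∀ᶠ y in l, 1 ≤ K * (‖ξ y * y ^ 2‖ + ‖u y‖ + T y)) :
    ξ =O[l] (fun y => y) ∨ (fun y => 3 * ξ y + 2 * b * u y ^ 3) =O[l] (fun y => y) := by
  have hy0 : Tendsto (fun y : ℂ => y) l (𝓝 0) :=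
    tendsto_id.mono_left (hl.trans nhdsWithin_le_nhds)
  have hbu : (fun y => 2 * b * u y ^ 3) =O[l] (fun _ => (1 : ℂ)) := by
    simpa using (hu.pow 3).const_mul_left (2 * b)
  have hξ : ξ =O[l] (fun _ => (1 : ℂ)) := by
    obtain ⟨C, hC⟩ := (hgrad.trans (hy0.isBigO_one ℂ)).bound
    obtain ⟨M, hM⟩ := hbu.bound
    refine IsBigO.of_bound (1 + |C| + |M|) ?_
    filter_upwards [hC, hM] with y h1 h2
    rw [norm_one, mul_one] at h1 h2 ⊢
    rw [norm_mul] at h1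
    have h3 : 3 * ‖ξ y‖ ≤ ‖3 * ξ y + 2 * b * u y ^ 3‖ + ‖2 * b * u y ^ 3‖ := by
      have h := norm_sub_le (3 * ξ y + 2 * b * u y ^ 3) (2 * b * u y ^ 3)
      rwa [add_sub_cancel_right, norm_mul 3, RCLike.norm_ofNat] at h
    by_contra! hlt
    have h4 := le_abs_self C
    have h5 := le_abs_self M
    have h6 := abs_nonneg C
    have h7 := abs_nonneg M
    have h8 : ‖ξ y‖ * 1 ≤ ‖ξ y‖ * ‖3 * ξ y + 2 * b * u y ^ 3‖ := by
      gcongr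
      linarith
    linarith
  obtain ⟨u₀, hu₀⟩ := l.exists_tendsto_of_isBigO_one hu
  obtain ⟨ξ₀, hξ₀⟩ := l.exists_tendsto_of_isBigO_one hξ
  have hune : u₀ ≠ 0 := by
    rintro rfl
    have hlim : Tendsto (fun y => K * (‖ξ y * y ^ 2‖ + ‖u y‖ + T y)) l (𝓝 0) := by
      simpa using (((hξ₀.mul (hy0.pow 2)).norm.add hu₀.norm).add hT).const_mul K
    exact absurd (ge_of_tendsto hlim hlow) (by norm_num)
  refine isBigO_or_isBigO_of_mul hξ₀ ((hξ₀.const_mul 3).add ((hu₀.pow 3).const_mul (2 * b)))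
    hgrad ?_
  by_cases h0 : ξ₀ = 0
  · right
    simp [h0, hb, hune]
  · exact Or.inl h0

/-- Coefficients `(A, B)` of the expansion `A y⁹ + B y¹⁰ + O(y¹¹)` of `f_{b,c}` along its two
polar arcs. -/
def IsPolarCoeff (b c A B : ℂ) : Prop :=
  (A = 1 ∧ B = 0) ∨ (A = 4 / 27 * b ^ 3 + 1 ∧ B = -(2 / 3 * (b * c)))

lemma exists_polarCoeff_expansion {l : Ultrafilter ℂ} (hl : (l : Filter ℂ) ≤ 𝓝[≠] 0) {b c : ℂ}
    (hb : b ≠ 0) {K : ℝ} {ξ u S : ℂ → ℂ} {T : ℂ → ℝ} (hu : u =O[l] (fun _ => (1 : ℂ)))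
    (hgrad : (fun y => 3 * ξ y ^ 2 + 2 * b * ξ y * u y ^ 3 + c * u y ^ 7 * y) =O[l] (fun y => y))
    (hT : Tendsto T l (𝓝 0)) (hlow : ∀ᶠ y in l, 1 ≤ K * (‖ξ y * y ^ 2‖ + ‖u y‖ + T y))
    (hS : S =O[l] (fun y => y ^ 2)) :
    ∃ A B, IsPolarCoeff b c A B ∧
      (fun y => ξ y ^ 3 + b * ξ y ^ 2 * u y ^ 3 + u y ^ 9 + c * ξ y * u y ^ 7 * y + S y -
        (A * u y ^ 9 + B * y * u y ^ 10)) =O[l] (fun y => y ^ 2) := by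
  have hy : (fun y : ℂ => y) =O[l] (fun y => y) := isBigO_refl _ _
  have h32 : (fun y : ℂ => y ^ 3) =O[l] (fun y => y ^ 2) := isBigO_pow_pow_of_le hl (by norm_num)
  have hun (n : ℕ) : (fun y => u y ^ n) =O[l] (fun _ => (1 : ℂ)) := by simpa using hu.pow n
  have hgrad' : (fun y => ξ y * (3 * ξ y + 2 * b * u y ^ 3)) =O[l] (fun y => y) := by
    have h1 : (fun y => c * u y ^ 7 * y) =O[l] (fun y => y) := by
      simpa using ((hun 7).const_mul_left c).mul hy
    refine (hgrad.sub h1).congr_left fun y => ?_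
    ring
  rcases isBigO_of_polar_bound hl hb hu hgrad' hT hlow with hξ | hη
  · refine ⟨1, 0, Or.inl ⟨rfl, rfl⟩, ?_⟩
    have h1 := (hξ.pow 3).trans h32
    have h2 : (fun y => ξ y ^ 2 * (b * u y ^ 3)) =O[l] (fun y => y ^ 2) := by
      simpa using (hξ.pow 2).mul ((hun 3).const_mul_left b)
    have h3 : (fun y => ξ y * y * (c * u y ^ 7)) =O[l] (fun y => y ^ 2) := by
      simpa [pow_two] using (hξ.mul hy).mul ((hun 7).const_mul_left c)
    refine (((h1.add h2).add h3).add hS).congr_left fun y => ?_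
    ring
  · refine ⟨_, _, Or.inr ⟨rfl, rfl⟩, ?_⟩
    have h1 := ((hη.pow 3).trans h32).const_mul_left (1 / 27)
    have h2 : (fun y => (3 * ξ y + 2 * b * u y ^ 3) ^ 2 * (-(b / 9) * u y ^ 3)) =O[l]
        (fun y => y ^ 2) := by
      simpa using (hη.pow 2).mul ((hun 3).const_mul_left (-(b / 9)))
    have h3 : (fun y => (3 * ξ y + 2 * b * u y ^ 3) * y * (c / 3 * u y ^ 7)) =O[l]
        (fun y => y ^ 2) := by
      simpa [pow_two] using (hη.mul hy).mul ((hun 7).const_mul_left (c / 3))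
    refine (((h1.add h2).add h3).add hS).congr_left fun y => ?_
    ring

lemma isBigO_pow_sub_pow {l : Filter ℂ} {u v w : ℂ → ℂ} (hu : u =O[l] (fun _ => (1 : ℂ)))
    (hv : v =O[l] (fun _ => (1 : ℂ))) (huv : (fun y => u y - v y) =O[l] w) (n : ℕ) :
    (fun y => u y ^ n - v y ^ n) =O[l] w := by
  have hsum : (fun y => ∑ i ∈ Finset.range n, u y ^ i * v y ^ (n - 1 - i)) =O[l]
      (fun _ => (1 : ℂ)) :=
    IsBigO.fun_sum fun i _ => by simpa using (hu.pow i).mul (hv.pow (n - 1 - i))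
  refine (huv.mul hsum).congr (fun y => ?_) fun y => mul_one _
  rw [mul_comm, geom_sum₂_mul]

/-- Comparing the values on two nearby arcs gives the relations between the coefficients. -/
lemma polarCoeff_relations {l : Ultrafilter ℂ} (hl : (l : Filter ℂ) ≤ 𝓝[≠] 0)
    {a B A₁ B₁ A₂ B₂ : ℂ} {u v : ℂ → ℂ} (hu : u =O[l] (fun _ => (1 : ℂ)))
    (hv : v =O[l] (fun _ => (1 : ℂ))) (huv : (fun y => u y - v y) =O[l] (fun y => y ^ 2))
    (h1 : (fun y => a + B * y - (A₁ * u y ^ 9 + B₁ * y * u y ^ 10)) =O[l] (fun y => y ^ 2))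
    (h2 : (fun y => 1 - (A₂ * v y ^ 9 + B₂ * y * v y ^ 10)) =O[l] (fun y => y ^ 2)) :
    ∃ t : ℂ, a = A₁ * t ^ 9 ∧ 1 = A₂ * t ^ 9 ∧ A₂ * B = (A₂ * B₁ - A₁ * B₂) * t ^ 10 := by
  have hy0 : Tendsto (fun y : ℂ => y) l (𝓝 0) :=
    tendsto_id.mono_left (hl.trans nhdsWithin_le_nhds)
  have hne : ∀ᶠ y : ℂ in l, y ≠ 0 := hl self_mem_nhdsWithin
  have hsq : Tendsto (fun y : ℂ => y ^ 2) l (𝓝 0) := by simpa using hy0.pow 2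
  obtain ⟨t, ht⟩ := l.exists_tendsto_of_isBigO_one hv
  have h1' : (fun y => a + B * y - (A₁ * v y ^ 9 + B₁ * y * v y ^ 10)) =O[l]
      (fun y => y ^ 2) := by
    have h9 := (isBigO_pow_sub_pow hu hv huv 9).const_mul_left A₁
    have h10 : (fun y => y * (B₁ * (u y ^ 10 - v y ^ 10))) =O[l] (fun y => y ^ 2) := by
      simpa using (hy0.isBigO_one ℂ).mul ((isBigO_pow_sub_pow hu hv huv 10).const_mul_left B₁)
    refine ((h1.add h9).add h10).congr_left fun y => ?_
    ring
  have hlim (α β A' B' : ℂ) : Tendsto (fun y => α + β * y - (A' * v y ^ 9 + B' * y * v y ^ 10)) l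
      (𝓝 (α - A' * t ^ 9)) := by
    simpa using ((hy0.const_mul β).const_add α).sub
      (((ht.pow 9).const_mul A').add ((hy0.const_mul B').mul (ht.pow 10)))
  have e1 : a = A₁ * t ^ 9 :=
    sub_eq_zero.1 (tendsto_nhds_unique (hlim a B A₁ B₁) (h1'.trans_tendsto hsq))
  have e2 : 1 = A₂ * t ^ 9 := by
    have := hlim 1 0 A₂ B₂
    simp only [zero_mul, add_zero] at this
    exact sub_eq_zero.1 (tendsto_nhds_unique this (h2.trans_tendsto hsq))
  refine ⟨t, e1, e2, ?_⟩
  have e3 : A₂ * a = A₁ := by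
    rw [e1]; linear_combination -A₁ * e2
  have h3 : (fun y => (A₂ * B - (A₂ * B₁ - A₁ * B₂) * v y ^ 10) * y) =O[l] (fun y => y * y) := by
    refine ((h1'.const_mul_left A₂).sub (h2.const_mul_left A₁)).congr (fun y => ?_)
      fun y => pow_two y
    linear_combination e3
  have h4 : (fun y => A₂ * B - (A₂ * B₁ - A₁ * B₂) * v y ^ 10) =O[l] (fun y => y) := by
    refine (h3.mul (isBigO_refl (fun y : ℂ => y⁻¹) l)).congr' ?_ ?_ <;>
    · filter_upwards [hne] with y hy
      field_simp
  have h5 : Tendsto (fun y => A₂ * B - (A₂ * B₁ - A₁ * B₂) * v y ^ 10) l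
      (𝓝 (A₂ * B - (A₂ * B₁ - A₁ * B₂) * t ^ 10)) := ((ht.pow 10).const_mul _).const_sub _
  exact sub_eq_zero.1 (tendsto_nhds_unique h5 (h4.trans_tendsto hy0))

/-- The points `(κ y³, y, 0)` with `3κ² + 2bκ = 0` are sent close to polar arcs of the target. -/
lemma exists_polarCoeff_of_biLip {m : ℕ} {b₁ c₁ b₂ c₂ κ : ℂ} (hb₂ : b₂ ≠ 0)
    (hκ : 3 * κ ^ 2 + 2 * b₁ * κ = 0) {l : Ultrafilter ℂ} (hl : (l : Filter ℂ) ≤ 𝓝[≠] 0)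
    {r L : ℝ} {h : EuclideanSpace ℂ (Fin (m + 2)) → EuclideanSpace ℂ (Fin (m + 2))}
    (hr : 0 < r) (hL : 1 ≤ L) (h0 : h 0 = 0)
    (hlip : ∀ p ∈ Metric.ball (0 : EuclideanSpace ℂ (Fin (m + 2))) r,
      ∀ q ∈ Metric.ball (0 : EuclideanSpace ℂ (Fin (m + 2))) r,
      L⁻¹ * ‖p - q‖ ≤ ‖h p - h q‖ ∧ ‖h p - h q‖ ≤ L * ‖p - q‖)
    (hnhds : h '' Metric.ball 0 r ∈ 𝓝 0)
    (hfg : ∀ p ∈ Metric.ball 0 r, fJ b₁ c₁ m p = fJ b₂ c₂ m (h p)) :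
    (∀ᶠ y in l, planePoint m (κ * y ^ 3) y ∈ Metric.ball 0 r) ∧
    (fun y => h (planePoint m (κ * y ^ 3) y) 1 / y) =O[l] (fun _ => (1 : ℂ)) ∧
    ∃ A B, IsPolarCoeff b₂ c₂ A B ∧
      (fun y => κ ^ 3 + b₁ * κ ^ 2 + 1 + c₁ * κ * y -
        (A * (h (planePoint m (κ * y ^ 3) y) 1 / y) ^ 9 +
          B * y * (h (planePoint m (κ * y ^ 3) y) 1 / y) ^ 10)) =O[l] (fun y => y ^ 2) := by
  have hL0 : 0 < L := by linarith
  have hy0 : Tendsto (fun y : ℂ => y) l (𝓝 0) :=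
    tendsto_id.mono_left (hl.trans nhdsWithin_le_nhds)
  have hne : ∀ᶠ y : ℂ in l, y ≠ 0 := hl self_mem_nhdsWithin
  have hpow {k n : ℕ} (hkn : k ≤ n) : (fun y : ℂ => y ^ n) =O[l] (fun y => y ^ k) :=
    isBigO_pow_pow_of_le hl hkn
  set P : ℂ → EuclideanSpace ℂ (Fin (m + 2)) := fun y => planePoint m (κ * y ^ 3) y with hP
  have hPO : P =O[l] (fun y => y) := by
    have h1 : (fun y : ℂ => ‖κ * y ^ 3‖ + ‖y‖) =O[l] (fun y => y) :=
      (((hpow (show 1 ≤ 3 by norm_num)).const_mul_left κ).norm_left.add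
        (hpow (le_refl 1)).norm_left).congr (fun y => by simp) (fun y => pow_one y)
    exact (IsBigO.of_bound 1 (Eventually.of_forall fun y => by
      rw [one_mul]
      exact (norm_planePoint_le m _ _).trans (le_abs_self _))).trans h1
  have hP0 : Tendsto P l (𝓝 0) := hPO.trans_tendsto hy0
  have hball : ∀ᶠ y in l, P y ∈ Metric.ball 0 r := hP0 (Metric.ball_mem_nhds 0 hr)
  have hQO : (fun y => h (P y)) =O[l] (fun y => y) := by
    refine IsBigO.trans (IsBigO.of_bound L ?_) hPO
    filter_upwards [hball] with y hy
    simpa [h0] using (hlip _ hy 0 (Metric.mem_ball_self hr)).2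
  have hQ0 : Tendsto (fun y => h (P y)) l (𝓝 0) := hQO.trans_tendsto hy0
  have hcoord (i : Fin (m + 2)) : (fun y => h (P y) i) =O[l] (fun y => y) :=
    (IsBigO.of_bound 1 (Eventually.of_forall fun y => by
      rw [one_mul]; exact PiLp.norm_apply_le (h (P y)) i)).trans hQO
  have hQnhds : ∀ᶠ y in l, h '' Metric.ball 0 r ∈ 𝓝 (h (P y)) :=
    hQ0.eventually (eventually_mem_nhds_iff.2 hnhds)
  have hD : (fun y => fJDeriv b₂ c₂ m (h (P y))) =O[l] (fun y => y ^ 7) := by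
    have hC : (fun y : ℂ => (‖c₁ * y ^ 7‖ + ‖(3 * b₁ * κ ^ 2 + 9) * y ^ 8 + 7 * c₁ * κ * y ^ 9‖ +
        ‖y ^ 7‖) * L) =O[l] (fun y => y ^ 7) := by
      have h7 := (hpow (le_refl 7)).const_mul_left c₁
      have h8 := (hpow (show 7 ≤ 8 by norm_num)).const_mul_left (3 * b₁ * κ ^ 2 + 9)
      have h9 := (hpow (show 7 ≤ 9 by norm_num)).const_mul_left (7 * c₁ * κ)
      refine (((h7.norm_left.add (h8.add h9).norm_left).add
        (hpow (le_refl 7)).norm_left).const_mul_left L).congr_left fun y => mul_comm _ _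
    refine IsBigO.trans (IsBigO.of_bound 1 ?_) hC
    filter_upwards [hball, hQnhds, hne] with y hy hyn hy0
    rw [one_mul]
    refine (norm_fderiv_le_of_biLip hL0 hy (fun q hq => (hlip q hq _ hy).1) hyn hfg
      (hasFDerivAt_fJ b₁ c₁ m _) (hasFDerivAt_fJ b₂ c₂ m _) ?_).trans (le_abs_self _)
    refine (norm_fJDeriv_planePoint_le b₁ c₁ m _ _).trans_lt ?_
    have e1 : 3 * (κ * y ^ 3) ^ 2 + 2 * b₁ * (κ * y ^ 3) * y ^ 3 + c₁ * y ^ 7 = c₁ * y ^ 7 := by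
      linear_combination y ^ 6 * hκ
    have e2 : 3 * b₁ * (κ * y ^ 3) ^ 2 * y ^ 2 + 9 * y ^ 8 + 7 * c₁ * (κ * y ^ 3) * y ^ 6 =
        (3 * b₁ * κ ^ 2 + 9) * y ^ 8 + 7 * c₁ * κ * y ^ 9 := by ring
    rw [e1, e2]
    have : 0 < ‖y ^ 7‖ := norm_pos_iff.2 (pow_ne_zero _ hy0)
    linarith
  have hDi (i : Fin (m + 2)) :
      (fun y => fJDeriv b₂ c₂ m (h (P y)) (EuclideanSpace.single i 1)) =O[l] (fun y => y ^ 7) :=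
    (IsBigO.of_bound 1 (Eventually.of_forall fun y => by
      simpa using (fJDeriv b₂ c₂ m (h (P y))).le_opNorm (EuclideanSpace.single i 1))).trans hD
  have hZ (i : Fin m) : (fun y => h (P y) i.succ.succ) =O[l] (fun y => y ^ 7) := by
    refine ((hDi i.succ.succ).const_mul_left (1 / 2)).congr_left fun y => ?_
    rw [fJDeriv_single_succ_succ]
    ring
  have hdiv {k n : ℕ} {φ : ℂ → ℂ} (hφ : φ =O[l] (fun y => y ^ (n + k))) :
      (fun y => φ y / y ^ k) =O[l] (fun y => y ^ n) := by
    refine (hφ.mul (isBigO_refl (fun y : ℂ => (y ^ k)⁻¹) l)).congr' (by rfl) ?_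
    filter_upwards [hne] with y hy
    rw [pow_add]
    field_simp
  have hu : (fun y => h (P y) 1 / y) =O[l] (fun _ => (1 : ℂ)) := by
    simpa using hdiv (k := 1) (n := 0) (φ := fun y => h (P y) 1) (by simpa using hcoord 1)
  refine ⟨hball, hu, ?_⟩
  have hgrad : (fun y => 3 * (h (P y) 0 / y ^ 3) ^ 2 +
      2 * b₂ * (h (P y) 0 / y ^ 3) * (h (P y) 1 / y) ^ 3 + c₂ * (h (P y) 1 / y) ^ 7 * y) =O[l]
      (fun y => y) := by
    refine (hdiv (k := 6) (n := 1) (hDi 0)).congr' ?_ (by simp)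
    filter_upwards [hne] with y hy
    rw [fJDeriv_single_zero]
    field_simp
  have hT : Tendsto (fun y => (∑ i : Fin m, ‖h (P y) i.succ.succ‖) / ‖y‖) l (𝓝 0) := by
    have h1 : (fun y => (∑ i : Fin m, ‖h (P y) i.succ.succ‖) / ‖y‖) =O[l] (fun y => y ^ 6) := by
      have h2 : (fun y => ∑ i : Fin m, ‖h (P y) i.succ.succ / y ^ 1‖) =O[l] (fun y => y ^ 6) :=
        IsBigO.fun_sum fun i _ => (hdiv (k := 1) (n := 6) (hZ i)).norm_left
      simpa [Finset.sum_div] using h2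
    exact h1.trans_tendsto (by simpa using hy0.pow 6)
  have hlow : ∀ᶠ y in l, 1 ≤ L * (‖h (P y) 0 / y ^ 3 * y ^ 2‖ + ‖h (P y) 1 / y‖ +
      (∑ i : Fin m, ‖h (P y) i.succ.succ‖) / ‖y‖) := by
    filter_upwards [hball, hne] with y hy hyne
    have hypos : 0 < ‖y‖ := norm_pos_iff.2 hyne
    have h1 : ‖y‖ ≤ ‖P y‖ := by simpa [hP] using PiLp.norm_apply_le (P y) 1
    have h2 : L⁻¹ * ‖P y‖ ≤ ‖h (P y)‖ := by
      simpa [h0] using (hlip _ hy 0 (Metric.mem_ball_self hr)).1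
    have h3 := norm_le_sum_norm_apply (h (P y))
    rw [Fin.sum_univ_succ, Fin.sum_univ_succ, Fin.succ_zero_eq_one] at h3
    have h4 : ‖P y‖ ≤ L * ‖h (P y)‖ := by rwa [inv_mul_le_iff₀ hL0] at h2
    have h5 : ‖h (P y) 0 / y ^ 3 * y ^ 2‖ = ‖h (P y) 0‖ / ‖y‖ := by
      rw [← norm_div]; congr 1; field_simp
    rw [h5, norm_div, ← add_div, ← add_div, ← mul_div_assoc, one_le_div hypos]
    refine h1.trans (h4.trans ?_)
    gcongr
    linarith
  have hS : (fun y => (∑ i : Fin m, h (P y) i.succ.succ ^ 2) / y ^ 9) =O[l] (fun y => y ^ 2) := by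
    refine hdiv (k := 9) (n := 2) (IsBigO.fun_sum fun i _ => ?_)
    refine (((hZ i).pow 2).congr_right fun y => ?_).trans (hpow (show 11 ≤ 14 by norm_num))
    ring
  obtain ⟨A, B, hAB, hO⟩ := exists_polarCoeff_expansion hl hb₂ hu hgrad hT hlow hS
  refine ⟨A, B, hAB, hO.congr' ?_ (by rfl)⟩
  filter_upwards [hball, hne] with y hy hyne
  congr 1
  have hval : κ ^ 3 + b₁ * κ ^ 2 + 1 + c₁ * κ * y = fJ b₂ c₂ m (h (P y)) / y ^ 9 := by
    rw [← hfg _ hy, hP, fJ_planePoint]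
    field_simp
  rw [hval, fJ]
  field_simp

/-- If `f_{b₁,c₁}` and `f_{b₂,c₂}` (with `bᵢ ≠ 0`, `cᵢ ≠ 0`, `4bᵢ³ + 27 ≠ 0`) are
bi-Lipschitz right equivalent, then either `b₁³ = b₂³` and `c₁⁹ = c₂⁹`, or
`((4/27)b₁³ + 1)((4/27)b₂³ + 1) = 1` and `(b₁c₁)⁹ = -((4/27)b₁³ + 1)¹⁹ (b₂c₂)⁹`. -/
theorem biLip_invariants_J30 (m : ℕ) (b₁ c₁ b₂ c₂ : ℂ)
    (hb₁ : b₁ ≠ 0) (hc₁ : c₁ ≠ 0) (h₁ : 4 * b₁ ^ 3 + 27 ≠ 0)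
    (hb₂ : b₂ ≠ 0) (hc₂ : c₂ ≠ 0) (h₂ : 4 * b₂ ^ 3 + 27 ≠ 0)
    (h : BiLipREquiv (fJ b₁ c₁ m) (fJ b₂ c₂ m)) :
    (b₁ ^ 3 = b₂ ^ 3 ∧ c₁ ^ 9 = c₂ ^ 9) ∨
      (((4 / 27 : ℂ) * b₁ ^ 3 + 1) * ((4 / 27 : ℂ) * b₂ ^ 3 + 1) = 1 ∧
        (b₁ * c₁) ^ 9 = -((4 / 27 : ℂ) * b₁ ^ 3 + 1) ^ 19 * (b₂ * c₂) ^ 9) := by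
  obtain ⟨r, L, h, hr, hL, h0, hlip, hnhds, hfg⟩ := h
  set l : Ultrafilter ℂ := Ultrafilter.of (𝓝[≠] 0)
  have hl : (l : Filter ℂ) ≤ 𝓝[≠] 0 := Ultrafilter.of_le _
  have hne : ∀ᶠ y : ℂ in l, y ≠ 0 := hl self_mem_nhdsWithin
  obtain ⟨hball, hu, A₁, B₁, hAB₁, hO₁⟩ := exists_polarCoeff_of_biLip (κ := -(2 / 3 * b₁)) hb₂
    (by ring) hl hr hL h0 hlip hnhds hfg
  obtain ⟨hball', hv, A₂, B₂, hAB₂, hO₂⟩ := exists_polarCoeff_of_biLip (κ := 0) hb₂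
    (by ring) hl hr hL h0 hlip hnhds hfg
  have huv : (fun y => h (planePoint m (-(2 / 3 * b₁) * y ^ 3) y) 1 / y -
      h (planePoint m (0 * y ^ 3) y) 1 / y) =O[l] (fun y => y ^ 2) := by
    refine IsBigO.of_bound (L * ‖2 / 3 * b₁‖) ?_
    filter_upwards [hball, hball', hne] with y hy hy' hyne
    have hypos : 0 < ‖y‖ := norm_pos_iff.2 hyne
    have hd : planePoint m (-(2 / 3 * b₁) * y ^ 3) y - planePoint m (0 * y ^ 3) y =
        planePoint m (-(2 / 3 * b₁) * y ^ 3) 0 := by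
      ext i
      simp [planePoint]
    have h3 := (hlip _ hy _ hy').2
    rw [hd] at h3
    have h4 := norm_planePoint_le m (-(2 / 3 * b₁) * y ^ 3) 0
    rw [norm_zero, add_zero, norm_mul, norm_neg, norm_pow] at h4
    have h5 := PiLp.norm_apply_le (h (planePoint m (-(2 / 3 * b₁) * y ^ 3) y) -
      h (planePoint m (0 * y ^ 3) y)) 1
    rw [PiLp.sub_apply] at h5
    rw [← sub_div, norm_div, div_le_iff₀ hypos, norm_pow]
    calc _ ≤ _ := h5
      _ ≤ _ := h3
      _ ≤ L * (‖2 / 3 * b₁‖ * ‖y‖ ^ 3) := by gcongr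
      _ = _ := by ring
  obtain ⟨t, e1, e2, e3⟩ := polarCoeff_relations (a := 4 / 27 * b₁ ^ 3 + 1)
    (B := -(2 / 3 * (b₁ * c₁))) (A₁ := A₁) (B₁ := B₁) (A₂ := A₂) (B₂ := B₂) hl hu hv huv
    (hO₁.congr_left fun y => by ring)
    (hO₂.congr_left fun y => by ring)
  have ha : (4 / 27 : ℂ) * b₁ ^ 3 + 1 ≠ 1 := by simpa using hb₁
  rcases hAB₁ with ⟨rfl, rfl⟩ | ⟨rfl, rfl⟩ <;> rcases hAB₂ with ⟨rfl, rfl⟩ | ⟨rfl, rfl⟩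
  · exact absurd (e1.trans e2.symm) ha
  · right
    rw [one_mul] at e1
    have hprod : (4 / 27 * b₁ ^ 3 + 1) * (4 / 27 * b₂ ^ 3 + 1) = 1 := by
      rw [e1]; linear_combination -e2
    refine ⟨hprod, ?_⟩
    generalize 4 / 27 * b₁ ^ 3 + 1 = a at *
    generalize 4 / 27 * b₂ ^ 3 + 1 = a' at *
    have e4 : b₁ * c₁ = -(a ^ 2 * (b₂ * c₂) * t) := by
      linear_combination (-(3 / 2) * a) * e3 - (b₁ * c₁) * hprod + a * b₂ * c₂ * t * e1
    rw [e4]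
    linear_combination a ^ 18 * (b₂ * c₂) ^ 9 * e1
  · left
    rw [one_mul] at e2
    rw [← e2, mul_one] at e1
    have hb : b₁ ^ 3 = b₂ ^ 3 := by linear_combination (27 / 4) * e1
    refine ⟨hb, ?_⟩
    have e4 : b₁ * c₁ = b₂ * c₂ * t := by
      linear_combination (-(3 / 2)) * e3 - b₂ * c₂ * t * e2
    have e5 : b₁ ^ 9 * c₁ ^ 9 = b₁ ^ 9 * c₂ ^ 9 := by
      calc b₁ ^ 9 * c₁ ^ 9 = (b₁ * c₁) ^ 9 := by ring
        _ = (b₂ ^ 3) ^ 3 * c₂ ^ 9 * t ^ 9 := by rw [e4]; ring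
        _ = b₁ ^ 9 * c₂ ^ 9 := by rw [← e2, ← hb]; ring
    exact mul_left_cancel₀ (pow_ne_zero 9 hb₁) e5
  · exact absurd (e1.trans e2.symm) ha
end

section
/- Let m ≥ 0 be an integer and, for b, c ∈ ℂ, let f_{b,c} : ℂ × ℂ × ℂ^m → ℂ, f_{b,c}(x,y,z) = x³ + b x² y³ + y⁹ + c x y⁷ + z₁² + ⋯ + z_m². Let (b₀, c₀) ∈ ℂ² satisfy b₀ ≠ 0, c₀ ≠ 0, 4b₀³ + 27 ≠ 0 and |(4/27)·b₀³ + 1| ≠ 1. Then there exists ε > 0 such that for any two distinct points (b₁,c₁) ≠ (b₂,c₂) in the open ball of radius ε centered at (b₀,c₀) in ℂ², the germs at 0 of f_{b₁,c₁} and f_{b₂,c₂} are not bi-Lipschitz right equivalent. -/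
open Filter

theorem hasFDerivAt_fJ_s3 (b c : ℂ) (m : ℕ) (p : EuclideanSpace ℂ (Fin (m + 2))) :
    HasFDerivAt (fJ b c m)
      ((3 * p 0 ^ 2 + 2 * b * p 0 * p 1 ^ 3 + c * p 1 ^ 7) •
          (EuclideanSpace.proj 0 : EuclideanSpace ℂ (Fin (m + 2)) →L[ℂ] ℂ) +
        (3 * b * p 0 ^ 2 * p 1 ^ 2 + 9 * p 1 ^ 8 + 7 * c * p 0 * p 1 ^ 6) •
          (EuclideanSpace.proj 1 : EuclideanSpace ℂ (Fin (m + 2)) →L[ℂ] ℂ) +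
        ∑ i : Fin m, (2 * p i.succ.succ) •
          (EuclideanSpace.proj i.succ.succ : EuclideanSpace ℂ (Fin (m + 2)) →L[ℂ] ℂ)) p := by
  have hp (i : Fin (m + 2)) : HasFDerivAt (fun q : EuclideanSpace ℂ (Fin (m + 2)) => q i)
      (EuclideanSpace.proj i : EuclideanSpace ℂ (Fin (m + 2)) →L[ℂ] ℂ) p :=
    (EuclideanSpace.proj i : EuclideanSpace ℂ (Fin (m + 2)) →L[ℂ] ℂ).hasFDerivAt
  have hs : HasFDerivAt (fun q : EuclideanSpace ℂ (Fin (m + 2)) => ∑ i : Fin m, q i.succ.succ ^ 2)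
      (∑ i : Fin m, (2 * p i.succ.succ) •
        (EuclideanSpace.proj i.succ.succ : EuclideanSpace ℂ (Fin (m + 2)) →L[ℂ] ℂ)) p := by
    refine HasFDerivAt.fun_sum fun i _ => ?_
    exact ((hp i.succ.succ).pow 2).congr_fderiv (by ext v; simp)
  refine ((((((hp 0).pow 3).add ((((hp 0).pow 2).const_mul b).mul ((hp 1).pow 3))).add
    ((hp 1).pow 9)).add (((hp 0).const_mul c).mul ((hp 1).pow 7))).add hs).congr_fderiv ?_
  ext v
  simp
  ring

/-- A bi-Lipschitz change of coordinates controls the norm of the derivative. -/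
theorem norm_fderiv_le_of_eq_comp {E : Type*} [NormedAddCommGroup E] [NormedSpace ℂ E]
    {f g : E → ℂ} {h : E → E} {s : Set E} {L K : ℝ} {p : E} {f' g' : E →L[ℂ] ℂ}
    (hL : 0 < L) (hK : 0 < K) (hlip : ∀ q ∈ s, L⁻¹ * ‖q - p‖ ≤ ‖h q - h p‖)
    (himg : h '' s ∈ nhds (h p)) (hfg : ∀ q ∈ s, f q = g (h q)) (hp : p ∈ s)
    (hf : HasFDerivAt f f' p) (hg : HasFDerivAt g g' (h p)) (hf' : ‖f'‖ ≤ K) :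
    ‖g'‖ ≤ 2 * K * L := by
  refine hg.le_of_lip' (by positivity) ?_
  have h1 : ∀ᶠ q in nhds p, ‖f q - f p‖ ≤ 2 * K * ‖q - p‖ := by
    filter_upwards [hf.isLittleO.def hK] with q hq
    have h2 : ‖f' (q - p)‖ ≤ K * ‖q - p‖ := f'.le_of_opNorm_le hf' _
    have h3 : f q - f p = (f q - f p - f' (q - p)) + f' (q - p) := by ring
    rw [h3]
    linarith [norm_add_le (f q - f p - f' (q - p)) (f' (q - p))]
  obtain ⟨δ, hδ, hball⟩ := Metric.eventually_nhds_iff.1 h1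
  filter_upwards [himg, Metric.ball_mem_nhds (h p) (div_pos hδ hL)] with y hy hyδ
  obtain ⟨q, hq, rfl⟩ := hy
  have h4 : ‖q - p‖ ≤ L * ‖h q - h p‖ := by
    have := hlip q hq
    rwa [inv_mul_le_iff₀ hL] at this
  have h5 : ‖h q - h p‖ < δ / L := by simpa [dist_eq_norm] using hyδ
  rw [lt_div_iff₀ hL] at h5
  have h6 := hball (y := q) (by rw [dist_eq_norm]; linarith)
  rw [← hfg q hq, ← hfg p hp]
  calc _ ≤ _ := h6
    _ ≤ 2 * K * (L * ‖h q - h p‖) := by gcongr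
    _ = _ := by ring

/-- The arc `s ↦ (a s³, s, 0)`. -/
noncomputable def cubicArc (a : ℂ) (m : ℕ) (s : ℝ) : EuclideanSpace ℂ (Fin (m + 2)) :=
  WithLp.toLp 2 (Fin.cons (a * s ^ 3) (Fin.cons (s : ℂ) 0))

@[simp]
theorem cubicArc_zero (a : ℂ) (m : ℕ) (s : ℝ) : cubicArc a m s 0 = a * s ^ 3 := rfl

@[simp]
theorem cubicArc_one (a : ℂ) (m : ℕ) (s : ℝ) : cubicArc a m s 1 = s := rfl

@[simp]
theorem cubicArc_succ_succ (a : ℂ) (m : ℕ) (s : ℝ) (i : Fin m) :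
    cubicArc a m s i.succ.succ = 0 := rfl

theorem EuclideanSpace.norm_le_sum {ι : Type*} [Fintype ι] (p : EuclideanSpace ℂ ι) :
    ‖p‖ ≤ ∑ i, ‖p i‖ := by
  rw [EuclideanSpace.norm_eq]
  refine Real.sqrt_le_iff.2 ⟨by positivity, ?_⟩
  exact Finset.sum_sq_le_sq_sum_of_nonneg fun i _ => norm_nonneg _

theorem norm_le_coords {m : ℕ} (p : EuclideanSpace ℂ (Fin (m + 2))) :
    ‖p‖ ≤ ‖p 0‖ + ‖p 1‖ + ∑ i : Fin m, ‖p i.succ.succ‖ := by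
  refine (EuclideanSpace.norm_le_sum p).trans_eq ?_
  rw [Fin.sum_univ_succ, Fin.sum_univ_succ, ← add_assoc]
  rfl

theorem norm_cubicArc_le (a : ℂ) (m : ℕ) {s : ℝ} (hs : 0 ≤ s) (hs1 : s ≤ 1) :
    ‖cubicArc a m s‖ ≤ (‖a‖ + 1) * s := by
  have h := norm_le_coords (cubicArc a m s)
  simp only [cubicArc_zero, cubicArc_one, cubicArc_succ_succ, norm_mul, norm_pow,
    Complex.norm_real, Real.norm_of_nonneg hs, norm_zero, Finset.sum_const_zero] at h
  have : ‖a‖ * s ^ 3 ≤ ‖a‖ * s := by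
    gcongr
    exact pow_le_of_le_one hs hs1 (by norm_num)
  linarith

theorem le_norm_cubicArc (a : ℂ) (m : ℕ) (s : ℝ) : s ≤ ‖cubicArc a m s‖ := by
  have := PiLp.norm_apply_le (cubicArc a m s) 1
  rw [cubicArc_one, Complex.norm_real] at this
  exact (le_abs_self s).trans this

theorem norm_cubicArc_sub_le (a a' : ℂ) (m : ℕ) {s : ℝ} (hs : 0 ≤ s) :
    ‖cubicArc a m s - cubicArc a' m s‖ ≤ ‖a - a'‖ * s ^ 3 := by
  have h := norm_le_coords (cubicArc a m s - cubicArc a' m s)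
  simpa [← sub_mul, abs_of_nonneg hs] using h

theorem fJ_cubicArc (a b c : ℂ) (m : ℕ) (s : ℝ) :
    fJ b c m (cubicArc a m s) = s ^ 9 * (a ^ 3 + b * a ^ 2 + 1 + c * a * s) := by
  simp [fJ]
  ring

theorem exists_bound_image_cubicArc {m : ℕ} {b₁ c₁ b₂ c₂ a : ℂ} {r L : ℝ}
    {h : EuclideanSpace ℂ (Fin (m + 2)) → EuclideanSpace ℂ (Fin (m + 2))}
    (hr : 0 < r) (hL : 1 ≤ L) (h0 : h 0 = 0)
    (hlip : ∀ p ∈ Metric.ball 0 r, ∀ q ∈ Metric.ball 0 r,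
      L⁻¹ * ‖p - q‖ ≤ ‖h p - h q‖ ∧ ‖h p - h q‖ ≤ L * ‖p - q‖)
    (himg : h '' Metric.ball 0 r ∈ nhds 0)
    (hfg : ∀ p ∈ Metric.ball 0 r, fJ b₁ c₁ m p = fJ b₂ c₂ m (h p))
    (ha : 3 * a ^ 2 + 2 * b₁ * a = 0) :
    ∃ C > 0, ∀ᶠ s in nhdsWithin (0 : ℝ) (Set.Ioi 0),
      cubicArc a m s ∈ Metric.ball 0 r ∧
      ‖h (cubicArc a m s)‖ ≤ C * s ∧ s ≤ C * ‖h (cubicArc a m s)‖ ∧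
      (∀ i : Fin m, ‖h (cubicArc a m s) i.succ.succ‖ ≤ C * s ^ 7) ∧
      ‖3 * h (cubicArc a m s) 0 ^ 2 +
        2 * b₂ * h (cubicArc a m s) 0 * h (cubicArc a m s) 1 ^ 3 +
        c₂ * h (cubicArc a m s) 1 ^ 7‖ ≤ C * s ^ 7 := by
  have hL0 : 0 < L := by linarith
  set K := ‖c₁‖ + ‖3 * b₁ * a ^ 2 + 9‖ + ‖7 * c₁ * a‖ + 1 with hKdef
  have hK : 0 < K := by positivity
  have hA : 0 < ‖a‖ + 1 := by positivity
  refine ⟨2 * K * L + L * (‖a‖ + 1), by positivity, ?_⟩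
  obtain ⟨δ, hδ, hδimg⟩ := Metric.mem_nhds_iff.1 himg
  have hpos : ∀ᶠ s : ℝ in nhdsWithin 0 (Set.Ioi 0), 0 < s := self_mem_nhdsWithin
  have hsmall {e : ℝ} (he : 0 < e) : ∀ᶠ s : ℝ in nhdsWithin 0 (Set.Ioi 0), s < e :=
    mem_nhdsWithin_of_mem_nhds (Iio_mem_nhds he)
  filter_upwards [hpos, hsmall one_pos, hsmall (div_pos hr hA),
    hsmall (div_pos hδ (mul_pos hL0 hA))] with s hs hs1 hsr hsδ
  rw [lt_div_iff₀ hA] at hsr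
  rw [lt_div_iff₀ (by positivity)] at hsδ
  set p := cubicArc a m s with hp
  have hpn : ‖p‖ ≤ (‖a‖ + 1) * s := norm_cubicArc_le a m hs.le hs1.le
  have hpn' : s ≤ ‖p‖ := le_norm_cubicArc a m s
  have hpr : p ∈ Metric.ball 0 r := by
    rw [mem_ball_zero_iff]; linarith
  have h0r : (0 : EuclideanSpace ℂ (Fin (m + 2))) ∈ Metric.ball 0 r := Metric.mem_ball_self hr
  obtain ⟨hlow, hup⟩ := hlip p hpr 0 h0r
  rw [h0, sub_zero, sub_zero] at hlow hup
  have hq : ‖h p‖ ≤ L * (‖a‖ + 1) * s := by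
    rw [mul_assoc]
    exact hup.trans (by gcongr)
  rw [inv_mul_le_iff₀ hL0] at hlow
  have himg' : h '' Metric.ball 0 r ∈ nhds (h p) :=
    Filter.mem_of_superset (Metric.isOpen_ball.mem_nhds
      (by rw [mem_ball_zero_iff]; linarith)) hδimg
  have hf' := hasFDerivAt_fJ_s3 b₁ c₁ m p
  have hg' := hasFDerivAt_fJ_s3 b₂ c₂ m (h p)
  have hKs : 0 < K * s ^ 7 := by positivity
  have hder := norm_fderiv_le_of_eq_comp hL0 hKs (fun q hq => (hlip q hq p hpr).1) himg' hfg hpr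
    hf' hg' <| by
    refine ContinuousLinearMap.opNorm_le_bound _ hKs.le fun v => ?_
    have hx : 3 * p 0 ^ 2 + 2 * b₁ * p 0 * p 1 ^ 3 + c₁ * p 1 ^ 7 = c₁ * s ^ 7 := by
      simp only [hp, cubicArc_zero, cubicArc_one]
      linear_combination (s : ℂ) ^ 6 * ha
    have hy : 3 * b₁ * p 0 ^ 2 * p 1 ^ 2 + 9 * p 1 ^ 8 + 7 * c₁ * p 0 * p 1 ^ 6 =
        (3 * b₁ * a ^ 2 + 9) * s ^ 8 + 7 * c₁ * a * s ^ 9 := by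
      simp only [hp, cubicArc_zero, cubicArc_one]
      ring
    have hz (i : Fin m) : p i.succ.succ = 0 := rfl
    rw [hx, hy]
    simp only [add_apply, sum_apply,
      smul_apply, PiLp.proj_apply, smul_eq_mul, hz, mul_zero,
      zero_mul, Finset.sum_const_zero, add_zero]
    have e0 : ‖c₁ * (s : ℂ) ^ 7‖ = ‖c₁‖ * s ^ 7 := by
      simp [abs_of_pos hs]
    have e1 : ‖(3 * b₁ * a ^ 2 + 9) * (s : ℂ) ^ 8 + 7 * c₁ * a * (s : ℂ) ^ 9‖ ≤
        (‖3 * b₁ * a ^ 2 + 9‖ + ‖7 * c₁ * a‖) * s ^ 7 := by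
      refine (norm_add_le _ _).trans ?_
      rw [norm_mul, norm_mul _ ((s : ℂ) ^ 9), add_mul]
      have n8 : ‖(s : ℂ) ^ 8‖ ≤ s ^ 7 := by
        rw [norm_pow, Complex.norm_real, Real.norm_of_nonneg hs.le]
        exact pow_le_pow_of_le_one hs.le hs1.le (by norm_num)
      have n9 : ‖(s : ℂ) ^ 9‖ ≤ s ^ 7 := by
        rw [norm_pow, Complex.norm_real, Real.norm_of_nonneg hs.le]
        exact pow_le_pow_of_le_one hs.le hs1.le (by norm_num)
      gcongr
    have v0 : ‖v 0‖ ≤ ‖v‖ := PiLp.norm_apply_le v 0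
    have v1 : ‖v 1‖ ≤ ‖v‖ := PiLp.norm_apply_le v 1
    refine (norm_add_le _ _).trans ?_
    rw [norm_mul, norm_mul _ (v 1), e0]
    calc _ ≤ ‖c₁‖ * s ^ 7 * ‖v‖ + (‖3 * b₁ * a ^ 2 + 9‖ + ‖7 * c₁ * a‖) * s ^ 7 * ‖v‖ := by
          gcongr
      _ ≤ K * s ^ 7 * ‖v‖ := by
          have : 0 ≤ s ^ 7 * ‖v‖ := by positivity
          rw [hKdef]
          linarith
  have hcoord (i : Fin (m + 2)) := ContinuousLinearMap.le_of_opNorm_le _ hder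
    (EuclideanSpace.single i (1 : ℂ))
  have hC : 2 * (K * s ^ 7) * L ≤ (2 * K * L + L * (‖a‖ + 1)) * s ^ 7 := by
    have : 0 ≤ L * (‖a‖ + 1) * s ^ 7 := by positivity
    linarith
  refine ⟨hpr, ?_, ?_, fun i => ?_, ?_⟩
  · refine hq.trans ?_
    gcongr
    linarith [show 0 ≤ 2 * K * L by positivity]
  · refine hpn'.trans (hlow.trans ?_)
    gcongr
    nlinarith [show 0 ≤ 2 * K * L by positivity, norm_nonneg a]
  · have h1 := hcoord i.succ.succ
    have h10 : (1 : Fin (m + 2)) ≠ i.succ.succ := by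
      rw [← Fin.succ_zero_eq_one]
      exact fun e => (Fin.succ_ne_zero i).symm (Fin.succ_injective _ e)
    simp [h10, (Fin.succ_ne_zero _).symm] at h1
    linarith [norm_nonneg ((h p) i.succ.succ)]
  · have h1 := hcoord 0
    simp [Fin.succ_ne_zero] at h1
    linarith

/-- The rescaled coordinates `w = x / s³` and `t = y / s` of the image of a cubic arc tangent to
the polar locus stay bounded, `t` stays away from `0`, and `(w, t)` approaches the polar locus. -/
theorem rescaled_image_cubicArc {m : ℕ} {b₁ c₁ b₂ c₂ a : ℂ} {r L : ℝ}
    {h : EuclideanSpace ℂ (Fin (m + 2)) → EuclideanSpace ℂ (Fin (m + 2))}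
    (hr : 0 < r) (hL : 1 ≤ L) (h0 : h 0 = 0)
    (hlip : ∀ p ∈ Metric.ball 0 r, ∀ q ∈ Metric.ball 0 r,
      L⁻¹ * ‖p - q‖ ≤ ‖h p - h q‖ ∧ ‖h p - h q‖ ≤ L * ‖p - q‖)
    (himg : h '' Metric.ball 0 r ∈ nhds 0)
    (hfg : ∀ p ∈ Metric.ball 0 r, fJ b₁ c₁ m p = fJ b₂ c₂ m (h p))
    (ha : 3 * a ^ 2 + 2 * b₁ * a = 0) {w t : ℝ → ℂ}
    (hw : ∀ s, w s = h (cubicArc a m s) 0 / s ^ 3) (ht : ∀ s, t s = h (cubicArc a m s) 1 / s) :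
    ∃ M > 0, ∀ᶠ s in nhdsWithin (0 : ℝ) (Set.Ioi 0),
      ‖w s‖ ≤ M ∧ ‖t s‖ ≤ M ∧ 1 ≤ M * ‖t s‖ ∧
      ‖w s * (3 * w s + 2 * b₂ * t s ^ 3)‖ ≤ M * s ∧
      ‖(a ^ 3 + b₁ * a ^ 2 + 1 + c₁ * a * s) -
        (w s ^ 3 + b₂ * w s ^ 2 * t s ^ 3 + t s ^ 9 + c₂ * w s * t s ^ 7 * s)‖ ≤ M * s ^ 2 := by
  obtain ⟨C, hC, hev⟩ := exists_bound_image_cubicArc hr hL h0 hlip himg hfg ha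
  set D := C + 2 * ‖b₂‖ * C ^ 3 + ‖c₂‖ * C ^ 7 with hD
  have hD0 : 0 < D := by positivity
  set e := C * (D + 1 + m * C) with he
  have he0 : 0 < e := by positivity
  have hpos : ∀ᶠ s : ℝ in nhdsWithin 0 (Set.Ioi 0), 0 < s := self_mem_nhdsWithin
  have hsmall {e : ℝ} (he : 0 < e) : ∀ᶠ s : ℝ in nhdsWithin 0 (Set.Ioi 0), s < e :=
    mem_nhdsWithin_of_mem_nhds (Iio_mem_nhds he)
  refine ⟨(D + 1) + 2 * C + m * C ^ 2, by positivity, ?_⟩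
  filter_upwards [hev, hpos, hsmall one_pos, hsmall (show 0 < 1 / (2 * e) by positivity)]
    with s hsC hs hs1 hse
  obtain ⟨hball, hup, hlow, hz, hP⟩ := hsC
  have hf := hfg _ hball
  rw [fJ_cubicArc, fJ] at hf
  set q := h (cubicArc a m s)
  have hs0 : (s : ℂ) ≠ 0 := by exact_mod_cast hs.ne'
  have hns : ‖(s : ℂ)‖ = s := by rw [Complex.norm_real, Real.norm_of_nonneg hs.le]
  have hX : q 0 = w s * s ^ 3 := by rw [hw, div_mul_cancel₀ _ (pow_ne_zero 3 hs0)]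
  have hY : q 1 = t s * s := by rw [ht, div_mul_cancel₀ _ hs0]
  have hmC : 0 ≤ m * C ^ 2 := by positivity
  have tb : ‖t s‖ ≤ C := by
    have h1 := (PiLp.norm_apply_le q 1).trans hup
    rw [hY, norm_mul, hns] at h1
    exact le_of_mul_le_mul_right h1 hs
  rw [hX, hY] at hP
  have hP' : ‖3 * w s ^ 2 + 2 * b₂ * w s * t s ^ 3 + c₂ * t s ^ 7 * s‖ ≤ C * s := by
    rw [show 3 * (w s * (s : ℂ) ^ 3) ^ 2 + 2 * b₂ * (w s * (s : ℂ) ^ 3) * (t s * s) ^ 3 +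
      c₂ * (t s * s) ^ 7 = (3 * w s ^ 2 + 2 * b₂ * w s * t s ^ 3 + c₂ * t s ^ 7 * s) * s ^ 6 by ring,
      norm_mul, norm_pow, hns, show C * s ^ 7 = C * s * s ^ 6 by ring] at hP
    exact le_of_mul_le_mul_right hP (by positivity)
  have n7 : ‖c₂ * t s ^ 7 * s‖ ≤ ‖c₂‖ * C ^ 7 * s := by
    rw [norm_mul, norm_mul, norm_pow, hns]
    gcongr
  have hpolar : ‖w s * (3 * w s + 2 * b₂ * t s ^ 3)‖ ≤ (C + ‖c₂‖ * C ^ 7) * s := by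
    rw [show w s * (3 * w s + 2 * b₂ * t s ^ 3) =
      (3 * w s ^ 2 + 2 * b₂ * w s * t s ^ 3 + c₂ * t s ^ 7 * s) - c₂ * t s ^ 7 * s by ring]
    refine (norm_sub_le _ _).trans ?_
    linarith
  have wb : ‖w s‖ ≤ D + 1 := by
    have n3 : ‖2 * b₂ * t s ^ 3 * w s‖ ≤ 2 * ‖b₂‖ * C ^ 3 * ‖w s‖ := by
      rw [norm_mul, norm_mul, norm_mul, norm_pow, Complex.norm_ofNat]
      gcongr
    have n1 : 3 * ‖w s‖ ^ 2 ≤ (C + ‖c₂‖ * C ^ 7) * s + 2 * ‖b₂‖ * C ^ 3 * ‖w s‖ := by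
      have : 3 * ‖w s‖ ^ 2 = ‖3 * w s ^ 2‖ := by simp
      rw [this, show 3 * w s ^ 2 = w s * (3 * w s + 2 * b₂ * t s ^ 3) - 2 * b₂ * t s ^ 3 * w s by
        ring]
      exact (norm_sub_le _ _).trans (by linarith)
    have n2 : (C + ‖c₂‖ * C ^ 7) * s ≤ C + ‖c₂‖ * C ^ 7 :=
      mul_le_of_le_one_right (by positivity) hs1.le
    have n4 : C + ‖c₂‖ * C ^ 7 ≤ D := by
      have : 0 ≤ 2 * ‖b₂‖ * C ^ 3 := by positivity
      linarith
    have n5 : 2 * ‖b₂‖ * C ^ 3 ≤ D := by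
      have : 0 ≤ ‖c₂‖ * C ^ 7 := by positivity
      linarith
    have n6 : 2 * ‖b₂‖ * C ^ 3 * ‖w s‖ ≤ D * ‖w s‖ := by gcongr
    by_contra! hlt
    nlinarith
  refine ⟨by linarith, by linarith, ?_, ?_, ?_⟩
  · have hqn := norm_le_coords q
    have hsum : ∑ i : Fin m, ‖q i.succ.succ‖ ≤ m * (C * s ^ 7) := by
      simpa using Finset.sum_le_card_nsmul Finset.univ _ _ fun i _ => hz i
    rw [hX, hY, norm_mul, norm_mul, norm_pow, hns] at hqn
    have h3 : s ^ 3 ≤ s * s := by nlinarith [mul_pos hs hs]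
    have h7 : s ^ 7 ≤ s * s := by
      rw [← sq]; exact pow_le_pow_of_le_one hs.le hs1.le (by norm_num)
    have h8 : ‖q‖ ≤ (D + 1) * (s * s) + ‖t s‖ * s + m * (C * (s * s)) :=
      calc ‖q‖ ≤ ‖w s‖ * s ^ 3 + ‖t s‖ * s + m * (C * s ^ 7) := by linarith
        _ ≤ _ := by gcongr
    have h9 : 1 * s ≤ (e * s + C * ‖t s‖) * s := by
      rw [one_mul]
      refine hlow.trans ?_
      calc C * ‖q‖ ≤ C * ((D + 1) * (s * s) + ‖t s‖ * s + m * (C * (s * s))) := by gcongr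
        _ = _ := by rw [he]; ring
    have h10 := le_of_mul_le_mul_right h9 hs
    rw [lt_div_iff₀ (by positivity)] at hse
    have h11 : 0 ≤ (D + 1 + m * C ^ 2) * ‖t s‖ := by positivity
    linarith
  · refine hpolar.trans ?_
    have : 0 ≤ 2 * ‖b₂‖ * C ^ 3 := by positivity
    exact mul_le_mul_of_nonneg_right (by linarith) hs.le
  · rw [hX, hY] at hf
    have hsum : ‖∑ i : Fin m, q i.succ.succ ^ 2‖ ≤ m * (C * s ^ 7) ^ 2 := by
      refine (norm_sum_le _ _).trans ?_
      have hterm (i : Fin m) : ‖q i.succ.succ ^ 2‖ ≤ (C * s ^ 7) ^ 2 := by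
        rw [norm_pow]
        exact pow_le_pow_left₀ (norm_nonneg _) (hz i) 2
      simpa using Finset.sum_le_card_nsmul Finset.univ _ _ fun i _ => hterm i
    have hdiff : ((a ^ 3 + b₁ * a ^ 2 + 1 + c₁ * a * s) -
        (w s ^ 3 + b₂ * w s ^ 2 * t s ^ 3 + t s ^ 9 + c₂ * w s * t s ^ 7 * s)) * s ^ 9 =
        ∑ i : Fin m, q i.succ.succ ^ 2 := by
      linear_combination hf
    rw [← hdiff, norm_mul, norm_pow, hns,
      show m * (C * s ^ 7) ^ 2 = m * C ^ 2 * s ^ 5 * s ^ 9 by ring] at hsum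
    refine (le_of_mul_le_mul_right hsum (by positivity)).trans ?_
    have h5 : s ^ 5 ≤ s ^ 2 := pow_le_pow_of_le_one hs.le hs1.le (by norm_num)
    exact mul_le_mul (by linarith) h5 (by positivity) (by positivity)

/-- A point close to the polar locus is close to one of its two branches, and the value of the
rescaled germ there is determined up to second order. -/
theorem exists_bound_near_branches {b : ℂ} (c : ℂ) (hb : b ≠ 0) {M : ℝ} (hM : 0 < M) :
    ∃ N : ℝ, ∀ (s : ℝ) (w t F : ℂ), 0 < s → s < 1 → ‖w‖ ≤ M → ‖t‖ ≤ M → 1 ≤ M * ‖t‖ →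
      ‖w * (3 * w + 2 * b * t ^ 3)‖ ≤ M * s →
      ‖F - (w ^ 3 + b * w ^ 2 * t ^ 3 + t ^ 9 + c * w * t ^ 7 * s)‖ ≤ M * s ^ 2 →
      ‖F - (1 * t ^ 9 - 0 * t ^ 10 * s)‖ ≤ N * s ^ 2 ∨
      ‖F - ((4 / 27 * b ^ 3 + 1) * t ^ 9 - 2 / 3 * b * c * t ^ 10 * s)‖ ≤ N * s ^ 2 := by
  have hb' : 0 < ‖b‖ := norm_pos_iff.2 hb
  set κ := 2 / 3 * ‖b‖ / M ^ 3 with hκ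
  have hκ0 : 0 < κ := by positivity
  set E := 2 * M / κ with hE
  have hE0 : 0 < E := by positivity
  refine ⟨M + E ^ 2 * (M + E + ‖b‖ * M ^ 3) + ‖c‖ * E * M ^ 7, ?_⟩
  intro s w t F hs hs1 hw ht ht1 hpolar hF
  have hns : ‖(s : ℂ)‖ = s := by rw [Complex.norm_real, Real.norm_of_nonneg hs.le]
  set d := w + 2 / 3 * b * t ^ 3 with hd
  have hwd : ‖w‖ * ‖d‖ ≤ M * s := by
    rw [show w * (3 * w + 2 * b * t ^ 3) = 3 * (w * d) by rw [hd]; ring, norm_mul,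
      Complex.norm_ofNat, norm_mul] at hpolar
    nlinarith [norm_nonneg w, norm_nonneg d, mul_nonneg (norm_nonneg w) (norm_nonneg d)]
  have hgap : κ ≤ ‖d‖ + ‖w‖ := by
    have h1 : ‖d - w‖ = 2 / 3 * ‖b‖ * ‖t‖ ^ 3 := by
      rw [hd, add_sub_cancel_left]; simp
    have h2 : 1 ≤ ‖t‖ ^ 3 * M ^ 3 := by
      rw [← mul_pow, mul_comm]; exact one_le_pow₀ ht1
    refine le_trans ?_ (norm_sub_le d w)
    rw [h1, hκ, div_le_iff₀ (by positivity), mul_assoc _ (‖t‖ ^ 3)]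
    exact le_mul_of_one_le_right (by positivity) h2
  have hsmall {x y : ℝ} (hx : 0 ≤ x) (hxy : x * y ≤ M * s) (hy : κ / 2 ≤ y) : x ≤ E * s := by
    rw [hE, div_mul_eq_mul_div, le_div_iff₀ hκ0]
    nlinarith
  have hbt : ‖b * t ^ 3‖ ≤ ‖b‖ * M ^ 3 := by
    rw [norm_mul, norm_pow]; gcongr
  have hct {x : ℂ} (hx : ‖x‖ ≤ E * s) : ‖c * x * t ^ 7 * s‖ ≤ ‖c‖ * E * M ^ 7 * s ^ 2 := by
    rw [norm_mul, norm_mul, norm_mul, norm_pow, hns]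
    calc _ ≤ ‖c‖ * (E * s) * M ^ 7 * s := by gcongr
      _ = _ := by ring
  have hsq {x y : ℂ} (hx : ‖x‖ ≤ E * s) (hy : ‖y‖ ≤ M + E + ‖b‖ * M ^ 3) :
      ‖x ^ 2 * y‖ ≤ E ^ 2 * (M + E + ‖b‖ * M ^ 3) * s ^ 2 := by
    rw [norm_mul, norm_pow]
    calc _ ≤ (E * s) ^ 2 * (M + E + ‖b‖ * M ^ 3) := by gcongr
      _ = _ := by ring
  rcases le_total (κ / 2) ‖d‖ with hcase | hcase
  · left
    have hws : ‖w‖ ≤ E * s := hsmall (norm_nonneg _) hwd hcase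
    rw [show F - (1 * t ^ 9 - 0 * t ^ 10 * s) =
      (F - (w ^ 3 + b * w ^ 2 * t ^ 3 + t ^ 9 + c * w * t ^ 7 * s)) +
        w ^ 2 * (w + b * t ^ 3) + c * w * t ^ 7 * s by ring]
    have h1 := hsq (y := w + b * t ^ 3) hws ((norm_add_le _ _).trans (by linarith))
    refine norm_add₃_le.trans ?_
    linarith [hct hws]
  · right
    have hds : ‖d‖ ≤ E * s :=
      hsmall (norm_nonneg _) (by rwa [mul_comm]) (show κ / 2 ≤ ‖w‖ by linarith)
    have hdE : ‖d‖ ≤ E := hds.trans (mul_le_of_le_one_right hE0.le hs1.le)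
    rw [show F - ((4 / 27 * b ^ 3 + 1) * t ^ 9 - 2 / 3 * b * c * t ^ 10 * s) =
      (F - (w ^ 3 + b * w ^ 2 * t ^ 3 + t ^ 9 + c * w * t ^ 7 * s)) +
        d ^ 2 * (d - b * t ^ 3) + c * d * t ^ 7 * s by rw [hd]; ring]
    have h1 := hsq (y := d - b * t ^ 3) hds ((norm_sub_le _ _).trans (by linarith))
    refine norm_add₃_le.trans ?_
    linarith [hct hds]

/-- Comparison of the expansions of a germ along two arcs at the same scale. -/
theorem compare_expansions {l : Filter ℝ} [l.NeBot] (hl : l ≤ nhdsWithin 0 (Set.Ioi 0))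
    {t₁ t₂ : ℝ → ℂ} {M N₁ N₂ : ℝ} {A κ R₁ k₁ R₂ k₂ : ℂ}
    (ht₁ : ∀ᶠ s in l, ‖t₁ s‖ ≤ M) (ht₂ : ∀ᶠ s in l, ‖t₂ s‖ ≤ M)
    (ht : ∀ᶠ s in l, ‖t₁ s - t₂ s‖ ≤ M * s ^ 2)
    (h₁ : ∀ᶠ s : ℝ in l, ‖(A - κ * s) - (R₁ * t₁ s ^ 9 - k₁ * t₁ s ^ 10 * s)‖ ≤ N₁ * s ^ 2)
    (h₂ : ∀ᶠ s : ℝ in l, ‖1 - (R₂ * t₂ s ^ 9 - k₂ * t₂ s ^ 10 * s)‖ ≤ N₂ * s ^ 2) :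
    A * R₂ = R₁ ∧ (R₁ = A → R₂ = 1 → k₂ = 0 → κ ^ 9 = k₁ ^ 9) := by
  have hs0 : Tendsto (fun s : ℝ => (s : ℂ)) l (nhds 0) := by
    have : Tendsto (fun s : ℝ => (s : ℂ)) (nhds 0) (nhds ((0 : ℝ) : ℂ)) :=
      Complex.continuous_ofReal.tendsto 0
    rw [Complex.ofReal_zero] at this
    exact this.mono_left (hl.trans nhdsWithin_le_nhds)
  have hne : ∀ᶠ s : ℝ in l, (s : ℂ) ≠ 0 := by
    filter_upwards [hl self_mem_nhdsWithin] with s hs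
    exact_mod_cast (Set.mem_Ioi.1 hs).ne'
  have big {u : ℝ → ℂ} {K : ℝ} (hu : ∀ᶠ s in l, ‖u s‖ ≤ K * s ^ 2) :
      u =O[l] fun s : ℝ => (s : ℂ) ^ 2 := by
    refine Asymptotics.IsBigO.of_bound K ?_
    filter_upwards [hu] with s hs
    simpa using hs
  have bdd {u : ℝ → ℂ} (hu : ∀ᶠ s in l, ‖u s‖ ≤ M) : u =O[l] fun _ => (1 : ℂ) := by
    refine Asymptotics.IsBigO.of_bound M ?_
    filter_upwards [hu] with s hs
    simpa using hs
  have bpow {u : ℝ → ℂ} (hu : u =O[l] fun _ => (1 : ℂ)) (n : ℕ) :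
      (fun s => u s ^ n) =O[l] fun _ => (1 : ℂ) := by simpa using hu.pow n
  have b₁ := bdd ht₁
  have b₂ := bdd ht₂
  have H₁ := big h₁
  have H₂ := big h₂
  have h9 : (fun s => t₁ s ^ 9 - t₂ s ^ 9) =O[l] fun s : ℝ => (s : ℂ) ^ 2 := by
    have hS : (fun s => ∑ i ∈ Finset.range 9, t₁ s ^ i * t₂ s ^ (9 - 1 - i)) =O[l]
        fun _ => (1 : ℂ) := by
      refine Asymptotics.IsBigO.fun_sum fun i _ => ?_
      exact ((bpow b₁ i).mul (bpow b₂ (9 - 1 - i))).congr_right fun _ => one_mul _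
    exact (hS.mul (big ht)).congr (fun s => (Commute.all (t₁ s) (t₂ s)).geom_sum₂_mul 9)
      fun _ => one_mul _
  have hsq : Tendsto (fun s : ℝ => (s : ℂ) ^ 2) l (nhds 0) := by simpa using hs0.pow 2
  have lin {u : ℝ → ℂ} (hu : u =O[l] fun _ => (1 : ℂ)) :
      Tendsto (fun s : ℝ => u s * s) l (nhds 0) := by
    have : (fun s : ℝ => u s * s) =O[l] fun s : ℝ => (s : ℂ) := by
      simpa using hu.mul (Asymptotics.isBigO_refl (fun s : ℝ => (s : ℂ)) l)
    exact this.trans_tendsto hs0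
  constructor
  · have hlim := ((((((H₁.trans_tendsto hsq).const_mul R₂).sub
      ((H₂.trans_tendsto hsq).const_mul R₁)).add (hs0.const_mul (R₂ * κ))).add
      ((h9.trans_tendsto hsq).const_mul (R₁ * R₂))).sub
      ((lin (bpow b₁ 10)).const_mul (R₂ * k₁))).add
      ((lin (bpow b₂ 10)).const_mul (R₁ * k₂))
    simp only [mul_zero, sub_zero, add_zero] at hlim
    have : Tendsto (fun _ : ℝ => A * R₂ - R₁) l (nhds 0) := by
      refine hlim.congr fun s => ?_
      ring
    exact sub_eq_zero.1 (tendsto_nhds_unique tendsto_const_nhds this)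
  · rintro rfl rfl rfl
    have hlin : (fun s : ℝ => (s : ℂ) * (κ - k₁ * t₁ s ^ 10)) =O[l]
        fun s : ℝ => (s : ℂ) * s := by
      have := ((H₂.const_mul_left R₁).sub H₁).sub (h9.const_mul_left R₁)
      refine this.congr (fun s => ?_) (fun s => ?_) <;> ring
    have hκ : Tendsto (fun s => κ - k₁ * t₁ s ^ 10) l (nhds 0) := by
      refine Asymptotics.IsBigO.trans_tendsto ?_ hs0
      have hinv := (Asymptotics.isBigO_refl (fun s : ℝ => (s : ℂ)⁻¹) l).mul hlin
      refine hinv.congr' ?_ ?_ <;> filter_upwards [hne] with s hs <;> field_simp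
    have hone : Tendsto (fun s => t₁ s ^ 9) l (nhds 1) := by
      have := ((h9.trans_tendsto hsq).sub (H₂.trans_tendsto hsq)).add_const 1
      rw [sub_zero, zero_add] at this
      exact this.congr fun s => by ring
    have hpow : Tendsto (fun s => (k₁ * t₁ s ^ 10) ^ 9) l (nhds (κ ^ 9)) := by
      have := (hκ.const_sub κ).pow 9
      simpa using this
    have hpow' : Tendsto (fun s => (k₁ * t₁ s ^ 10) ^ 9) l (nhds (k₁ ^ 9)) := by
      have := (hone.pow 10).const_mul (k₁ ^ 9)
      rw [one_pow, mul_one] at this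
      exact this.congr fun s => by ring
    exact tendsto_nhds_unique hpow hpow'

/-- Bi-Lipschitz right equivalence determines the parameters up to finitely many choices. -/
theorem BiLipREquiv.parameters {m : ℕ} {b₁ c₁ b₂ c₂ : ℂ} (hb₁ : b₁ ≠ 0) (hb₂ : b₂ ≠ 0)
    (hA₂ : 4 / 27 * b₂ ^ 3 + 1 ≠ 0) (hA : (4 / 27 * b₁ ^ 3 + 1) * (4 / 27 * b₂ ^ 3 + 1) ≠ 1)
    (hequiv : BiLipREquiv (fJ b₁ c₁ m) (fJ b₂ c₂ m)) :
    b₁ ^ 3 = b₂ ^ 3 ∧ (b₁ * c₁) ^ 9 = (b₂ * c₂) ^ 9 := by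
  obtain ⟨r, L, h, hr, hL, h0, hlip, himg, hfg⟩ := hequiv
  set a : ℂ := -(2 / 3) * b₁ with ha
  set t₁ : ℝ → ℂ := fun s => h (cubicArc a m s) 1 / s with ht₁
  set t₂ : ℝ → ℂ := fun s => h (cubicArc 0 m s) 1 / s with ht₂
  obtain ⟨M₁, hM₁, hev₁⟩ := rescaled_image_cubicArc (a := a) hr hL h0 hlip himg hfg
    (by rw [ha]; ring) (w := fun s => h (cubicArc a m s) 0 / s ^ 3) (t := t₁)
    (fun _ => rfl) (fun _ => rfl)
  obtain ⟨M₂, hM₂, hev₂⟩ := rescaled_image_cubicArc (a := 0) hr hL h0 hlip himg hfg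
    (by ring) (w := fun s => h (cubicArc 0 m s) 0 / s ^ 3) (t := t₂)
    (fun _ => rfl) (fun _ => rfl)
  obtain ⟨N₁, hN₁⟩ := exists_bound_near_branches c₂ hb₂ hM₁
  obtain ⟨N₂, hN₂⟩ := exists_bound_near_branches c₂ hb₂ hM₂
  let l : Ultrafilter ℝ := Ultrafilter.of (nhdsWithin 0 (Set.Ioi 0))
  have hl : (l : Filter ℝ) ≤ nhdsWithin 0 (Set.Ioi 0) := Ultrafilter.of_le _
  have hpos : ∀ᶠ s : ℝ in nhdsWithin 0 (Set.Ioi 0), 0 < s := self_mem_nhdsWithin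
  have hsmall {e : ℝ} (he : 0 < e) : ∀ᶠ s : ℝ in nhdsWithin 0 (Set.Ioi 0), s < e :=
    mem_nhdsWithin_of_mem_nhds (Iio_mem_nhds he)
  have hdich₁ : ∀ᶠ s : ℝ in l,
      ‖(4 / 27 * b₁ ^ 3 + 1 - 2 / 3 * b₁ * c₁ * s) -
        (1 * t₁ s ^ 9 - 0 * t₁ s ^ 10 * s)‖ ≤ N₁ * s ^ 2 ∨
      ‖(4 / 27 * b₁ ^ 3 + 1 - 2 / 3 * b₁ * c₁ * s) -
        ((4 / 27 * b₂ ^ 3 + 1) * t₁ s ^ 9 - 2 / 3 * b₂ * c₂ * t₁ s ^ 10 * s)‖ ≤ N₁ * s ^ 2 := by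
    filter_upwards [hl hev₁, hl hpos, hl (hsmall one_pos)] with s hs hs0 hs1
    obtain ⟨hw, ht, ht', hp, hF⟩ := hs
    refine hN₁ s _ _ _ hs0 hs1 hw ht ht' hp ?_
    rwa [show 4 / 27 * b₁ ^ 3 + 1 - 2 / 3 * b₁ * c₁ * s =
      a ^ 3 + b₁ * a ^ 2 + 1 + c₁ * a * s by rw [ha]; ring]
  have hdich₂ : ∀ᶠ s : ℝ in l,
      ‖1 - (1 * t₂ s ^ 9 - 0 * t₂ s ^ 10 * s)‖ ≤ N₂ * s ^ 2 ∨
      ‖1 - ((4 / 27 * b₂ ^ 3 + 1) * t₂ s ^ 9 - 2 / 3 * b₂ * c₂ * t₂ s ^ 10 * s)‖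
        ≤ N₂ * s ^ 2 := by
    filter_upwards [hl hev₂, hl hpos, hl (hsmall one_pos)] with s hs hs0 hs1
    obtain ⟨hw, ht, ht', hp, hF⟩ := hs
    refine hN₂ s _ _ _ hs0 hs1 hw ht ht' hp ?_
    rwa [show (1 : ℂ) = 0 ^ 3 + b₁ * 0 ^ 2 + 1 + c₁ * 0 * s by ring]
  set M := M₁ + M₂ + L * ‖a‖ with hM
  have hLa : 0 ≤ L * ‖a‖ := by positivity
  have bt₁ : ∀ᶠ s in (l : Filter ℝ), ‖t₁ s‖ ≤ M := by
    filter_upwards [hl hev₁] with s hs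
    linarith [hs.2.1]
  have bt₂ : ∀ᶠ s in (l : Filter ℝ), ‖t₂ s‖ ≤ M := by
    filter_upwards [hl hev₂] with s hs
    linarith [hs.2.1]
  have bt : ∀ᶠ s in (l : Filter ℝ), ‖t₁ s - t₂ s‖ ≤ M * s ^ 2 := by
    have hA0 : 0 < ‖a‖ + 1 := by positivity
    filter_upwards [hl hpos, hl (hsmall one_pos), hl (hsmall (div_pos hr hA0))] with s hs hs1 hsr
    rw [lt_div_iff₀ hA0] at hsr
    have hp₁ : cubicArc a m s ∈ Metric.ball 0 r := by
      rw [mem_ball_zero_iff]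
      linarith [norm_cubicArc_le a m hs.le hs1.le]
    have hp₂ : cubicArc 0 m s ∈ Metric.ball 0 r := by
      rw [mem_ball_zero_iff]
      have := norm_cubicArc_le 0 m hs.le hs1.le
      rw [norm_zero, zero_add, one_mul] at this
      nlinarith [norm_nonneg a]
    have hd := (hlip _ hp₁ _ hp₂).2.trans
      (mul_le_mul_of_nonneg_left (norm_cubicArc_sub_le a 0 m hs.le) (by linarith))
    have hd' := (PiLp.norm_apply_le (h (cubicArc a m s) - h (cubicArc 0 m s)) 1).trans hd
    rw [PiLp.sub_apply, sub_zero] at hd'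
    simp only [ht₁, ht₂]
    rw [← sub_div, norm_div, Complex.norm_real, Real.norm_of_nonneg hs.le, div_le_iff₀ hs]
    refine hd'.trans ?_
    rw [← mul_assoc, mul_assoc M, ← pow_succ]
    gcongr
    linarith
  have hA₁ : 4 / 27 * b₁ ^ 3 + 1 ≠ 1 := by simp [hb₁]
  rcases Ultrafilter.eventually_or.1 hdich₁ with h₁ | h₁ <;>
    rcases Ultrafilter.eventually_or.1 hdich₂ with h₂ | h₂ <;>
    obtain ⟨heq, hsecond⟩ := compare_expansions hl bt₁ bt₂ bt h₁ h₂
  · exact absurd (by simpa using heq) hA₁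
  · exact absurd heq hA
  · have hA₁₂ : 4 / 27 * b₁ ^ 3 + 1 = 4 / 27 * b₂ ^ 3 + 1 := by simpa using heq
    refine ⟨by linear_combination 27 / 4 * hA₁₂, ?_⟩
    linear_combination (3 / 2) ^ 9 * hsecond hA₁₂.symm rfl rfl
  · exact absurd (mul_right_cancel₀ hA₂ (heq.trans (one_mul _).symm)) hA₁

/-- Near a nonzero complex number, the `n`-th power map is injective. -/
theorem eventually_pow_injective {n : ℕ} (hn : n ≠ 0) {z : ℂ} (hz : z ≠ 0) :
    ∀ᶠ p : ℂ × ℂ in nhds (z, z), p.1 ^ n = p.2 ^ n → p.1 = p.2 := by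
  have hcont : Continuous fun p : ℂ × ℂ =>
      ∑ i ∈ Finset.range n, p.1 ^ i * p.2 ^ (n - 1 - i) := by fun_prop
  have hne : ∑ i ∈ Finset.range n, z ^ i * z ^ (n - 1 - i) ≠ 0 := by
    rw [geom_sum₂_self]
    exact mul_ne_zero (Nat.cast_ne_zero.2 hn) (pow_ne_zero _ hz)
  filter_upwards [hcont.continuousAt.eventually_ne hne] with p hp heq
  have h := (Commute.all p.1 p.2).geom_sum₂_mul n
  rw [heq, sub_self] at h
  exact sub_eq_zero.1 ((mul_eq_zero.1 h).resolve_left hp)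

/-- If `b₀ ≠ 0`, `c₀ ≠ 0`, `4b₀³ + 27 ≠ 0` and `|(4/27)b₀³ + 1| ≠ 1`, then there is an
`ε > 0` such that any two distinct germs `f_{b₁,c₁} ≠ f_{b₂,c₂}` with parameters in the
ball of radius `ε` around `(b₀, c₀)` are not bi-Lipschitz right equivalent. -/
theorem J30_not_biLip_equivalent_near (m : ℕ) (b₀ c₀ : ℂ)
    (hb₀ : b₀ ≠ 0) (hc₀ : c₀ ≠ 0) (h₀ : 4 * b₀ ^ 3 + 27 ≠ 0)
    (habs : ‖(4 / 27 : ℂ) * b₀ ^ 3 + 1‖ ≠ 1) :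
    ∃ ε > (0 : ℝ), ∀ b₁ c₁ b₂ c₂ : ℂ,
      (b₁, c₁) ∈ Metric.ball ((b₀, c₀) : ℂ × ℂ) ε →
      (b₂, c₂) ∈ Metric.ball ((b₀, c₀) : ℂ × ℂ) ε →
      (b₁, c₁) ≠ (b₂, c₂) →
      ¬ BiLipREquiv (fJ b₁ c₁ m) (fJ b₂ c₂ m) := by
  have hbc : ∀ᶠ p : (ℂ × ℂ) × (ℂ × ℂ) in nhds ((b₀, c₀), (b₀, c₀)),
      p.1.1 ≠ 0 ∧ p.2.1 ≠ 0 ∧ 4 / 27 * p.2.1 ^ 3 + 1 ≠ 0 ∧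
      (4 / 27 * p.1.1 ^ 3 + 1) * (4 / 27 * p.2.1 ^ 3 + 1) ≠ 1 ∧
      (p.1.1 ^ 3 = p.2.1 ^ 3 → p.1.1 = p.2.1) ∧ (p.1.2 ^ 9 = p.2.2 ^ 9 → p.1.2 = p.2.2) := by
    have hA : 4 / 27 * b₀ ^ 3 + 1 ≠ 0 := fun h => h₀ (by linear_combination 27 * h)
    have hAA : (4 / 27 * b₀ ^ 3 + 1) * (4 / 27 * b₀ ^ 3 + 1) ≠ 1 := by
      intro h
      have hn : ‖(4 / 27 : ℂ) * b₀ ^ 3 + 1‖ ^ 2 = 1 := by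
        rw [← norm_pow, sq, h, norm_one]
      exact habs ((pow_eq_one_iff_of_nonneg (norm_nonneg _) two_ne_zero).1 hn)
    have e1 : Tendsto (fun p : (ℂ × ℂ) × (ℂ × ℂ) => (p.1.1, p.2.1))
        (nhds ((b₀, c₀), (b₀, c₀))) (nhds (b₀, b₀)) :=
      Continuous.tendsto (by fun_prop) ((b₀, c₀), (b₀, c₀))
    have e2 : Tendsto (fun p : (ℂ × ℂ) × (ℂ × ℂ) => (p.1.2, p.2.2))
        (nhds ((b₀, c₀), (b₀, c₀))) (nhds (c₀, c₀)) :=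
      Continuous.tendsto (by fun_prop) ((b₀, c₀), (b₀, c₀))
    refine .and ?_ (.and ?_ (.and ?_ (.and ?_
      (.and (e1.eventually (eventually_pow_injective three_ne_zero hb₀))
        (e2.eventually (eventually_pow_injective (by norm_num) hc₀))))))
    · exact ContinuousAt.eventually_ne (by fun_prop) hb₀
    · exact ContinuousAt.eventually_ne (by fun_prop) hb₀
    · exact ContinuousAt.eventually_ne (by fun_prop) hA
    · exact ContinuousAt.eventually_ne (by fun_prop) hAA
  obtain ⟨ε, hε, hball⟩ := Metric.eventually_nhds_iff_ball.1 hbc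
  refine ⟨ε, hε, fun b₁ c₁ b₂ c₂ h₁ h₂ hne hequiv => ?_⟩
  obtain ⟨hb₁, hb₂, hA₂, hAA, hb, hc⟩ := hball ((b₁, c₁), (b₂, c₂))
    (by rw [← ball_prod_same]; exact ⟨h₁, h₂⟩)
  obtain ⟨hb3, hbc9⟩ := hequiv.parameters hb₁ hb₂ hA₂ hAA
  obtain rfl : b₁ = b₂ := hb hb3
  rw [mul_pow, mul_pow] at hbc9
  obtain rfl : c₁ = c₂ := hc (mul_left_cancel₀ (pow_ne_zero 9 hb₁) hbc9)
  exact hne rfl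
end

section
/- Let f ∈ ℂ[x,y] be a polynomial with f(0,0) = 0 having an isolated singularity at 0, and suppose that every monomial x^i y^j occurring in f with nonzero coefficient satisfies 3i + j ≥ 9 (that is, fil_w(f) ≥ 9 for the weight w = (3,1)). Then f deforms to J_{3,0}: there exists a function F(x,y,t), analytic on a neighborhood of 0 in ℂ² × ℂ, with F(x,y,0) = f(x,y), such that for every ε > 0 there exist t ∈ ℂ with 0 < |t| < ε and b, c ∈ ℂ with 4b³ + 27 ≠ 0 for which the germ at 0 of (x,y) ↦ F(x,y,t) is right equivalent to the germ at 0 of x³ + b x² y³ + y⁹ + c x y⁷. -/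
open Filter MvPolynomial

/-- Evaluation of a polynomial in two variables at a point of `ℂ × ℂ`. -/
noncomputable def evalP (f : MvPolynomial (Fin 2) ℂ) (p : ℂ × ℂ) : ℂ :=
  MvPolynomial.eval ![p.1, p.2] f

/-- The germs at `0` of `g₁` and `g₂` are (smoothly/holomorphically) right equivalent:
there is a map `φ`, analytic on a neighborhood of `0`, with `φ 0 = 0` and invertible
derivative at `0`, such that `g₁ = g₂ ∘ φ` near `0`. -/
def RightEquiv (g₁ g₂ : ℂ × ℂ → ℂ) : Prop :=
  ∃ φ : ℂ × ℂ → ℂ × ℂ, φ 0 = 0 ∧ AnalyticAt ℂ φ 0 ∧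
    (∃ L : (ℂ × ℂ) ≃L[ℂ] ℂ × ℂ, fderiv ℂ φ 0 = (L : (ℂ × ℂ) →L[ℂ] ℂ × ℂ)) ∧
    ∀ᶠ p in nhds (0 : ℂ × ℂ), g₁ p = g₂ (φ p)

/-- The normal form `x³ + b x² y³ + y⁹ + c x y⁷` of the class `J_{3,0}`. -/
noncomputable def J30 (b c : ℂ) (p : ℂ × ℂ) : ℂ :=
  p.1 ^ 3 + b * p.1 ^ 2 * p.2 ^ 3 + p.2 ^ 9 + c * p.1 * p.2 ^ 7

/-- A polynomial all of whose monomials have weight at least `9` for the weights `(3, 1)` lies in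
the ideal `(x, y³)³`. -/
theorem exists_eq_of_weight_ge_nine (f : MvPolynomial (Fin 2) ℂ)
    (hfil : ∀ d ∈ f.support, 9 ≤ 3 * d 0 + d 1) :
    ∃ A B C D : MvPolynomial (Fin 2) ℂ,
      f = A * X 0 ^ 3 + B * (X 0 ^ 2 * X 1 ^ 3) + C * (X 0 * X 1 ^ 6) + D * X 1 ^ 9 := by
  obtain ⟨I, hI⟩ : ∃ I : Ideal (MvPolynomial (Fin 2) ℂ),
      I = Ideal.span {X 0 ^ 3, X 0 ^ 2 * X 1 ^ 3, X 0 * X 1 ^ 6, X 1 ^ 9} := ⟨_, rfl⟩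
  have hmem : f ∈ I := by
    have key : ∀ (d : Fin 2 →₀ ℕ) (i j : ℕ), i ≤ d 0 → j ≤ d 1 →
        (X 0 ^ i * X 1 ^ j : MvPolynomial (Fin 2) ℂ) ∈ I → monomial d (coeff d f) ∈ I := by
      intro d i j hi hj h
      rw [monomial_eq, Finsupp.prod_fintype _ _ (fun _ => pow_zero _), Fin.prod_univ_two]
      exact I.mul_mem_left _
        (I.mem_of_dvd (mul_dvd_mul (pow_dvd_pow _ hi) (pow_dvd_pow _ hj)) h)
    have g0 : (X 0 ^ 0 * X 1 ^ 9 : MvPolynomial (Fin 2) ℂ) ∈ I := by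
      rw [hI, pow_zero, one_mul]; exact Ideal.subset_span (by simp)
    have g1 : (X 0 ^ 1 * X 1 ^ 6 : MvPolynomial (Fin 2) ℂ) ∈ I := by
      rw [hI, pow_one]; exact Ideal.subset_span (by simp)
    have g2 : (X 0 ^ 2 * X 1 ^ 3 : MvPolynomial (Fin 2) ℂ) ∈ I := by
      rw [hI]; exact Ideal.subset_span (by simp)
    have g3 : (X 0 ^ 3 * X 1 ^ 0 : MvPolynomial (Fin 2) ℂ) ∈ I := by
      rw [hI, pow_zero, mul_one]; exact Ideal.subset_span (by simp)
    rw [f.as_sum]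
    refine I.sum_mem fun d hd => ?_
    have h9 := hfil d hd
    rcases Nat.lt_or_ge (d 0) 1 with h1 | h1
    · exact key d 0 9 (by omega) (by omega) g0
    rcases Nat.lt_or_ge (d 0) 2 with h2 | h2
    · exact key d 1 6 (by omega) (by omega) g1
    rcases Nat.lt_or_ge (d 0) 3 with h3 | h3
    · exact key d 2 3 (by omega) (by omega) g2
    · exact key d 3 0 (by omega) (by omega) g3
  rw [hI] at hmem
  obtain ⟨A, g, hg, hf⟩ := Ideal.mem_span_insert.1 hmem
  obtain ⟨B, g', hg', hgg'⟩ := Ideal.mem_span_insert.1 hg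
  obtain ⟨C, D, hCD⟩ := Ideal.mem_span_pair.1 hg'
  exact ⟨A, B, C, D, by rw [hf, hgg', ← hCD, add_assoc, add_assoc]⟩

/-- The discriminant of the binary cubic form `a x³ + b x² z + c x z² + d z³`. -/
def cubicDisc (a b c d : ℂ) : ℂ :=
  18 * a * b * c * d - 4 * b ^ 3 * d + b ^ 2 * c ^ 2 - 4 * a * c ^ 3 - 27 * a ^ 2 * d ^ 2

/-- A generic binary cubic form in `(x, y³)` becomes `x³ + b₀ x² y³ + y⁹` after the substitution
`x ↦ α x + β y³`, `y ↦ γ y`. -/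
theorem exists_cubic_normal_form {a b c d : ℂ} (ha : a ≠ 0) (hbac : b ^ 2 - 3 * a * c ≠ 0)
    (hdisc : cubicDisc a b c d ≠ 0) :
    ∃ α β γ b₀ : ℂ, α ≠ 0 ∧ γ ≠ 0 ∧ b₀ ≠ 0 ∧ 4 * b₀ ^ 3 + 27 ≠ 0 ∧ α ^ 3 * a = 1 ∧
      3 * α ^ 2 * β * a + α ^ 2 * γ ^ 3 * b = b₀ ∧
      3 * α * β ^ 2 * a + 2 * α * β * γ ^ 3 * b + α * γ ^ 6 * c = 0 ∧
      β ^ 3 * a + β ^ 2 * γ ^ 3 * b + β * γ ^ 6 * c + γ ^ 9 * d = 1 := by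
  obtain ⟨α, hα⟩ := IsAlgClosed.exists_pow_nat_eq (a⁻¹) (n := 3) (by norm_num)
  obtain ⟨r, hr⟩ := IsAlgClosed.exists_pow_nat_eq (b ^ 2 - 3 * a * c) (n := 2) (by norm_num)
  obtain ⟨κ, hκ⟩ : ∃ κ, 3 * a * κ + b = r := ⟨(r - b) / (3 * a), by field_simp; ring⟩
  have hcrit : 3 * a * κ ^ 2 + 2 * b * κ + c = 0 := by
    have : 3 * a * (3 * a * κ ^ 2 + 2 * b * κ + c) = 0 := by
      rw [← hκ] at hr; linear_combination hr
    exact (mul_eq_zero.1 this).resolve_left (by simpa using ha)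
  obtain ⟨D, hD⟩ : ∃ D, D = a * κ ^ 3 + b * κ ^ 2 + c * κ + d := ⟨_, rfl⟩
  have hfactor : cubicDisc a b c d = -D * (4 * r ^ 3 + 27 * a ^ 2 * D) := by
    obtain rfl : c = -(3 * a * κ ^ 2 + 2 * b * κ) := by linear_combination hcrit
    subst hD hκ
    unfold cubicDisc
    ring
  rw [hfactor] at hdisc
  have hD0 : D ≠ 0 := by rintro rfl; simp at hdisc
  have hr27 : 4 * r ^ 3 + 27 * a ^ 2 * D ≠ 0 := right_ne_zero_of_mul hdisc
  have hr0 : r ≠ 0 := by rintro rfl; simp at hr; exact hbac hr.symm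
  obtain ⟨γ, hγ⟩ := IsAlgClosed.exists_pow_nat_eq (D⁻¹) (n := 9) (by norm_num)
  have hα1 : α ^ 3 * a = 1 := by rw [hα]; field_simp
  have hγ1 : γ ^ 9 * D = 1 := by rw [hγ]; field_simp
  have hα0 : α ≠ 0 := by rintro rfl; simp at hα1
  have hγ0 : γ ≠ 0 := by rintro rfl; simp at hγ1
  refine ⟨α, κ * γ ^ 3, γ, α ^ 2 * γ ^ 3 * r, hα0, hγ0, by positivity, ?_, hα1, ?_, ?_, ?_⟩
  · have : (a ^ 2 * D) * (4 * (α ^ 2 * γ ^ 3 * r) ^ 3 + 27) = 4 * r ^ 3 + 27 * a ^ 2 * D := by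
      linear_combination 4 * r ^ 3 * ((α ^ 3 * a + 1) * γ ^ 9 * D * hα1 + hγ1)
    exact right_ne_zero_of_mul (this ▸ hr27)
  · rw [← hκ]; ring
  · linear_combination α * γ ^ 6 * hcrit
  · rw [hD] at hγ1; linear_combination hγ1

/-- Moving a binary cubic form linearly towards `x³ + x² z + z³` makes it generic for small
`t ≠ 0`. -/
theorem eventually_generic_cubic (a b c d : ℂ) :
    ∀ᶠ t in nhdsWithin (0 : ℂ) {0}ᶜ, a + t * (1 - a) ≠ 0 ∧
      (b + t * (1 - b)) ^ 2 - 3 * (a + t * (1 - a)) * (c + t * (0 - c)) ≠ 0 ∧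
      cubicDisc (a + t * (1 - a)) (b + t * (1 - b)) (c + t * (0 - c)) (d + t * (1 - d)) ≠ 0 := by
  have key : ∀ P : Polynomial ℂ, P.eval 1 ≠ 0 →
      ∀ᶠ t in nhdsWithin (0 : ℂ) {0}ᶜ, P.eval t ≠ 0 := by
    intro P hP1
    have hP : P ≠ 0 := by rintro rfl; simp at hP1
    have hfin : (P.roots.toFinset \ {0} : Set ℂ).Finite := Set.toFinite _
    filter_upwards [self_mem_nhdsWithin, nhdsWithin_le_nhds
      (hfin.isClosed.isOpen_compl.mem_nhds (by simp : (0 : ℂ) ∈ _))] with t ht0 ht h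
    exact ht ⟨by simpa [hP] using h, ht0⟩
  obtain ⟨L, hL⟩ : ∃ L : ℂ → ℂ → Polynomial ℂ, ∀ u v t, (L u v).eval t = u + t * (v - u) :=
    ⟨fun u v => Polynomial.C u + Polynomial.X * Polynomial.C (v - u), fun u v t => by simp⟩
  have h1 := key (L a 1) (by simp [hL])
  have h2 := key (L b 1 ^ 2 - 3 * L a 1 * L c 0) (by simp [hL])
  have h3 := key (18 * L a 1 * L b 1 * L c 0 * L d 1 - 4 * L b 1 ^ 3 * L d 1
    + L b 1 ^ 2 * L c 0 ^ 2 - 4 * L a 1 * L c 0 ^ 3 - 27 * L a 1 ^ 2 * L d 1 ^ 2)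
    (by simp [hL]; norm_num)
  filter_upwards [h1, h2, h3] with t h1 h2 h3
  simp only [Polynomial.eval_sub, Polynomial.eval_add, Polynomial.eval_mul, Polynomial.eval_pow,
    Polynomial.eval_ofNat, hL] at h1 h2 h3
  exact ⟨h1, h2, h3⟩

section Solve

variable {𝒜 : Type*} [NormedCommRing 𝒜] [NormedAlgebra ℂ 𝒜]

/-- For `X = u x + v y³` and `Y = w y + s x`, the coefficients of `x³`, `x² y³`, `x y⁶`, `y⁹` in
`X³ + b X² Y³ + Y⁹ + c X Y⁷`, modified by `q` times the syzygy `y³ · (x² y³) = x · (x y⁶)`. -/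
noncomputable def pullbackCoeffs (x y : 𝒜) (m : 𝒜 × 𝒜 × 𝒜 × 𝒜 × 𝒜 × ℂ × ℂ) : 𝒜 × 𝒜 × 𝒜 × 𝒜 :=
  let u := m.1
  let v := m.2.1
  let w := m.2.2.1
  let s := m.2.2.2.1
  let q := m.2.2.2.2.1
  let b := algebraMap ℂ 𝒜 m.2.2.2.2.2.1
  let c := algebraMap ℂ 𝒜 m.2.2.2.2.2.2
  let R := 3 * w ^ 2 * s * y ^ 2 + 3 * w * s ^ 2 * x * y + s ^ 3 * x ^ 2
  let W := w ^ 3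
  let Y := w * y + s * x
  (u ^ 3 + b * u ^ 2 * R + R ^ 3 + c * Y * u * R ^ 2,
   3 * u ^ 2 * v + b * (u ^ 2 * W + 2 * u * v * R) + 3 * R ^ 2 * W
      + c * Y * (2 * u * R * W + v * R ^ 2) + y ^ 3 * q,
   3 * u * v ^ 2 + b * (2 * u * v * W + v ^ 2 * R) + 3 * R * W ^ 2
      + c * Y * (u * W ^ 2 + 2 * v * R * W) - x * q,
   v ^ 3 + b * v ^ 2 * W + W ^ 3 + c * Y * v * W ^ 2)

theorem eq_of_pullbackCoeffs_eq {x y u v w s q A B C D : 𝒜} {b c : ℂ}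
    (h : pullbackCoeffs x y (u, v, w, s, q, b, c) = (A, B, C, D)) :
    A * x ^ 3 + B * (x ^ 2 * y ^ 3) + C * (x * y ^ 6) + D * y ^ 9 =
      (u * x + v * y ^ 3) ^ 3
        + algebraMap ℂ 𝒜 b * (u * x + v * y ^ 3) ^ 2 * (w * y + s * x) ^ 3
        + (w * y + s * x) ^ 9
        + algebraMap ℂ 𝒜 c * (u * x + v * y ^ 3) * (w * y + s * x) ^ 7 := by
  simp only [pullbackCoeffs, Prod.mk.injEq] at h
  obtain ⟨rfl, rfl, rfl, rfl⟩ := h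
  ring

theorem contDiff_pullbackCoeffs (x y : 𝒜) : ContDiff ℂ 1 (pullbackCoeffs x y) := by
  have hmap : ContDiff ℂ 1 (algebraMap ℂ 𝒜) := (algebraMapCLM ℂ 𝒜).contDiff
  unfold pullbackCoeffs
  fun_prop

theorem hasDerivAt_pullbackCoeffs (x y du dv dw ds dq : 𝒜) (b₀ db dc : ℂ) :
    HasDerivAt (fun t : ℂ => pullbackCoeffs x y
        ((1, 0, 1, 0, 0, b₀, 0) + t • (du, dv, dw, ds, dq, db, dc)))
      (3 * du + 3 * algebraMap ℂ 𝒜 b₀ * y ^ 2 * ds,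
       3 * dv + 2 * algebraMap ℂ 𝒜 b₀ * du + 3 * algebraMap ℂ 𝒜 b₀ * dw + algebraMap ℂ 𝒜 db
        + y ^ 3 * dq,
       2 * algebraMap ℂ 𝒜 b₀ * dv + 9 * y ^ 2 * ds + algebraMap ℂ 𝒜 dc * y - x * dq,
       9 * dw) 0 := by
  have lin : ∀ e de : 𝒜, HasDerivAt (fun t : ℂ => e + t • de) de 0 := fun e de => by
    simpa using ((hasDerivAt_id (0 : ℂ)).smul_const de).const_add e
  have lin' : ∀ k dk : ℂ, HasDerivAt (fun t : ℂ => algebraMap ℂ 𝒜 (k + t * dk))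
      (algebraMap ℂ 𝒜 dk) 0 := fun k dk => by
    have := lin (algebraMap ℂ 𝒜 k) (algebraMap ℂ 𝒜 dk)
    refine this.congr_of_eventuallyEq (.of_forall fun t => ?_)
    simp [Algebra.smul_def]
  have hu := lin 1 du
  have hv := lin 0 dv
  have hw := lin 1 dw
  have hs := lin 0 ds
  have hq := lin 0 dq
  have hb := lin' b₀ db
  have hc := lin' 0 dc
  have three : HasDerivAt (fun _ : ℂ => (3 : 𝒜)) 0 0 := hasDerivAt_const _ _
  have two : HasDerivAt (fun _ : ℂ => (2 : 𝒜)) 0 0 := hasDerivAt_const _ _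
  have hx : HasDerivAt (fun _ : ℂ => x) 0 0 := hasDerivAt_const _ _
  have hy : HasDerivAt (fun _ : ℂ => y) 0 0 := hasDerivAt_const _ _
  have hW := hw.fun_pow 3
  have hY := (hw.fun_mul hy).fun_add (hs.fun_mul hx)
  have hR := ((((three.fun_mul (hw.fun_pow 2)).fun_mul hs).fun_mul (hy.fun_pow 2)).fun_add
    ((((three.fun_mul hw).fun_mul (hs.fun_pow 2)).fun_mul hx).fun_mul hy)).fun_add
    ((hs.fun_pow 3).fun_mul (hx.fun_pow 2))
  have hcY := hc.fun_mul hY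
  have h1 := (((hu.fun_pow 3).fun_add ((hb.fun_mul (hu.fun_pow 2)).fun_mul hR)).fun_add
    (hR.fun_pow 3)).fun_add ((hcY.fun_mul hu).fun_mul (hR.fun_pow 2))
  have h2 := (((((three.fun_mul (hu.fun_pow 2)).fun_mul hv).fun_add
    (hb.fun_mul (((hu.fun_pow 2).fun_mul hW).fun_add
      (((two.fun_mul hu).fun_mul hv).fun_mul hR)))).fun_add
    ((three.fun_mul (hR.fun_pow 2)).fun_mul hW)).fun_add
    (hcY.fun_mul ((((two.fun_mul hu).fun_mul hR).fun_mul hW).fun_add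
      (hv.fun_mul (hR.fun_pow 2))))).fun_add ((hy.fun_pow 3).fun_mul hq)
  have h3 := (((((three.fun_mul hu).fun_mul (hv.fun_pow 2)).fun_add
    (hb.fun_mul ((((two.fun_mul hu).fun_mul hv).fun_mul hW).fun_add
      ((hv.fun_pow 2).fun_mul hR)))).fun_add
    ((three.fun_mul hR).fun_mul (hW.fun_pow 2))).fun_add
    (hcY.fun_mul ((hu.fun_mul (hW.fun_pow 2)).fun_add
      (((two.fun_mul hv).fun_mul hR).fun_mul hW)))).fun_sub (hx.fun_mul hq)
  have h4 := (((hv.fun_pow 3).fun_add ((hb.fun_mul (hv.fun_pow 2)).fun_mul hW)).fun_add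
    (hW.fun_pow 3)).fun_add ((hcY.fun_mul hv).fun_mul (hW.fun_pow 2))
  refine HasDerivAt.congr_deriv (h1.prodMk (h2.prodMk (h3.prodMk h4))) ?_
  simp only [zero_smul, add_zero, zero_mul, map_zero, Prod.mk.injEq]
  refine ⟨?_, ?_, ?_, ?_⟩ <;> norm_num <;> ring

/-- Every coefficient vector near that of `x³ + b₀ x² y³ + y⁹` is attained near the identity. -/
theorem map_nhds_pullbackCoeffs [CompleteSpace 𝒜] {x y : 𝒜}
    (hdiv : ∀ e : 𝒜, ∃ k l : ℂ, ∃ s p : 𝒜,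
      e = algebraMap ℂ 𝒜 k + algebraMap ℂ 𝒜 l * y + y ^ 2 * s + x * p)
    {b₀ : ℂ} (hb₀ : b₀ ≠ 0) (h27 : 4 * b₀ ^ 3 + 27 ≠ 0) :
    map (pullbackCoeffs x y) (nhds (1, 0, 1, 0, 0, b₀, 0)) =
      nhds (1, algebraMap ℂ 𝒜 b₀, 0, 1) := by
  have hstrict := (contDiff_pullbackCoeffs x y).contDiffAt.hasStrictFDerivAt
    (x := (1, 0, 1, 0, 0, b₀, 0)) one_ne_zero
  rw [hstrict.map_nhds_eq_of_surj ?_]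
  · simp [pullbackCoeffs]
  rw [LinearMap.range_eq_top]
  rintro ⟨a₁, a₂, a₃, a₄⟩
  obtain ⟨k, l, s', p, hdec⟩ := hdiv (a₃ - algebraMap ℂ 𝒜 (2 * b₀ / 3) *
    (a₂ - algebraMap ℂ 𝒜 (b₀ / 3) * a₄ - algebraMap ℂ 𝒜 (2 * b₀ / 3) * a₁))
  obtain ⟨β, hβ⟩ : ∃ β, β = algebraMap ℂ 𝒜 b₀ := ⟨_, rfl⟩
  obtain ⟨θ, hθ⟩ : ∃ θ, θ = algebraMap ℂ 𝒜 (1 / 3) := ⟨_, rfl⟩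
  obtain ⟨τ, hτ⟩ : ∃ τ, τ = algebraMap ℂ 𝒜 (3 / (4 * b₀ ^ 3 + 27)) := ⟨_, rfl⟩
  have hθ3 : 3 * θ = 1 := by
    rw [hθ, ← map_ofNat (algebraMap ℂ 𝒜) 3, ← map_mul]; norm_num
  have hτ1 : (4 * β ^ 3 + 27) * τ = 3 := by
    rw [hτ, hβ, ← map_ofNat (algebraMap ℂ 𝒜) 4, ← map_ofNat (algebraMap ℂ 𝒜) 27,
      ← map_ofNat (algebraMap ℂ 𝒜) 3, ← map_pow, ← map_mul, ← map_add, ← map_mul,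
      mul_div_cancel₀ _ h27]
  have hdb : 2 * β * algebraMap ℂ 𝒜 (-(3 / (2 * b₀)) * k) = -3 * algebraMap ℂ 𝒜 k := by
    rw [hβ, ← map_ofNat (algebraMap ℂ 𝒜) 2, ← map_ofNat (algebraMap ℂ 𝒜) 3, ← map_neg,
      ← map_mul, ← map_mul, ← map_mul]
    congr 1
    field_simp
  have e1 : algebraMap ℂ 𝒜 (2 * b₀ / 3) = 2 * β * θ := by
    rw [hβ, hθ, ← map_ofNat (algebraMap ℂ 𝒜) 2, ← map_mul, ← map_mul]; congr 1; ring
  have e2 : algebraMap ℂ 𝒜 (b₀ / 3) = β * θ := by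
    rw [hβ, hθ, ← map_mul]; congr 1; ring
  rw [e1, e2] at hdec
  obtain ⟨δ, hδ⟩ : ∃ δ, δ = algebraMap ℂ 𝒜 (-(3 / (2 * b₀)) * k) := ⟨_, rfl⟩
  rw [← hδ] at hdb
  obtain ⟨ds, hds⟩ : ∃ ds, ds = τ * (s' - 2 * β * θ * y * p) := ⟨_, rfl⟩
  obtain ⟨du, hdu⟩ : ∃ du, du = θ * a₁ - β * y ^ 2 * ds := ⟨_, rfl⟩
  obtain ⟨dv, hdv⟩ : ∃ dv, dv = θ * (a₂ - θ * β * a₄ - 2 * β * du - δ + y ^ 3 * p) := ⟨_, rfl⟩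
  refine ⟨(du, dv, θ ^ 2 * a₄, ds, -p, -(3 / (2 * b₀)) * k, l), ?_⟩
  have hline := ((hasDerivAt_id (0 : ℂ)).smul_const
    (du, dv, θ ^ 2 * a₄, ds, -p, -(3 / (2 * b₀)) * k, l)).const_add
    ((1, 0, 1, 0, 0, b₀, 0) : 𝒜 × 𝒜 × 𝒜 × 𝒜 × 𝒜 × ℂ × ℂ)
  have hcomp := HasFDerivAt.comp_hasDerivAt_of_eq (0 : ℂ) hstrict.hasFDerivAt hline (by simp)
  rw [one_smul] at hcomp
  refine (hcomp.unique (hasDerivAt_pullbackCoeffs x y _ _ _ _ _ _ _ _)).trans ?_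
  rw [← hδ, ← hβ]
  simp only [Prod.mk.injEq]
  have hds' : y ^ 2 * ds * ((4 * β ^ 3 + 27) * θ) = y ^ 2 * s' - 2 * β * θ * y ^ 3 * p := by
    rw [hds]
    linear_combination θ * y ^ 2 * (s' - 2 * β * θ * y * p) * hτ1
      + y ^ 2 * (s' - 2 * β * θ * y * p) * hθ3
  refine ⟨?_, ?_, ?_, ?_⟩
  · rw [hdu]; linear_combination a₁ * hθ3
  · rw [hdv]
    linear_combination (a₂ - 2 * β * du - δ + y ^ 3 * p) * hθ3
  · rw [hdv, hdu]
    linear_combination -hdec + hds' - 9 * y ^ 2 * ds * hθ3 - θ * hdb + algebraMap ℂ 𝒜 k * hθ3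
  · linear_combination a₄ * (3 * θ + 1) * hθ3

end Solve

/-- The closed unit bidisc. -/
abbrev Bidisc : Type := Metric.closedBall (0 : Fin 2 → ℂ) 1

namespace Bidisc

theorem norm_apply_le (p : Bidisc) (i : Fin 2) : ‖p.1 i‖ ≤ 1 :=
  (norm_le_pi_norm p.1 i).trans (mem_closedBall_zero_iff.1 p.2)

/-- Replace the `i`-th coordinate. -/
def replace (p : Bidisc) (i : Fin 2) (z : ℂ) (hz : ‖z‖ ≤ 1) : Bidisc :=
  ⟨Function.update p.1 i z, mem_closedBall_zero_iff.2 <|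
    (pi_norm_le_iff_of_nonneg zero_le_one).2 fun j => by
      rcases eq_or_ne j i with rfl | h
      · simpa using hz
      · simpa [h] using norm_apply_le p j⟩

/-- The projection of the bidisc setting the `i`-th coordinate to zero. -/
def zeroAt (i : Fin 2) : C(Bidisc, Bidisc) where
  toFun p := p.replace i 0 (by simp)
  continuous_toFun := Continuous.subtype_mk (by fun_prop) _

/-- The `i`-th coordinate function. -/
def coord (i : Fin 2) : C(Bidisc, ℂ) where
  toFun p := p.1 i
  continuous_toFun := (continuous_apply i).comp continuous_subtype_val

/-- The bidisc algebra: uniform limits of polynomials on the closed bidisc. -/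
noncomputable def discAlgebra : Subalgebra ℂ C(Bidisc, ℂ) :=
  (Algebra.adjoin ℂ (Set.range coord)).topologicalClosure

theorem coord_mem (i : Fin 2) : coord i ∈ discAlgebra :=
  Subalgebra.le_topologicalClosure _ (Algebra.subset_adjoin ⟨i, rfl⟩)

/-- The `i`-th coordinate as an element of the bidisc algebra. -/
noncomputable def var (i : Fin 2) : discAlgebra := ⟨coord i, coord_mem i⟩

instance : CompleteSpace discAlgebra :=
  (Subalgebra.isClosed_topologicalClosure _).completeSpace_coe

theorem norm_apply_le_norm_coord_mul (i : Fin 2) (g : C(Bidisc, ℂ)) (hg : g ∈ discAlgebra)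
    (p : Bidisc) : ‖g p‖ ≤ ‖coord i * g‖ := by
  have hclosed : IsClosed {g : C(Bidisc, ℂ) | ‖g p‖ ≤ ‖coord i * g‖} :=
    isClosed_le (by fun_prop) (by fun_prop)
  refine closure_minimal (fun g hg => ?_) hclosed hg
  obtain ⟨h, hh, hgh⟩ : ∃ h : ℂ → ℂ, Differentiable ℂ h ∧
      ∀ z (hz : ‖z‖ ≤ 1), h z = g (p.replace i z hz) := by
    induction hg using Algebra.adjoin_induction with
    | mem g hg =>
      obtain ⟨j, rfl⟩ := hg
      refine ⟨fun z => Function.update p.1 i z j, ?_, fun z hz => rfl⟩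
      rcases eq_or_ne j i with rfl | h
      · simp
      · simp [h]
    | algebraMap k => exact ⟨fun _ => k, by fun_prop, fun z hz => rfl⟩
    | add g₁ g₂ _ _ ih₁ ih₂ =>
      obtain ⟨h₁, d₁, e₁⟩ := ih₁
      obtain ⟨h₂, d₂, e₂⟩ := ih₂
      exact ⟨fun z => h₁ z + h₂ z, d₁.add d₂, fun z hz => by simp [e₁ z hz, e₂ z hz]⟩
    | mul g₁ g₂ _ _ ih₁ ih₂ =>
      obtain ⟨h₁, d₁, e₁⟩ := ih₁
      obtain ⟨h₂, d₂, e₂⟩ := ih₂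
      exact ⟨fun z => h₁ z * h₂ z, d₁.mul d₂, fun z hz => by simp [e₁ z hz, e₂ z hz]⟩
  have hmax := Complex.norm_le_of_forall_mem_frontier_norm_le (U := Metric.ball (0 : ℂ) 1)
    (C := ‖coord i * g‖) (z := p.1 i) Metric.isBounded_ball hh.diffContOnCl (fun z hz => by
      rw [frontier_ball _ one_ne_zero, mem_sphere_zero_iff_norm] at hz
      have := (coord i * g).norm_coe_le_norm (p.replace i z hz.le)
      rw [ContinuousMap.mul_apply, norm_mul] at this
      simpa [coord, replace, hz, hgh z hz.le] using this) (by
      rw [closure_ball _ one_ne_zero]; simpa using norm_apply_le p i)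
  rw [hgh _ (norm_apply_le p i)] at hmax
  convert! hmax
  simp [replace]

/-- Multiplication by a coordinate is isometric on the bidisc algebra. -/
theorem norm_var_mul (i : Fin 2) (g : discAlgebra) : ‖var i * g‖ = ‖g‖ := by
  refine le_antisymm ?_ ?_
  · refine (norm_mul_le _ _).trans (mul_le_of_le_one_left (norm_nonneg _) ?_)
    exact (ContinuousMap.norm_le _ zero_le_one).2 fun p => norm_apply_le p i
  · exact (ContinuousMap.norm_le _ (norm_nonneg _)).2
      (norm_apply_le_norm_coord_mul i g.1 g.2)

/-- Multiplication by a coordinate as a linear isometry. -/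
noncomputable def mulVar (i : Fin 2) : discAlgebra →ₗᵢ[ℂ] discAlgebra where
  toLinearMap := LinearMap.mulLeft ℂ (var i)
  norm_map' := norm_var_mul i

theorem exists_sub_comp_zeroAt_eq (i : Fin 2) (g : discAlgebra) :
    ∃ d : discAlgebra, g.1 - g.1.comp (zeroAt i) = coord i * d.1 := by
  have hiso : Isometry fun d : discAlgebra => (mulVar i d).1 :=
    isometry_subtype_coe.comp (mulVar i).isometry
  have hclosed : IsClosed {g : C(Bidisc, ℂ) |
      g - g.comp (zeroAt i) ∈ Set.range fun d : discAlgebra => (mulVar i d).1} :=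
    hiso.isClosedEmbedding.isClosed_range.preimage
      (continuous_id.sub (zeroAt i).continuous_precomp)
  suffices h : g.1 ∈ {g : C(Bidisc, ℂ) |
      g - g.comp (zeroAt i) ∈ Set.range fun d : discAlgebra => (mulVar i d).1} by
    obtain ⟨d, hd⟩ := h
    exact ⟨d, hd.symm⟩
  refine closure_minimal (fun g hg => ?_) hclosed g.2
  suffices h : ∃ d ∈ discAlgebra, ∀ p, g p = g (zeroAt i p) + p.1 i * d p by
    obtain ⟨d, hd, h⟩ := h
    refine ⟨⟨d, hd⟩, ContinuousMap.ext fun p => ?_⟩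
    exact (eq_sub_of_add_eq' (h p).symm)
  have hle := Subalgebra.le_topologicalClosure (Algebra.adjoin ℂ (Set.range coord))
  induction hg using Algebra.adjoin_induction with
  | mem g hg =>
    obtain ⟨j, rfl⟩ := hg
    rcases eq_or_ne j i with rfl | h
    · exact ⟨1, one_mem _, fun p => by simp [coord, zeroAt, replace]⟩
    · exact ⟨0, zero_mem _, fun p => by simp [coord, zeroAt, replace, h]⟩
  | algebraMap k => exact ⟨0, zero_mem _, fun p => by simp⟩
  | add g₁ g₂ _ _ ih₁ ih₂ =>
    obtain ⟨d₁, m₁, e₁⟩ := ih₁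
    obtain ⟨d₂, m₂, e₂⟩ := ih₂
    refine ⟨d₁ + d₂, add_mem m₁ m₂, fun p => ?_⟩
    simp only [ContinuousMap.add_apply]
    linear_combination e₁ p + e₂ p
  | mul g₁ g₂ hg₁ hg₂ ih₁ ih₂ =>
    obtain ⟨d₁, m₁, e₁⟩ := ih₁
    obtain ⟨d₂, m₂, e₂⟩ := ih₂
    refine ⟨d₁ * g₂ + (g₁ - coord i * d₁) * d₂, add_mem (mul_mem m₁ (hle hg₂))
      (mul_mem (sub_mem (hle hg₁) (mul_mem (coord_mem i) m₁)) m₂), fun p => ?_⟩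
    simp only [ContinuousMap.add_apply, ContinuousMap.mul_apply, ContinuousMap.sub_apply]
    rw [show coord i p = p.1 i from rfl]
    linear_combination g₂ p * e₁ p + g₁ (zeroAt i p) * e₂ p - p.1 i * d₂ p * e₁ p

theorem norm_le_of_sub_comp_zeroAt_eq {i : Fin 2} {g d : discAlgebra}
    (h : g.1 - g.1.comp (zeroAt i) = coord i * d.1) : ‖d‖ ≤ 2 * ‖g‖ := by
  have hcomp : ‖g.1.comp (zeroAt i)‖ ≤ ‖g.1‖ :=
    (ContinuousMap.norm_le _ (norm_nonneg _)).2 fun p => g.1.norm_coe_le_norm _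
  have hd : ‖coord i * d.1‖ = ‖d‖ := norm_var_mul i d
  rw [← hd, ← h, two_mul]
  exact (norm_sub_le _ _).trans (add_le_add_right hcomp _)

/-- Division by a coordinate is a bounded operator on the bidisc algebra. -/
theorem exists_divVar (i : Fin 2) : ∃ L : discAlgebra →L[ℂ] discAlgebra, ∀ g : discAlgebra,
    ∀ p, g.1 p = g.1 (zeroAt i p) + p.1 i * (L g).1 p := by
  choose d hd using exists_sub_comp_zeroAt_eq i
  have hinj : ∀ e e' : discAlgebra, coord i * e.1 = coord i * e'.1 → e = e' := fun e e' h =>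
    (mulVar i).injective (Subtype.ext h)
  have hadd : ∀ g h, d (g + h) = d g + d h := fun g h => hinj _ _ (by
    rw [← hd]
    simp only [Subalgebra.coe_add, mul_add, ← hd, ContinuousMap.add_comp]
    abel)
  have hsmul : ∀ (k : ℂ) g, d (k • g) = k • d g := fun k g => hinj _ _ (by
    rw [← hd]
    simp only [Subalgebra.coe_smul, mul_smul_comm, ← hd, ContinuousMap.smul_comp, smul_sub])
  have hbound : ∀ g, ‖d g‖ ≤ 2 * ‖g‖ := fun g => norm_le_of_sub_comp_zeroAt_eq (hd g)
  exact ⟨LinearMap.mkContinuous ⟨⟨d, hadd⟩, hsmul⟩ 2 hbound, fun g p =>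
    sub_eq_iff_eq_add'.1 (DFunLike.congr_fun (hd g) p)⟩

/-- The origin of the bidisc. -/
def origin : Bidisc := ⟨0, by simp⟩

theorem zeroAt_zeroAt {i j : Fin 2} (hij : i ≠ j) (p : Bidisc) :
    zeroAt i (zeroAt j p) = origin := by
  refine Subtype.ext (funext fun k => ?_)
  rcases eq_or_ne k i with rfl | hk
  · simp [zeroAt, replace, origin]
  · obtain rfl : k = j := by omega
    simp [zeroAt, replace, origin, hk]

section Resolvent

variable {E : Type*} [NormedAddCommGroup E] [NormedSpace ℂ E]

theorem analyticAt_inverse_one_sub_smul [CompleteSpace E] (L : E →L[ℂ] E) (π : ℂ × ℂ →L[ℂ] ℂ) :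
    AnalyticAt ℂ (fun q : ℂ × ℂ => Ring.inverse (1 - π q • L)) 0 := by
  refine AnalyticAt.fun_comp (f := fun q => 1 - π q • L) (g := Ring.inverse) ?_ ?_
  · simpa using analyticAt_inverse (𝕜 := ℂ) (1 : (E →L[ℂ] E)ˣ)
  · exact analyticAt_const.sub ((π.analyticAt 0).smul analyticAt_const)

theorem eventually_isUnit_one_sub_smul [CompleteSpace E] (L : E →L[ℂ] E) (π : ℂ × ℂ →L[ℂ] ℂ) :
    ∀ᶠ q in nhds (0 : ℂ × ℂ), IsUnit (1 - π q • L) := by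
  have hc : Continuous fun q : ℂ × ℂ => 1 - π q • L := by fun_prop
  exact hc.continuousAt.eventually (Units.isOpen.mem_nhds (by simp))

theorem eval_eq_eval_inverse (χ : Bidisc → E →L[ℂ] ℂ) {i : Fin 2} {L : E →L[ℂ] E}
    (hL : ∀ g p, χ p g = χ (zeroAt i p) g + p.1 i * χ p (L g)) {k : ℂ} {p : Bidisc}
    (hk : p.1 i = k) (hu : IsUnit (1 - k • L)) (e : E) :
    χ p e = χ (zeroAt i p) (Ring.inverse (1 - k • L) e) := by
  have he : Ring.inverse (1 - k • L) e - k • L (Ring.inverse (1 - k • L) e) = e :=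
    DFunLike.congr_fun (Ring.mul_inverse_cancel _ hu) e
  have h := congrArg (χ p) he
  rw [map_sub, map_smul, smul_eq_mul, hL _ p, hk, add_sub_cancel_right] at h
  exact h.symm

/-- A Banach space of functions on the bidisc that is stable under bounded division by the
coordinates consists of functions analytic at the origin. -/
theorem exists_analyticAt_of_division [CompleteSpace E] (χ : Bidisc → E →L[ℂ] ℂ)
    {L₀ L₁ : E →L[ℂ] E}
    (hL₀ : ∀ g p, χ p g = χ (zeroAt 0 p) g + p.1 0 * χ p (L₀ g))
    (hL₁ : ∀ g p, χ p g = χ (zeroAt 1 p) g + p.1 1 * χ p (L₁ g)) (g : E) :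
    ∃ G : ℂ × ℂ → ℂ, AnalyticAt ℂ G 0 ∧ ∀ᶠ q in nhds (0 : ℂ × ℂ),
      ∀ p : Bidisc, p.1 = ![q.1, q.2] → G q = χ p g := by
  refine ⟨fun q => χ origin (Ring.inverse (1 - (ContinuousLinearMap.snd ℂ ℂ ℂ) q • L₁)
      (Ring.inverse (1 - (ContinuousLinearMap.fst ℂ ℂ ℂ) q • L₀) g)), ?_, ?_⟩
  · have happly : ∀ {T : ℂ × ℂ → E →L[ℂ] E} {e : ℂ × ℂ → E}, AnalyticAt ℂ T 0 →
        AnalyticAt ℂ e 0 → AnalyticAt ℂ (fun q => T q (e q)) 0 := fun {T e} hT he =>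
      ((ContinuousLinearMap.id ℂ (E →L[ℂ] E)).analyticAt_bilinear (T 0, e 0)).comp₂ hT he
    exact ((χ origin).analyticAt _).fun_comp (happly (analyticAt_inverse_one_sub_smul L₁ _)
      (happly (analyticAt_inverse_one_sub_smul L₀ _) analyticAt_const))
  · filter_upwards [eventually_isUnit_one_sub_smul L₀ (.fst ℂ ℂ ℂ),
      eventually_isUnit_one_sub_smul L₁ (.snd ℂ ℂ ℂ)] with q h₀ h₁ p hp
    have e₀ := eval_eq_eval_inverse χ hL₀ (k := q.1) (by rw [hp]; rfl) h₀ g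
    have e₁ := eval_eq_eval_inverse χ hL₁ (p := zeroAt 0 p) (k := q.2)
      (by simp [zeroAt, replace, hp]) h₁ (Ring.inverse (1 - q.1 • L₀) g)
    rw [e₀, e₁, zeroAt_zeroAt (by decide)]
    rfl

end Resolvent

/-- Elements of the bidisc algebra are analytic at the origin. -/
theorem exists_analyticAt (g : discAlgebra) : ∃ G : ℂ × ℂ → ℂ, AnalyticAt ℂ G 0 ∧
    ∀ᶠ q in nhds (0 : ℂ × ℂ), ∀ p : Bidisc, p.1 = ![q.1, q.2] → G q = g.1 p := by
  obtain ⟨L₀, hL₀⟩ := exists_divVar 0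
  obtain ⟨L₁, hL₁⟩ := exists_divVar 1
  exact exists_analyticAt_of_division (E := discAlgebra)
    (fun p => (ContinuousMap.evalCLM ℂ p).comp discAlgebra.toSubmodule.subtypeL) hL₀ hL₁ g

theorem exists_eq_algebraMap_add (e : discAlgebra) : ∃ (k : ℂ) (p q : discAlgebra),
    e = algebraMap ℂ discAlgebra k + var 0 * p + var 1 * q := by
  obtain ⟨d₀, h₀⟩ := exists_sub_comp_zeroAt_eq 0 e
  obtain ⟨d₁, h₁⟩ := exists_sub_comp_zeroAt_eq 1 (e - var 0 * d₀)
  refine ⟨e.1 origin, d₀, d₁, Subtype.ext (ContinuousMap.ext fun p => ?_)⟩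
  have e₀ : ∀ p, e.1 p - e.1 (zeroAt 0 p) = p.1 0 * d₀.1 p := DFunLike.congr_fun h₀
  have e₁ : e.1 p - p.1 0 * d₀.1 p - (e.1 (zeroAt 1 p) - (zeroAt 1 p).1 0 * d₀.1 (zeroAt 1 p))
      = p.1 1 * d₁.1 p := DFunLike.congr_fun h₁ p
  have e₂ := e₀ (zeroAt 1 p)
  rw [zeroAt_zeroAt (by decide)] at e₂
  change e.1 p = e.1 origin + p.1 0 * d₀.1 p + p.1 1 * d₁.1 p
  linear_combination e₁ + e₂

theorem exists_division (e : discAlgebra) : ∃ k l : ℂ, ∃ s p : discAlgebra,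
    e = algebraMap ℂ discAlgebra k + algebraMap ℂ discAlgebra l * var 1 + var 1 ^ 2 * s
      + var 0 * p := by
  obtain ⟨k, p, q, rfl⟩ := exists_eq_algebraMap_add e
  obtain ⟨l, p', s, rfl⟩ := exists_eq_algebraMap_add q
  exact ⟨k, l, s, p + var 1 * p', by ring⟩

end Bidisc

theorem RightEquiv.trans {g h k : ℂ × ℂ → ℂ} (hgh : RightEquiv g h) (hhk : RightEquiv h k) :
    RightEquiv g k := by
  obtain ⟨φ, φ0, hφ, ⟨L, hL⟩, eφ⟩ := hgh
  obtain ⟨ψ, ψ0, hψ, ⟨M, hM⟩, eψ⟩ := hhk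
  have hψ' : AnalyticAt ℂ ψ (φ 0) := by rwa [φ0]
  refine ⟨ψ ∘ φ, by simp [φ0, ψ0], hψ'.comp hφ, ⟨L.trans M, ?_⟩, ?_⟩
  · rw [fderiv_comp _ hψ'.differentiableAt hφ.differentiableAt, φ0, hL, hM]
    rfl
  · have ht : Tendsto φ (nhds 0) (nhds 0) := by
      simpa [ContinuousAt, φ0] using hφ.continuousAt
    filter_upwards [eφ, ht.eventually eψ] with p h₁ h₂
    rw [h₁, h₂, Function.comp_apply]

theorem rightEquiv_of_triangular {g h U V W S : ℂ × ℂ → ℂ} (hU : AnalyticAt ℂ U 0)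
    (hV : AnalyticAt ℂ V 0) (hW : AnalyticAt ℂ W 0) (hS : AnalyticAt ℂ S 0) (hU0 : U 0 ≠ 0)
    (hW0 : W 0 ≠ 0) (heq : ∀ᶠ p in nhds (0 : ℂ × ℂ),
      g p = h (U p * p.1 + V p * p.2 ^ 3, W p * p.2 + S p * p.1)) : RightEquiv g h := by
  have hfst : AnalyticAt ℂ (fun p : ℂ × ℂ => p.1) 0 := analyticAt_fst
  have hsnd : AnalyticAt ℂ (fun p : ℂ × ℂ => p.2) 0 := analyticAt_snd
  let L : ℂ × ℂ →L[ℂ] ℂ × ℂ := (U 0 • ContinuousLinearMap.fst ℂ ℂ ℂ).prod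
    (W 0 • ContinuousLinearMap.snd ℂ ℂ ℂ + S 0 • ContinuousLinearMap.fst ℂ ℂ ℂ)
  let M : ℂ × ℂ →L[ℂ] ℂ × ℂ := ((U 0)⁻¹ • ContinuousLinearMap.fst ℂ ℂ ℂ).prod
    ((W 0)⁻¹ • (ContinuousLinearMap.snd ℂ ℂ ℂ -
      (S 0 * (U 0)⁻¹) • ContinuousLinearMap.fst ℂ ℂ ℂ))
  refine ⟨fun p => (U p * p.1 + V p * p.2 ^ 3, W p * p.2 + S p * p.1), by simp, by fun_prop,
    ⟨ContinuousLinearEquiv.equivOfInverse L M (fun p => ?_) (fun p => ?_), ?_⟩, heq⟩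
  · ext <;> simp [L, M] <;> field_simp
    ring
  · ext <;> simp [L, M] <;> field_simp
    ring
  · have d1 : HasFDerivAt (fun p : ℂ × ℂ => p.1) (ContinuousLinearMap.fst ℂ ℂ ℂ) 0 :=
      hasFDerivAt_fst
    have d2 : HasFDerivAt (fun p : ℂ × ℂ => p.2) (ContinuousLinearMap.snd ℂ ℂ ℂ) 0 :=
      hasFDerivAt_snd
    have dU := hU.differentiableAt.hasFDerivAt
    have dV := hV.differentiableAt.hasFDerivAt
    have dW := hW.differentiableAt.hasFDerivAt
    have dS := hS.differentiableAt.hasFDerivAt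
    refine HasFDerivAt.fderiv ((((dU.fun_mul d1).fun_add (dV.fun_mul (d2.pow 3))).prodMk
      ((dW.fun_mul d2).fun_add (dS.fun_mul d1))).congr_fderiv ?_)
    ext <;> simp [L]

theorem continuous_aeval {𝒜 : Type*} [NormedCommRing 𝒜] [NormedAlgebra ℂ 𝒜]
    {σ : ℂ → Fin 2 → 𝒜} (hσ : ∀ i, Continuous fun t => σ t i) (P : MvPolynomial (Fin 2) ℂ) :
    Continuous fun t => aeval (σ t) P := by
  simp only [aeval_def, eval₂_eq]
  fun_prop

/-- Evaluation of elements of the bidisc algebra at a point. -/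
noncomputable def Bidisc.evalAt (p : Bidisc) : Bidisc.discAlgebra →ₐ[ℂ] ℂ :=
  (ContinuousMap.evalAlgHom ℂ ℂ p).comp Bidisc.discAlgebra.val

/-- A germ in `(x, y³)³` whose part of weight `9` is nondegenerate belongs to `J_{3,0}`. -/
theorem exists_rightEquiv_J30 (A B C D : MvPolynomial (Fin 2) ℂ) {α β γ b₀ : ℂ} (hα : α ≠ 0)
    (hγ : γ ≠ 0) (hb₀ : b₀ ≠ 0) (h27 : 4 * b₀ ^ 3 + 27 ≠ 0)
    (h1 : α ^ 3 * constantCoeff A = 1)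
    (h2 : 3 * α ^ 2 * β * constantCoeff A + α ^ 2 * γ ^ 3 * constantCoeff B = b₀)
    (h3 : 3 * α * β ^ 2 * constantCoeff A + 2 * α * β * γ ^ 3 * constantCoeff B
      + α * γ ^ 6 * constantCoeff C = 0)
    (h4 : β ^ 3 * constantCoeff A + β ^ 2 * γ ^ 3 * constantCoeff B
      + β * γ ^ 6 * constantCoeff C + γ ^ 9 * constantCoeff D = 1) :
    ∃ b c : ℂ, 4 * b ^ 3 + 27 ≠ 0 ∧ RightEquiv (fun p => evalP A p * p.1 ^ 3
      + evalP B p * (p.1 ^ 2 * p.2 ^ 3) + evalP C p * (p.1 * p.2 ^ 6) + evalP D p * p.2 ^ 9)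
      (J30 b c) := by
  obtain ⟨x, hx⟩ : ∃ x, x = Bidisc.var 0 := ⟨_, rfl⟩
  obtain ⟨y, hy⟩ : ∃ y, y = Bidisc.var 1 := ⟨_, rfl⟩
  let σ : ℂ → Fin 2 → Bidisc.discAlgebra := fun t =>
    ![t ^ 3 • (α • x + β • y ^ 3), (t * γ) • y]
  have hσ : ∀ i, Continuous fun t => σ t i := by
    intro i
    fin_cases i
    · change Continuous fun t : ℂ => t ^ 3 • (α • x + β • y ^ 3)
      fun_prop
    · change Continuous fun t : ℂ => (t * γ) • y
      fun_prop
  have hσ0 : σ 0 = 0 := by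
    funext i
    fin_cases i <;> simp [σ]
  let V : ℂ → Bidisc.discAlgebra × Bidisc.discAlgebra × Bidisc.discAlgebra × Bidisc.discAlgebra :=
    fun t =>
    (α ^ 3 • aeval (σ t) A,
     (3 * α ^ 2 * β) • aeval (σ t) A + (α ^ 2 * γ ^ 3) • aeval (σ t) B,
     (3 * α * β ^ 2) • aeval (σ t) A + (2 * α * β * γ ^ 3) • aeval (σ t) B
      + (α * γ ^ 6) • aeval (σ t) C,
     β ^ 3 • aeval (σ t) A + (β ^ 2 * γ ^ 3) • aeval (σ t) B + (β * γ ^ 6) • aeval (σ t) C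
      + γ ^ 9 • aeval (σ t) D)
  have hVcont : Continuous V := by
    have hA := continuous_aeval hσ A
    have hB := continuous_aeval hσ B
    have hC := continuous_aeval hσ C
    have hD := continuous_aeval hσ D
    fun_prop
  have hV0 : V 0 = (1, algebraMap ℂ _ b₀, 0, 1) := by
    simp only [V, hσ0, aeval_zero, Algebra.smul_def, ← map_mul, ← map_add, h1, h2, h3, h4,
      map_one, map_zero]
  have hopen := map_nhds_pullbackCoeffs (x := x) (y := y) (hx ▸ hy ▸ Bidisc.exists_division)
    hb₀ h27
  let N : Set (Bidisc.discAlgebra × Bidisc.discAlgebra × Bidisc.discAlgebra × Bidisc.discAlgebra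
      × Bidisc.discAlgebra × ℂ × ℂ) :=
    {m | 4 * m.2.2.2.2.2.1 ^ 3 + 27 ≠ 0 ∧ m.1.1 Bidisc.origin ≠ 0 ∧
      m.2.2.1.1 Bidisc.origin ≠ 0}
  have hev : Continuous fun g : Bidisc.discAlgebra => g.1 Bidisc.origin :=
    (ContinuousMap.evalCLM ℂ Bidisc.origin).continuous.comp continuous_subtype_val
  have hN : N ∈ nhds (1, 0, 1, 0, 0, b₀, 0) := by
    refine IsOpen.mem_nhds ?_ ⟨h27, ?_, ?_⟩
    · refine (isOpen_ne_fun (by fun_prop) continuous_const).inter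
        ((isOpen_ne_fun (hev.comp continuous_fst) continuous_const).inter
          (isOpen_ne_fun (hev.comp (by fun_prop)) continuous_const))
    · exact one_ne_zero
    · exact one_ne_zero
  have himage : ∀ᶠ t in nhds (0 : ℂ), V t ∈ pullbackCoeffs x y '' N := by
    refine hVcont.continuousAt.eventually ?_
    rw [hV0, ← hopen]
    exact image_mem_map hN
  obtain ⟨t, ⟨⟨u, v, w, s, q, b, c⟩, ⟨hb, hu, hw⟩, hm⟩, ht⟩ :=
    ((himage.filter_mono nhdsWithin_le_nhds).and
      (self_mem_nhdsWithin (s := {(0 : ℂ)}ᶜ))).exists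
  replace ht : t ≠ 0 := ht
  have hid := eq_of_pullbackCoeffs_eq hm
  obtain ⟨U, hU, eU⟩ := Bidisc.exists_analyticAt u
  obtain ⟨V', hV', eV⟩ := Bidisc.exists_analyticAt v
  obtain ⟨W, hW, eW⟩ := Bidisc.exists_analyticAt w
  obtain ⟨S, hS, eS⟩ := Bidisc.exists_analyticAt s
  have horigin : Bidisc.origin.1 = ![(0 : ℂ × ℂ).1, (0 : ℂ × ℂ).2] := by
    funext i
    fin_cases i <;> rfl
  have hU0 : U 0 ≠ 0 := by rwa [eU.self_of_nhds _ horigin]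
  have hW0 : W 0 ≠ 0 := by rwa [eW.self_of_nhds _ horigin]
  have hball : ∀ᶠ z in nhds (0 : ℂ × ℂ), ∃ p : Bidisc, p.1 = ![z.1, z.2] := by
    filter_upwards [Metric.closedBall_mem_nhds (0 : ℂ × ℂ) one_pos] with z hz
    rw [mem_closedBall_zero_iff, Prod.norm_def, max_le_iff] at hz
    exact ⟨⟨![z.1, z.2], mem_closedBall_zero_iff.2 <|
      (pi_norm_le_iff_of_nonneg zero_le_one).2 (Fin.forall_fin_two.2 hz)⟩, rfl⟩
  refine ⟨b, c / t, hb, RightEquiv.trans (h := fun z =>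
    (fun p : ℂ × ℂ => evalP A p * p.1 ^ 3
      + evalP B p * (p.1 ^ 2 * p.2 ^ 3) + evalP C p * (p.1 * p.2 ^ 6) + evalP D p * p.2 ^ 9)
      (t ^ 3 * (α * z.1 + β * z.2 ^ 3), t * γ * z.2)) ?_ ?_⟩
  · refine rightEquiv_of_triangular (U := fun _ => (t ^ 3 * α)⁻¹)
      (V := fun _ => -β / (α * (t * γ) ^ 3)) (W := fun _ => (t * γ)⁻¹) (S := fun _ => 0)
      analyticAt_const analyticAt_const analyticAt_const analyticAt_const (by positivity)
      (by positivity) (.of_forall fun p => ?_)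
    have e1 : t ^ 3 * (α * ((t ^ 3 * α)⁻¹ * p.1 + -β / (α * (t * γ) ^ 3) * p.2 ^ 3)
        + β * ((t * γ)⁻¹ * p.2 + 0 * p.1) ^ 3) = p.1 := by
      field_simp
      ring
    have e2 : t * γ * ((t * γ)⁻¹ * p.2 + 0 * p.1) = p.2 := by
      field_simp
      ring
    simp only [e1, e2]
  · refine rightEquiv_of_triangular (U := fun z => t ^ 3 * U z) (V := fun z => t ^ 3 * V' z)
      (W := fun z => t * W z) (S := fun z => t * S z) (by fun_prop) (by fun_prop) (by fun_prop)
      (by fun_prop) (by positivity) (by positivity) ?_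
    filter_upwards [eU, eV, eW, eS, hball] with z eU eV eW eS ⟨p, hp⟩
    have hz1 : p.evalAt x = z.1 := by
      rw [hx]; exact congrFun hp 0
    have hz2 : p.evalAt y = z.2 := by
      rw [hy]; exact congrFun hp 1
    have hpoly : ∀ P : MvPolynomial (Fin 2) ℂ, p.evalAt (aeval (σ t) P) =
        evalP P (t ^ 3 * (α * z.1 + β * z.2 ^ 3), t * γ * z.2) := by
      intro P
      rw [comp_aeval_apply, evalP, ← aeval_eq_eval]
      congr 2
      funext i
      fin_cases i <;> simp [σ, hz1, hz2, mul_add]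
    have hval := congrArg p.evalAt hid
    simp only [map_add, map_mul, map_pow, map_smul, AlgHom.commutes, smul_eq_mul, hpoly, hz1,
      hz2, Algebra.algebraMap_self, RingHom.id_apply] at hval
    rw [show p.evalAt u = U z from (eU p hp).symm, show p.evalAt v = V' z from (eV p hp).symm,
      show p.evalAt w = W z from (eW p hp).symm, show p.evalAt s = S z from (eS p hp).symm] at hval
    have hc : c / t * t = c := div_mul_cancel₀ _ ht
    simp only [J30]
    linear_combination t ^ 9 * hval
      - t ^ 9 * (U z * z.1 + V' z * z.2 ^ 3) * (W z * z.2 + S z * z.1) ^ 7 * hc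

/-- If `f ∈ ℂ[x,y]` has `f(0,0) = 0`, an isolated singularity at `0`, and every
monomial `xⁱyʲ` of `f` satisfies `3i + j ≥ 9`, then `f` deforms to `J_{3,0}`. -/
theorem deforms_to_J30_of_filtration_ge_nine (f : MvPolynomial (Fin 2) ℂ)
    (h0 : evalP f 0 = 0)
    (hcrit : evalP (pderiv 0 f) 0 = 0 ∧ evalP (pderiv 1 f) 0 = 0)
    (hiso : ∃ ε > (0 : ℝ), ∀ p : ℂ × ℂ, ‖p‖ < ε → p ≠ 0 →
      ¬ (evalP (pderiv 0 f) p = 0 ∧ evalP (pderiv 1 f) p = 0))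
    (hfil : ∀ d ∈ f.support, 9 ≤ 3 * d 0 + d 1) :
    ∃ F : (ℂ × ℂ) × ℂ → ℂ, AnalyticAt ℂ F 0 ∧
      (∀ᶠ p in nhds (0 : ℂ × ℂ), F (p, 0) = evalP f p) ∧
      ∀ ε > (0 : ℝ), ∃ t : ℂ, 0 < ‖t‖ ∧ ‖t‖ < ε ∧
        ∃ b c : ℂ, 4 * b ^ 3 + 27 ≠ 0 ∧
          RightEquiv (fun p => F (p, t)) (J30 b c) := by
  obtain ⟨A, B, C, D, hf⟩ := exists_eq_of_weight_ge_nine f hfil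
  obtain ⟨a, ha⟩ : ∃ a, a = constantCoeff A := ⟨_, rfl⟩
  obtain ⟨b, hb⟩ : ∃ b, b = constantCoeff B := ⟨_, rfl⟩
  obtain ⟨c, hc⟩ : ∃ c, c = constantCoeff C := ⟨_, rfl⟩
  obtain ⟨d, hd⟩ : ∃ d, d = constantCoeff D := ⟨_, rfl⟩
  refine ⟨fun z => evalP f z.1 + z.2 * ((1 - a) * z.1.1 ^ 3 + (1 - b) * (z.1.1 ^ 2 * z.1.2 ^ 3)
    + (0 - c) * (z.1.1 * z.1.2 ^ 6) + (1 - d) * z.1.2 ^ 9), ?_, .of_forall fun p => by simp, ?_⟩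
  · have hx : AnalyticAt ℂ (fun z : (ℂ × ℂ) × ℂ => z.1.1) 0 :=
      ((ContinuousLinearMap.fst ℂ ℂ ℂ).comp (ContinuousLinearMap.fst ℂ (ℂ × ℂ) ℂ)).analyticAt 0
    have hy : AnalyticAt ℂ (fun z : (ℂ × ℂ) × ℂ => z.1.2) 0 :=
      ((ContinuousLinearMap.snd ℂ ℂ ℂ).comp (ContinuousLinearMap.fst ℂ (ℂ × ℂ) ℂ)).analyticAt 0
    have ht : AnalyticAt ℂ (fun z : (ℂ × ℂ) × ℂ => z.2) 0 := analyticAt_snd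
    have hev : AnalyticAt ℂ (fun z : (ℂ × ℂ) × ℂ => evalP f z.1) 0 := by
      refine AnalyticAt.aeval_mvPolynomial (f := fun z : (ℂ × ℂ) × ℂ => ![z.1.1, z.1.2]) ?_ f
      intro i
      fin_cases i
      · exact hx
      · exact hy
    fun_prop
  · intro ε hε
    obtain ⟨t, ⟨⟨g1, g2, g3⟩, htε⟩, ht0⟩ := (((eventually_generic_cubic a b c d).and
      (nhdsWithin_le_nhds (Metric.ball_mem_nhds (0 : ℂ) hε))).and
      (self_mem_nhdsWithin (s := {(0 : ℂ)}ᶜ))).exists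
    refine ⟨t, norm_pos_iff.2 ht0, by simpa using htε, ?_⟩
    obtain ⟨α, β, γ, b₀, hα, hγ, hb₀, h27, e1, e2, e3, e4⟩ := exists_cubic_normal_form g1 g2 g3
    have hcoeff : ∀ (P : MvPolynomial (Fin 2) ℂ) (k : ℂ),
        constantCoeff (P + MvPolynomial.C k) = constantCoeff P + k := fun P k => by simp
    obtain ⟨b', c', h27', hequiv⟩ := exists_rightEquiv_J30
      (A + MvPolynomial.C (t * (1 - a))) (B + MvPolynomial.C (t * (1 - b)))
      (C + MvPolynomial.C (t * (0 - c))) (D + MvPolynomial.C (t * (1 - d))) hα hγ hb₀ h27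
      (by rw [hcoeff, ← ha]; exact e1) (by rw [hcoeff, hcoeff, ← ha, ← hb]; exact e2)
      (by rw [hcoeff, hcoeff, hcoeff, ← ha, ← hb, ← hc]; exact e3)
      (by rw [hcoeff, hcoeff, hcoeff, hcoeff, ← ha, ← hb, ← hc, ← hd]; exact e4)
    refine ⟨b', c', h27', ?_⟩
    convert! hequiv using 1
    funext p
    rw [hf]
    simp only [evalP, map_add, map_mul, map_pow, eval_X, eval_C, Matrix.cons_val_zero,
      Matrix.cons_val_one]
    ring
end

section
/- Let s, t ∈ ℂ with 4s³ + 27 ≠ 0 and let f(x,y) = x³y + s x²y³ + t x y⁶ + y⁷ (the family Z_{1,0}). Then f does not deform to J_{3,0}: for every integer m ≥ 1 and every function F(x,y,u), analytic on a neighborhood of 0 in ℂ² × ℂ^m, with F(x,y,0) = f(x,y), there exists ε > 0 such that for every u ∈ ℂ^m with 0 < ‖u‖ < ε, the germ at 0 of (x,y) ↦ F(x,y,u) is not right equivalent to the germ at 0 of x³ + b x²y³ + y⁹ + c x y⁷ for any b, c ∈ ℂ with 4b³ + 27 ≠ 0. -/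
open Filter

open Asymptotics Polynomial Topology

theorem isBigO_pow_pow_of_le_s5 {m n : ℕ} (h : n ≤ m) :
    (fun τ : ℂ => τ ^ m) =O[𝓝 0] fun τ => τ ^ n := by
  refine IsBigO.of_bound 1 ?_
  filter_upwards [Metric.ball_mem_nhds (0 : ℂ) one_pos] with τ hτ
  rw [one_mul, norm_pow, norm_pow]
  exact pow_le_pow_of_le_one (norm_nonneg _) (mem_ball_zero_iff.1 hτ).le h

theorem Polynomial.X_pow_dvd_of_isBigO (Q : ℂ[X]) (n : ℕ)
    (h : (fun τ => Q.eval τ) =O[𝓝 0] fun τ => τ ^ n) : X ^ n ∣ Q := by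
  induction n with
  | zero => simp
  | succ n ih =>
    obtain ⟨R, rfl⟩ := ih (h.trans (isBigO_pow_pow_of_le_s5 n.le_succ))
    have hR : R.eval 0 = 0 := by
      have h1 : (fun τ => R.eval τ) =O[𝓝[≠] 0] fun τ : ℂ => τ := by
        obtain ⟨K, hK⟩ := h.bound
        refine IsBigO.of_bound K ?_
        filter_upwards [hK.filter_mono nhdsWithin_le_nhds, self_mem_nhdsWithin] with τ hτ hne
        have hpos : 0 < ‖τ‖ ^ n := pow_pos (norm_pos_iff.2 hne) n
        simp only [eval_mul, eval_pow, eval_X, norm_mul, norm_pow, pow_succ] at hτ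
        refine le_of_mul_le_mul_left ?_ hpos
        linarith
      have h2 : Tendsto (fun τ => R.eval τ) (𝓝[≠] 0) (𝓝 0) :=
        h1.trans_tendsto (tendsto_id.mono_left nhdsWithin_le_nhds)
      have h3 : Tendsto (fun τ => R.eval τ) (𝓝[≠] 0) (𝓝 (R.eval 0)) :=
        (R.continuous.tendsto 0).mono_left nhdsWithin_le_nhds
      exact tendsto_nhds_unique h3 h2
    rw [pow_succ]
    exact mul_dvd_mul_left _ (X_dvd_iff.2 (by rwa [coeff_zero_eq_eval_zero]))

/-- If `∑ τ ^ w A_w(η + ζ τ)` vanishes to order `n` in `τ` for all `ζ`, then the `k`-th Taylor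
coefficient of `A_w` at `η` vanishes whenever `w + k < n`. -/
theorem Polynomial.taylor_coeff_eq_zero_of_isBigO (A : ℕ → ℂ[X]) (η : ℂ) (n : ℕ)
    (h : ∀ ζ : ℂ, (fun τ : ℂ => ∑ w ∈ Finset.range n, τ ^ w * (A w).eval (η + ζ * τ))
      =O[𝓝 0] fun τ => τ ^ n) {w k : ℕ} (hwk : w + k < n) : (taylor η (A w)).coeff k = 0 := by
  have h1 : ∀ ζ : ℂ, ∑ v ∈ Finset.range (w + k + 1),
      (taylor η (A v)).coeff (w + k - v) * ζ ^ (w + k - v) = 0 := by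
    intro ζ
    have hd := X_pow_dvd_of_isBigO
      (∑ v ∈ Finset.range n, ((taylor η (A v)).comp (C ζ * X)) * X ^ v) n (by
        refine (h ζ).congr_left fun τ => ?_
        simp only [eval_finsetSum, eval_mul, eval_pow, eval_X, eval_comp, eval_C, taylor_eval]
        exact Finset.sum_congr rfl fun v _ => by rw [mul_comm, add_comm])
    have hc := X_pow_dvd_iff.1 hd _ hwk
    simp only [finsetSum_coeff, coeff_mul_X_pow', comp_C_mul_X_coeff] at hc
    rw [← hc]
    refine Finset.sum_subset_zero_on_sdiff (fun v hv => ?_) (fun v hv => ?_) (fun v hv => ?_)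
    · simp only [Finset.mem_range] at *; omega
    · simp only [Finset.mem_range, Finset.mem_sdiff] at hv
      rw [if_neg (by omega)]
    · simp only [Finset.mem_range] at hv
      rw [if_pos (by omega)]
  have h2 : ∑ v ∈ Finset.range (w + k + 1),
      C ((taylor η (A v)).coeff (w + k - v)) * X ^ (w + k - v) = 0 := by
    refine Polynomial.funext fun ζ => ?_
    simpa [eval_finsetSum] using h1 ζ
  have h3 := congrArg (fun p => coeff p k) h2
  simp only [finsetSum_coeff, coeff_C_mul, coeff_X_pow, coeff_zero] at h3
  rw [Finset.sum_eq_single w] at h3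
  · simpa using h3
  · intro v hv hne
    simp only [Finset.mem_range] at hv
    rw [if_neg (by omega), mul_zero]
  · intro hw
    simp at hw

/-- The binary form obtained by restricting a multilinear map to a diagonal plane. -/
theorem ContinuousMultilinearMap.map_add_smul_const {V : Type*} [NormedAddCommGroup V]
    [NormedSpace ℂ V] {k : ℕ} (f : ContinuousMultilinearMap ℂ (fun _ : Fin k => V) ℂ)
    (a b : V) (x y : ℂ) :
    f (fun _ => x • a + y • b) = ∑ i ∈ Finset.range (k + 1),
      (∑ s ∈ Finset.powersetCard i (Finset.univ : Finset (Fin k)),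
        f (s.piecewise (fun _ => a) (fun _ => b))) * x ^ i * y ^ (k - i) := by
  have h1 := f.map_add_univ (fun _ => x • a) (fun _ => y • b)
  have h2 : ((fun _ => x • a) + fun _ => y • b : Fin k → V) = fun _ => x • a + y • b := rfl
  rw [h2] at h1
  rw [h1, ← Finset.powerset_univ, Finset.sum_powerset, Finset.card_univ, Fintype.card_fin]
  refine Finset.sum_congr rfl fun i hi => ?_
  rw [Finset.sum_mul, Finset.sum_mul]
  refine Finset.sum_congr rfl fun s hs => ?_
  have hcard := (Finset.mem_powersetCard.1 hs).2
  have h3 : (s.piecewise (fun _ => x • a) (fun _ => y • b) : Fin k → V) =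
      fun l => (s.piecewise (fun _ => x) (fun _ => y) : Fin k → ℂ) l •
        (s.piecewise (fun _ => a) (fun _ => b) : Fin k → V) l := by
    funext l
    by_cases hl : l ∈ s <;> simp [hl]
  rw [h3, f.map_smul_univ, Finset.prod_piecewise, smul_eq_mul]
  have h4 : (Finset.univ \ s).card = k - i := by
    rw [← Finset.compl_eq_univ_sdiff, Finset.card_compl, Fintype.card_fin, hcard]
  simp [h4, hcard]
  ring

theorem Finset.sum_range_sum_range_eq_sum_filter {M : Type*} [AddCommMonoid M] (n : ℕ)
    (f : ℕ → ℕ → M) :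
    ∑ k ∈ Finset.range n, ∑ i ∈ Finset.range (k + 1), f i (k - i) =
      ∑ q ∈ (Finset.range n ×ˢ Finset.range n).filter (fun q => q.1 + q.2 < n), f q.1 q.2 := by
  rw [Finset.sum_sigma']
  refine Finset.sum_nbij' (fun q => (q.2, q.1 - q.2)) (fun q => ⟨q.1 + q.2, q.1⟩) ?_ ?_ ?_ ?_ ?_
  · rintro ⟨k, i⟩ h
    simp only [Finset.mem_sigma, Finset.mem_range, Finset.mem_filter, Finset.mem_product] at *
    omega
  · rintro ⟨k, i⟩ h
    simp only [Finset.mem_sigma, Finset.mem_range, Finset.mem_filter, Finset.mem_product] at *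
    omega
  · rintro ⟨k, i⟩ h
    simp only [Finset.mem_sigma, Finset.mem_range] at h
    simp only [Sigma.mk.injEq, heq_eq_eq, and_true]
    omega
  · rintro ⟨k, i⟩ h
    simp
  · rintro ⟨k, i⟩ h
    rfl

theorem isBigO_monomial (c : ℂ) {i j n : ℕ} (h : n ≤ i + j) :
    (fun p : ℂ × ℂ => c * p.1 ^ i * p.2 ^ j) =O[𝓝 0] fun p => ‖p‖ ^ n := by
  refine IsBigO.of_bound ‖c‖ ?_
  filter_upwards [Metric.ball_mem_nhds (0 : ℂ × ℂ) one_pos] with p hp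
  have hp1 : ‖p‖ ≤ 1 := (mem_ball_zero_iff.1 hp).le
  rw [norm_mul, norm_mul, norm_pow, norm_pow, norm_pow, norm_norm, mul_assoc]
  gcongr
  calc ‖p.1‖ ^ i * ‖p.2‖ ^ j ≤ ‖p‖ ^ i * ‖p‖ ^ j := by
        gcongr
        · exact norm_fst_le p
        · exact norm_snd_le p
    _ = ‖p‖ ^ (i + j) := (pow_add _ _ _).symm
    _ ≤ ‖p‖ ^ n := pow_le_pow_of_le_one (norm_nonneg _) hp1 h

/-- The coefficients `c i j` are the Taylor coefficients of `g` at the origin in degrees less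
than `n`. -/
def HasTaylorCoeffs (n : ℕ) (g : ℂ × ℂ → ℂ) (c : ℕ → ℕ → ℂ) : Prop :=
  (fun p : ℂ × ℂ => g p - ∑ q ∈ Finset.range n ×ˢ Finset.range n,
    c q.1 q.2 * p.1 ^ q.1 * p.2 ^ q.2) =O[𝓝 0] fun p => ‖p‖ ^ n

/-- Taylor coefficients of an analytic family depend continuously on the parameter. -/
theorem AnalyticAt.exists_continuousAt_taylorCoeffs {E : Type*} [NormedAddCommGroup E]
    [NormedSpace ℂ E] {F : (ℂ × ℂ) × E → ℂ} (hF : AnalyticAt ℂ F 0) :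
    ∃ c : ℕ → ℕ → E → ℂ, (∀ i j, ContinuousAt (c i j) 0) ∧
      ∀ᶠ u in 𝓝 (0 : E), ∀ n, HasTaylorCoeffs n (fun p => F (p, u)) (fun i j => c i j u) := by
  obtain ⟨P, r, hP⟩ := hF
  let D : E → ℕ → ℕ → ℂ := fun u k i =>
    ∑ s ∈ Finset.powersetCard i (Finset.univ : Finset (Fin k)),
      P.changeOrigin ((0, u) : (ℂ × ℂ) × E) k
        (s.piecewise (fun _ => ((1, 0), 0)) (fun _ => ((0, 1), 0)))
  refine ⟨fun i j u => D u (i + j) i, fun i j => ?_, ?_⟩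
  · have h1 := (P.analyticAt_changeOrigin (hP.r_pos.trans_le hP.r_le) (i + j)).continuousAt
    have h2 : ContinuousAt
        (fun u : E => P.changeOrigin ((0, u) : (ℂ × ℂ) × E) (i + j)) 0 := by
      refine ContinuousAt.comp (f := fun u : E => ((0, u) : (ℂ × ℂ) × E)) h1 ?_
      fun_prop
    refine tendsto_finsetSum _ fun s _ => ?_
    exact ((ContinuousMultilinearMap.apply ℂ _ ℂ _).continuous.continuousAt.comp h2 :)
  · have hball : ∀ᶠ u in 𝓝 (0 : E), u ∈ Metric.eball (0 : E) r :=
      Metric.eball_mem_nhds _ hP.r_pos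
    filter_upwards [hball] with u hu n
    have hu' : ‖((0, u) : (ℂ × ℂ) × E)‖ₑ < r := by
      rw [← edist_zero_right, Prod.edist_eq]
      simpa using hu
    have h1 := (hP.changeOrigin hu').hasFPowerSeriesAt.isBigO_sub_partialSum_pow n
    have hι : Tendsto (fun p : ℂ × ℂ => ((p, 0) : (ℂ × ℂ) × E)) (𝓝 0) (𝓝 0) := by
      have : Continuous (fun p : ℂ × ℂ => ((p, 0) : (ℂ × ℂ) × E)) := by fun_prop
      exact this.tendsto 0
    have h2 := h1.comp_tendsto hι
    have h3 : (fun p : ℂ × ℂ => ∑ q ∈ (Finset.range n ×ˢ Finset.range n).filter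
        (fun q => ¬ q.1 + q.2 < n), D u (q.1 + q.2) q.1 * p.1 ^ q.1 * p.2 ^ q.2)
        =O[𝓝 0] fun p => ‖p‖ ^ n := by
      refine IsBigO.fun_sum fun q hq => isBigO_monomial _ ?_
      simpa using (Finset.mem_filter.1 hq).2
    have h2' := h2.congr_right (g₂ := fun p : ℂ × ℂ => ‖p‖ ^ n) fun p => by simp
    refine (h2'.sub h3).congr_left fun p => ?_
    · have h4 : (P.changeOrigin ((0, u) : (ℂ × ℂ) × E)).partialSum n (p, 0) =
          ∑ k ∈ Finset.range n, ∑ i ∈ Finset.range (k + 1),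
            D u (i + (k - i)) i * p.1 ^ i * p.2 ^ (k - i) := by
        refine Finset.sum_congr rfl fun k _ => ?_
        have h5 : ((p, 0) : (ℂ × ℂ) × E) =
            p.1 • (((1, 0), 0) : (ℂ × ℂ) × E) + p.2 • (((0, 1), 0) : (ℂ × ℂ) × E) := by
          ext <;> simp
        rw [h5, ContinuousMultilinearMap.map_add_smul_const]
        refine Finset.sum_congr rfl fun i hi => ?_
        rw [Nat.add_sub_cancel' (by simp only [Finset.mem_range] at hi; omega)]
      simp only [Function.comp_apply, h4]
      rw [Finset.sum_range_sum_range_eq_sum_filter n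
        (fun i j => D u (i + j) i * p.1 ^ i * p.2 ^ j), sub_sub,
        Finset.sum_filter_add_sum_filter_not]
      simp

theorem isBigO_pow_mul_of_continuous {R : ℂ → ℂ} (hR : Continuous R) {m n : ℕ} (h : n ≤ m) :
    (fun τ : ℂ => τ ^ m * R τ) =O[𝓝 0] fun τ => τ ^ n := by
  simpa using (isBigO_pow_pow_of_le_s5 h).mul ((hR.tendsto 0).isBigO_one ℂ)

/-- Error term of a Taylor expansion along a curve `τ ↦ (τ R(τ), τ S(τ))`. -/
theorem HasTaylorCoeffs.isBigO_comp_curve {n : ℕ} {g : ℂ × ℂ → ℂ} {c : ℕ → ℕ → ℂ}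
    (hg : HasTaylorCoeffs n g c) {R S : ℂ → ℂ} (hR : Continuous R) (hS : Continuous S) :
    (fun τ : ℂ => g (τ * R τ, τ * S τ) - ∑ q ∈ Finset.range n ×ˢ Finset.range n,
      c q.1 q.2 * (τ * R τ) ^ q.1 * (τ * S τ) ^ q.2) =O[𝓝 0] fun τ => τ ^ n := by
  have hγ : Tendsto (fun τ : ℂ => ((τ * R τ, τ * S τ) : ℂ × ℂ)) (𝓝 0) (𝓝 0) := by
    have : Continuous (fun τ : ℂ => ((τ * R τ, τ * S τ) : ℂ × ℂ)) := by fun_prop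
    exact this.tendsto' 0 0 (by simp)
  have h1 : (fun τ : ℂ => ((τ * R τ, τ * S τ) : ℂ × ℂ)) =O[𝓝 0] fun τ => τ := by
    refine IsBigO.prod_left ?_ ?_
    · simpa using isBigO_pow_mul_of_continuous hR (le_refl 1)
    · simpa using isBigO_pow_mul_of_continuous hS (le_refl 1)
  exact (hg.comp_tendsto hγ).trans (h1.norm_left.pow n)

theorem HasTaylorCoeffs.swap {n : ℕ} {g : ℂ × ℂ → ℂ} {c : ℕ → ℕ → ℂ}
    (hg : HasTaylorCoeffs n g c) :
    HasTaylorCoeffs n (fun p => g (p.2, p.1)) (fun i j => c j i) := by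
  have hs : Tendsto (fun p : ℂ × ℂ => ((p.2, p.1) : ℂ × ℂ)) (𝓝 0) (𝓝 0) := by
    have : Continuous (fun p : ℂ × ℂ => ((p.2, p.1) : ℂ × ℂ)) := by fun_prop
    exact this.tendsto' 0 0 (by simp)
  refine ((hg.comp_tendsto hs).congr_right (g₂ := fun p : ℂ × ℂ => ‖p‖ ^ n) fun p => ?_).congr_left
    fun p => ?_
  · simp [Prod.norm_def, max_comm]
  · simp only [Function.comp_apply]
    rw [Finset.sum_product_right, Finset.sum_product]
    congr 1
    exact Finset.sum_congr rfl fun i _ => Finset.sum_congr rfl fun j _ => by ring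

/-- The part of weight `w` of `∑ c i j x ^ i y ^ j` (with `x` of weight `r`, `y` of weight `1`),
dehomogenized at `y = 1`. -/
noncomputable def weightPart (c : ℕ → ℕ → ℂ) (n r w : ℕ) : ℂ[X] :=
  ∑ q ∈ (Finset.range n ×ˢ Finset.range n).filter (fun q => r * q.1 + q.2 = w),
    C (c q.1 q.2) * X ^ q.1

theorem HasTaylorCoeffs.taylor_weightPart_coeff_eq_zero {n : ℕ} {g : ℂ × ℂ → ℂ}
    {c : ℕ → ℕ → ℂ} (hg : HasTaylorCoeffs n g c) (r : ℕ) (η : ℂ)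
    (h : ∀ ζ : ℂ, (fun τ : ℂ => g ((η + ζ * τ) * τ ^ (r + 1), τ)) =O[𝓝 0] fun τ => τ ^ n)
    {w k : ℕ} (hwk : w + k < n) : (taylor η (weightPart c n (r + 1) w)).coeff k = 0 := by
  refine taylor_coeff_eq_zero_of_isBigO _ η n (fun ζ => ?_) hwk
  have h1 := hg.isBigO_comp_curve (R := fun τ => (η + ζ * τ) * τ ^ r) (S := fun _ => 1)
    (by fun_prop) continuous_const
  have h2 : (fun τ : ℂ => ∑ q ∈ (Finset.range n ×ˢ Finset.range n).filter
      (fun q => ¬ (r + 1) * q.1 + q.2 < n),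
      c q.1 q.2 * ((η + ζ * τ) * τ ^ (r + 1)) ^ q.1 * τ ^ q.2) =O[𝓝 0] fun τ => τ ^ n := by
    refine IsBigO.fun_sum fun q hq => ?_
    have hq' := (Finset.mem_filter.1 hq).2
    refine (isBigO_pow_mul_of_continuous (R := fun τ => c q.1 q.2 * (η + ζ * τ) ^ q.1)
      (by fun_prop) (not_lt.1 hq')).congr_left fun τ => ?_
    rw [mul_pow, ← pow_mul, pow_add]
    ring
  refine (((h ζ).sub h1).sub h2).congr_left fun τ => ?_
  have h3 : ∑ w ∈ Finset.range n, τ ^ w * (weightPart c n (r + 1) w).eval (η + ζ * τ) =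
      ∑ q ∈ (Finset.range n ×ˢ Finset.range n).filter (fun q => (r + 1) * q.1 + q.2 < n),
        c q.1 q.2 * ((η + ζ * τ) * τ ^ (r + 1)) ^ q.1 * τ ^ q.2 := by
    rw [← Finset.sum_fiberwise_of_maps_to (t := Finset.range n)
      (g := fun q : ℕ × ℕ => (r + 1) * q.1 + q.2) (by
        intro q hq
        simpa using (Finset.mem_filter.1 hq).2)]
    refine Finset.sum_congr rfl fun w hw => ?_
    rw [weightPart, eval_finsetSum, Finset.mul_sum, Finset.filter_filter]
    refine Finset.sum_congr ?_ fun q hq => ?_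
    · ext q
      simp only [Finset.mem_filter, Finset.mem_range] at *
      constructor
      · rintro ⟨h1, h2⟩
        exact ⟨h1, by omega, h2⟩
      · rintro ⟨h1, -, h2⟩
        exact ⟨h1, h2⟩
    · rw [← (Finset.mem_filter.1 hq).2.2]
      simp only [eval_mul, eval_C, eval_pow, eval_X]
      rw [mul_pow, ← pow_mul, pow_add]
      ring
  have h4 : ∀ q : ℕ × ℕ, c q.1 q.2 * (τ * ((η + ζ * τ) * τ ^ r)) ^ q.1 * (τ * 1) ^ q.2 =
      c q.1 q.2 * ((η + ζ * τ) * τ ^ (r + 1)) ^ q.1 * τ ^ q.2 := fun q => by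
    rw [mul_one, show τ * ((η + ζ * τ) * τ ^ r) = (η + ζ * τ) * τ ^ (r + 1) by ring]
  rw [h3, Finset.sum_congr rfl fun q _ => h4 q,
    ← Finset.sum_filter_add_sum_filter_not _ (fun q : ℕ × ℕ => (r + 1) * q.1 + q.2 < n),
    show τ * ((η + ζ * τ) * τ ^ r) = (η + ζ * τ) * τ ^ (r + 1) by ring, mul_one]
  ring

theorem HasTaylorCoeffs.unique {n : ℕ} {g : ℂ × ℂ → ℂ} {c d : ℕ → ℕ → ℂ}
    (hc : HasTaylorCoeffs n g c) (hd : HasTaylorCoeffs n g d) {i j : ℕ} (hij : i + j < n) :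
    c i j = d i j := by
  have h0 : HasTaylorCoeffs n (fun _ => 0) (fun i j => c i j - d i j) := by
    refine (IsBigO.sub hc hd).congr_left fun p => ?_
    simp only [sub_mul, Finset.sum_sub_distrib]
    ring
  have h1 : weightPart (fun i j => c i j - d i j) n (0 + 1) (i + j) = 0 := by
    refine Polynomial.funext fun η => ?_
    simpa using h0.taylor_weightPart_coeff_eq_zero 0 η (fun ζ => isBigO_zero _ _)
      (w := i + j) (k := 0) (by omega)
  have h2 := congrArg (fun p => coeff p i) h1
  simp only [weightPart, finsetSum_coeff, coeff_C_mul, coeff_X_pow, coeff_zero] at h2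
  rw [Finset.sum_eq_single (i, j)] at h2
  · simpa [sub_eq_zero] using h2
  · rintro ⟨k, l⟩ hkl hne
    simp only [Finset.mem_filter] at hkl
    rw [if_neg, mul_zero]
    rintro rfl
    exact hne (by ext <;> simp; omega)
  · intro h
    exact absurd h (by simp; omega)

theorem J30_isBigO_of_isBigO {b c : ℂ} {V W : ℂ → ℂ} {k : ℕ} (hk : k ≤ 3)
    (hV : V =O[𝓝 0] fun τ => τ ^ k) (hW : W =O[𝓝 0] fun τ => τ) :
    (fun τ => J30 b c (V τ, W τ)) =O[𝓝 0] fun τ => τ ^ (3 * k) := by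
  have key : ∀ (e : ℂ) (i j : ℕ), 3 * k ≤ k * i + j →
      (fun τ => e * V τ ^ i * W τ ^ j) =O[𝓝 0] fun τ => τ ^ (3 * k) := fun e i j h => by
    refine (((hV.pow i).const_mul_left e).mul (hW.pow j)).trans ?_
    refine (isBigO_pow_pow_of_le_s5 h).congr_left fun τ => ?_
    rw [pow_add, pow_mul]
  refine ((((key 1 3 0 (by omega)).add (key b 2 3 (by omega))).add (key 1 0 9 (by omega))).add
    (key c 1 7 (by omega))).congr_left fun τ => ?_
  simp only [J30]
  ring

/-- A germ right equivalent to a member of `J_{3,0}` has high contact with a family of curves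
tangent to each other. -/
theorem RightEquiv.exists_curves {g : ℂ × ℂ → ℂ} {b c : ℂ} (h : RightEquiv g (J30 b c)) :
    (∀ ζ : ℂ, (fun τ : ℂ => g (τ, ζ * τ * τ)) =O[𝓝 0] fun τ => τ ^ 6) ∨
    ∃ a η : ℂ, (∀ ζ : ℂ, (fun τ : ℂ => g ((a + ζ * τ) * τ, τ)) =O[𝓝 0] fun τ => τ ^ 6) ∧
      ∀ ζ : ℂ, (fun τ : ℂ => g ((η + ζ * τ) * τ ^ 2 + a * τ, τ)) =O[𝓝 0] fun τ => τ ^ 9 := by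
  obtain ⟨φ, hφ0, hφ, ⟨L, hL⟩, hg⟩ := h
  obtain ⟨x, -, hx⟩ := AnalyticAt.exists_continuousAt_taylorCoeffs
    (F := fun q : (ℂ × ℂ) × ℂ => (φ q.1).1)
    (analyticAt_fst.comp (hφ.comp_of_eq analyticAt_fst rfl))
  have hX := hx.self_of_nhds 3
  generalize (fun i j => x i j 0) = y at hX
  -- contact along a curve on which the first component of `φ` vanishes to order `k`
  have key : ∀ (R S : ℂ → ℂ) (T : ℂ → ℂ) (k : ℕ), k ≤ 3 → Continuous R → Continuous S →
      Continuous T →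
      (∀ τ, ∑ q ∈ Finset.range 3 ×ˢ Finset.range 3,
        y q.1 q.2 * (τ * R τ) ^ q.1 * (τ * S τ) ^ q.2 = τ ^ k * T τ) →
      (fun τ : ℂ => g (τ * R τ, τ * S τ)) =O[𝓝 0] fun τ => τ ^ (3 * k) := by
    intro R S T k hk hR hS hT hsum
    have hγ : Tendsto (fun τ : ℂ => ((τ * R τ, τ * S τ) : ℂ × ℂ)) (𝓝 0) (𝓝 0) := by
      have : Continuous (fun τ : ℂ => ((τ * R τ, τ * S τ) : ℂ × ℂ)) := by fun_prop
      exact this.tendsto' 0 0 (by simp)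
    have h1 : (fun τ : ℂ => (φ (τ * R τ, τ * S τ)).1) =O[𝓝 0] fun τ => τ ^ k := by
      refine (((hX.isBigO_comp_curve hR hS).trans (isBigO_pow_pow_of_le_s5 hk)).add
        (isBigO_pow_mul_of_continuous hT le_rfl)).congr_left fun τ => ?_
      rw [hsum]
      ring
    have h2 : (fun τ : ℂ => (φ (τ * R τ, τ * S τ)).2) =O[𝓝 0] fun τ => τ := by
      have h3 : φ =O[𝓝 0] fun p => p := by
        simpa [hφ0] using hφ.differentiableAt.isBigO_sub
      have h4 : (fun τ : ℂ => ((τ * R τ, τ * S τ) : ℂ × ℂ)) =O[𝓝 0] fun τ => τ := by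
        refine IsBigO.prod_left ?_ ?_
        · simpa using isBigO_pow_mul_of_continuous hR (le_refl 1)
        · simpa using isBigO_pow_mul_of_continuous hS (le_refl 1)
      exact isBigO_snd_prod'.trans ((h3.comp_tendsto hγ).trans h4)
    refine (J30_isBigO_of_isBigO (b := b) (c := c) hk h1 h2).congr' ?_ EventuallyEq.rfl
    filter_upwards [hγ.eventually hg] with τ hτ
    exact hτ.symm
  have hy0 : y 0 0 = 0 := by
    have h1 : (fun p : ℂ × ℂ => (φ p).1 - ∑ q ∈ Finset.range 3 ×ˢ Finset.range 3,
        y q.1 q.2 * p.1 ^ q.1 * p.2 ^ q.2) =O[𝓝 0] fun p => ‖p - 0‖ ^ 3 := by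
      simpa [HasTaylorCoeffs] using hX
    have h2 := h1.eq_zero_of_norm_pow (by norm_num)
    simpa [hφ0, Finset.sum_product, Finset.sum_range_succ] using h2
  have hy1 : y 1 0 = 0 → y 0 1 ≠ 0 := by
    intro h10 h01
    have h1 : (fun p : ℂ × ℂ => ∑ q ∈ Finset.range 3 ×ˢ Finset.range 3,
        y q.1 q.2 * p.1 ^ q.1 * p.2 ^ q.2) =O[𝓝 0] fun p => ‖p‖ ^ 2 := by
      refine IsBigO.fun_sum fun q _ => ?_
      by_cases hq : 2 ≤ q.1 + q.2
      · exact isBigO_monomial _ hq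
      · have : y q.1 q.2 = 0 := by
          obtain ⟨i, j⟩ := q
          simp only at hq ⊢
          have : (i = 0 ∧ j = 0) ∨ (i = 1 ∧ j = 0) ∨ (i = 0 ∧ j = 1) := by omega
          rcases this with ⟨rfl, rfl⟩ | ⟨rfl, rfl⟩ | ⟨rfl, rfl⟩ <;> assumption
        simpa [this] using isBigO_zero _ _
    have h2 : (fun p : ℂ × ℂ => ‖p‖ ^ 3) =O[𝓝 0] fun p => ‖p‖ ^ 2 := by
      refine IsBigO.of_bound 1 ?_
      filter_upwards [Metric.ball_mem_nhds (0 : ℂ × ℂ) one_pos] with p hp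
      rw [one_mul, norm_pow, norm_pow, norm_norm]
      exact pow_le_pow_of_le_one (norm_nonneg _) (mem_ball_zero_iff.1 hp).le (by norm_num)
    have h3 : (fun p => (φ p).1) =O[𝓝 0] fun p : ℂ × ℂ => ‖p - 0‖ ^ 2 := by
      simpa using (IsBigO.trans hX h2).add h1
    have h4 := h3.hasFDerivAt (𝕜 := ℂ) (by norm_num)
    have h5 := hφ.differentiableAt.hasFDerivAt.fst
    rw [hL] at h5
    have h6 := congrArg (fun M : (ℂ × ℂ) →L[ℂ] ℂ => M (L.symm (1, 0))) (h5.unique h4)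
    simp at h6
  by_cases h10 : y 1 0 = 0
  · left
    intro ζ
    refine (key (fun _ => 1) (fun τ => ζ * τ) (fun τ => y 0 1 * ζ + y 2 0 + y 1 1 * ζ * τ +
      y 0 2 * ζ ^ 2 * τ ^ 2 + y 2 1 * ζ * τ ^ 2 + y 1 2 * ζ ^ 2 * τ ^ 3 + y 2 2 * ζ ^ 2 * τ ^ 4) 2
      (by norm_num) (by fun_prop) (by fun_prop) (by fun_prop) fun τ => ?_).congr_left fun τ => ?_
    · simp only [Finset.sum_product, Finset.sum_range_succ, Finset.sum_range_zero, hy0, h10]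
      ring
    · rw [mul_one, mul_comm τ (ζ * τ)]
  · right
    obtain ⟨a, ha⟩ : ∃ a, y 1 0 * a + y 0 1 = 0 := ⟨-y 0 1 / y 1 0, by field_simp; ring⟩
    obtain ⟨η, hη⟩ : ∃ η, y 1 0 * η + y 2 0 * a ^ 2 + y 1 1 * a + y 0 2 = 0 :=
      ⟨-(y 2 0 * a ^ 2 + y 1 1 * a + y 0 2) / y 1 0, by field_simp; ring⟩
    refine ⟨a, η, fun ζ => ?_, fun ζ => ?_⟩
    · refine (key (fun τ => a + ζ * τ) (fun _ => 1) (fun τ => y 1 0 * ζ + y 2 0 * (a + ζ * τ) ^ 2 +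
        y 1 1 * (a + ζ * τ) + y 0 2 + y 2 1 * (a + ζ * τ) ^ 2 * τ + y 1 2 * (a + ζ * τ) * τ +
        y 2 2 * (a + ζ * τ) ^ 2 * τ ^ 2) 2
        (by norm_num) (by fun_prop) (by fun_prop) (by fun_prop) fun τ => ?_).congr_left fun τ => ?_
      · simp only [Finset.sum_product, Finset.sum_range_succ, Finset.sum_range_zero, hy0]
        linear_combination τ * ha
      · rw [mul_one, mul_comm τ]
    · refine (key (fun τ => a + (η + ζ * τ) * τ) (fun _ => 1) (fun τ => y 1 0 * ζ +
        y 2 0 * (2 * a * (η + ζ * τ) + (η + ζ * τ) ^ 2 * τ) + y 1 1 * (η + ζ * τ) +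
        y 2 1 * (a + (η + ζ * τ) * τ) ^ 2 + y 1 2 * (a + (η + ζ * τ) * τ) +
        y 2 2 * (a + (η + ζ * τ) * τ) ^ 2 * τ) 3
        (by norm_num) (by fun_prop) (by fun_prop) (by fun_prop) fun τ => ?_).congr_left fun τ => ?_
      · simp only [Finset.sum_product, Finset.sum_range_succ, Finset.sum_range_zero, hy0]
        linear_combination τ * ha + τ ^ 2 * hη
      · rw [mul_one, show τ * (a + (η + ζ * τ) * τ) = (η + ζ * τ) * τ ^ 2 + a * τ by ring]

theorem cubic_discr_eq_zero_of_double_root {p q r s z : ℂ}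
    (h : p * z ^ 3 + q * z ^ 2 + r * z + s = 0) (h' : 3 * p * z ^ 2 + 2 * q * z + r = 0) :
    q ^ 2 * r ^ 2 - 4 * p * r ^ 3 - 4 * q ^ 3 * s - 27 * p ^ 2 * s ^ 2 + 18 * p * q * r * s = 0 := by
  obtain rfl : r = -(3 * p * z ^ 2 + 2 * q * z) := by linear_combination h'
  obtain rfl : s = 2 * p * z ^ 3 + q * z ^ 2 := by linear_combination h
  ring

theorem norm_lt_of_cubic_eq_zero {p q r s a : ℂ} {δ : ℝ} (hδ : 0 < δ) (hδ1 : δ ≤ 1)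
    (hp : 1 / 2 < ‖p‖) (hq : ‖q‖ < δ ^ 3 / 20) (hr : ‖r‖ < δ ^ 3 / 20) (hs : ‖s‖ < δ ^ 3 / 20)
    (h : p * a ^ 3 + 2 * q * a ^ 2 + 3 * r * a + 4 * s = 0) : ‖a‖ < δ := by
  by_contra! hle
  have ha : 0 < ‖a‖ := hδ.trans_le hle
  have h1 : ‖p‖ * ‖a‖ ^ 3 ≤ 2 * ‖q‖ * ‖a‖ ^ 2 + 3 * ‖r‖ * ‖a‖ + 4 * ‖s‖ := by
    have : p * a ^ 3 = -(2 * q * a ^ 2 + 3 * r * a + 4 * s) := by linear_combination h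
    calc ‖p‖ * ‖a‖ ^ 3 = ‖2 * q * a ^ 2 + 3 * r * a + 4 * s‖ := by
          rw [← norm_pow, ← norm_mul, this, norm_neg]
      _ ≤ ‖2 * q * a ^ 2‖ + ‖3 * r * a‖ + ‖4 * s‖ := norm_add₃_le
      _ = _ := by simp
  have hd3 : δ ^ 3 ≤ ‖a‖ ^ 3 := by gcongr
  have e2 : δ ^ 3 * ‖a‖ ^ 2 ≤ ‖a‖ ^ 3 := by
    have : δ ^ 3 ≤ δ := pow_le_of_le_one hδ.le hδ1 (by norm_num)
    nlinarith [pow_pos ha 2]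
  have e1 : δ ^ 3 * ‖a‖ ≤ ‖a‖ ^ 3 := by
    have : δ ^ 3 ≤ δ ^ 2 := pow_le_pow_of_le_one hδ.le hδ1 (by norm_num)
    have : δ ^ 2 ≤ ‖a‖ ^ 2 := by gcongr
    nlinarith
  have b2 : ‖q‖ * ‖a‖ ^ 2 ≤ δ ^ 3 / 20 * ‖a‖ ^ 2 := by gcongr
  have b1 : ‖r‖ * ‖a‖ ≤ δ ^ 3 / 20 * ‖a‖ := by gcongr
  have b3 : 1 / 2 * ‖a‖ ^ 3 < ‖p‖ * ‖a‖ ^ 3 := by gcongr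
  linarith [pow_pos ha 3]

/-- The Taylor coefficients of `x³y + s x²y³ + t x y⁶ + y⁷`. -/
noncomputable def coeffZ10 (s t : ℂ) (i j : ℕ) : ℂ :=
  if i = 3 ∧ j = 1 then 1 else if i = 2 ∧ j = 3 then s else
    if i = 1 ∧ j = 6 then t else if i = 0 ∧ j = 7 then 1 else 0

theorem hasTaylorCoeffs_coeffZ10 {s t : ℂ} {g : ℂ × ℂ → ℂ}
    (hg : ∀ᶠ p in 𝓝 (0 : ℂ × ℂ),
      g p = p.1 ^ 3 * p.2 + s * p.1 ^ 2 * p.2 ^ 3 + t * p.1 * p.2 ^ 6 + p.2 ^ 7) :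
    HasTaylorCoeffs 9 g (coeffZ10 s t) := by
  refine (isBigO_zero _ _).congr' ?_ EventuallyEq.rfl
  filter_upwards [hg] with p hp
  rw [hp]
  simp [Finset.sum_product, Finset.sum_range_succ, coeffZ10]
  ring

/-- A germ with Taylor coefficients `c` having contact of order `6` with the curves
`x = (a + ζ y) y` has a quartic part with double root `a`. -/
theorem HasTaylorCoeffs.quartic_double_root {g : ℂ × ℂ → ℂ} {c : ℕ → ℕ → ℂ}
    (hg : HasTaylorCoeffs 6 g c) {a : ℂ}
    (h : ∀ ζ : ℂ, (fun τ : ℂ => g ((a + ζ * τ) * τ, τ)) =O[𝓝 0] fun τ => τ ^ 6) :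
    c 4 0 * a ^ 4 + c 3 1 * a ^ 3 + c 2 2 * a ^ 2 + c 1 3 * a + c 0 4 = 0 ∧
      4 * c 4 0 * a ^ 3 + 3 * c 3 1 * a ^ 2 + 2 * c 2 2 * a + c 1 3 = 0 := by
  have hw : weightPart c 6 (0 + 1) 4 = C (c 0 4) * X ^ 0 + (C (c 1 3) * X ^ 1 + (C (c 2 2) * X ^ 2 +
      (C (c 3 1) * X ^ 3 + C (c 4 0) * X ^ 4))) := by
    have : (Finset.range 6 ×ˢ Finset.range 6).filter (fun q => (0 + 1) * q.1 + q.2 = 4) =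
        {(0, 4), (1, 3), (2, 2), (3, 1), (4, 0)} := by decide
    rw [weightPart, this]
    simp
  have h' : ∀ ζ : ℂ, (fun τ : ℂ => g ((a + ζ * τ) * τ ^ (0 + 1), τ)) =O[𝓝 0] fun τ => τ ^ 6 := by
    simpa using h
  have h0 := hg.taylor_weightPart_coeff_eq_zero 0 a h' (w := 4) (k := 0) (by norm_num)
  have h1 := hg.taylor_weightPart_coeff_eq_zero 0 a h' (w := 4) (k := 1) (by norm_num)
  rw [hw, taylor_coeff_zero] at h0
  rw [hw, taylor_coeff_one] at h1
  simp at h0 h1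
  exact ⟨by linear_combination h0, by linear_combination h1⟩

/-- A germ with Taylor coefficients `c` having contact of order `9` with the curves
`x = (η + ζ y) y²` has a part of weight `7` with double root `η`. -/
theorem HasTaylorCoeffs.weight_seven_double_root {g : ℂ × ℂ → ℂ} {c : ℕ → ℕ → ℂ}
    (hg : HasTaylorCoeffs 9 g c) {η : ℂ}
    (h : ∀ ζ : ℂ, (fun τ : ℂ => g ((η + ζ * τ) * τ ^ 2, τ)) =O[𝓝 0] fun τ => τ ^ 9) :
    c 3 1 * η ^ 3 + c 2 3 * η ^ 2 + c 1 5 * η + c 0 7 = 0 ∧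
      3 * c 3 1 * η ^ 2 + 2 * c 2 3 * η + c 1 5 = 0 := by
  have hw : weightPart c 9 (1 + 1) 7 = C (c 0 7) * X ^ 0 + (C (c 1 5) * X ^ 1 + (C (c 2 3) * X ^ 2 +
      C (c 3 1) * X ^ 3)) := by
    have : (Finset.range 9 ×ˢ Finset.range 9).filter (fun q => (1 + 1) * q.1 + q.2 = 7) =
        {(0, 7), (1, 5), (2, 3), (3, 1)} := by decide
    rw [weightPart, this]
    simp
  have h0 := hg.taylor_weightPart_coeff_eq_zero 1 η h (w := 7) (k := 0) (by norm_num)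
  have h1 := hg.taylor_weightPart_coeff_eq_zero 1 η h (w := 7) (k := 1) (by norm_num)
  rw [hw, taylor_coeff_zero] at h0
  rw [hw, taylor_coeff_one] at h1
  simp at h0 h1
  exact ⟨by linear_combination h0, by linear_combination h1⟩

/-- The family Z10 does not deform to `J_{3,0}`: for every analytic deformation
`F` of `f` with parameter in `ℂ^m` (m ≥ 1), all nearby nonzero parameter values
give germs not right equivalent to any member of `J_{3,0}`. -/
theorem not_deform_to_J30_Z10 (s t : ℂ) (hs : 4 * s ^ 3 + 27 ≠ 0)
    (m : ℕ) (hm : 1 ≤ m) (F : (ℂ × ℂ) × EuclideanSpace ℂ (Fin m) → ℂ)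
    (hF : AnalyticAt ℂ F 0)
    (hF0 : ∀ᶠ p in nhds (0 : ℂ × ℂ), F (p, 0) = p.1 ^ 3 * p.2 + s * p.1 ^ 2 * p.2 ^ 3 + t * p.1 * p.2 ^ 6 + p.2 ^ 7) :
    ∃ ε > (0 : ℝ), ∀ u : EuclideanSpace ℂ (Fin m), 0 < ‖u‖ → ‖u‖ < ε →
      ∀ b c : ℂ, 4 * b ^ 3 + 27 ≠ 0 →
        ¬ RightEquiv (fun p => F (p, u)) (J30 b c) := by
  obtain ⟨c, hc, hcF⟩ := hF.exists_continuousAt_taylorCoeffs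
  let E := EuclideanSpace ℂ (Fin m)
  let F' : (ℂ × ℂ) × (E × ℂ) → ℂ := fun q => F ((q.1.1 + q.2.2 * q.1.2, q.1.2), q.2.1)
  have hF' : AnalyticAt ℂ F' 0 := by
    refine AnalyticAt.comp_of_eq
      (f := fun q : (ℂ × ℂ) × (E × ℂ) => ((q.1.1 + q.2.2 * q.1.2, q.1.2), q.2.1)) hF ?_ (by simp)
    have h1 : AnalyticAt ℂ (fun q : (ℂ × ℂ) × (E × ℂ) => q.1) 0 := analyticAt_fst
    have h2 : AnalyticAt ℂ (fun q : (ℂ × ℂ) × (E × ℂ) => q.2) 0 := analyticAt_snd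
    have h11 := analyticAt_fst.comp h1
    have h12 := analyticAt_snd.comp h1
    have h21 := analyticAt_fst.comp h2
    have h22 := analyticAt_snd.comp h2
    exact ((h11.add (h22.mul h12)).prod h12).prod h21
  obtain ⟨d, hd, hdF⟩ := hF'.exists_continuousAt_taylorCoeffs
  have hc0 : ∀ {i j : ℕ}, i + j < 9 → c i j 0 = coeffZ10 s t i j := fun hij =>
    (hcF.self_of_nhds 9).unique (hasTaylorCoeffs_coeffZ10 hF0) hij
  have hd0 : ∀ {i j : ℕ}, i + j < 9 → d i j 0 = coeffZ10 s t i j := fun hij =>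
    (hdF.self_of_nhds 9).unique (hasTaylorCoeffs_coeffZ10 (by simpa [F'] using hF0)) hij
  -- the discriminant of the part of weight `7` does not vanish near the given germ
  have hdisc : ∀ᶠ v in 𝓝 (0 : E × ℂ), d 2 3 v ^ 2 * d 1 5 v ^ 2 - 4 * d 3 1 v * d 1 5 v ^ 3 -
      4 * d 2 3 v ^ 3 * d 0 7 v - 27 * d 3 1 v ^ 2 * d 0 7 v ^ 2 +
      18 * d 3 1 v * d 2 3 v * d 1 5 v * d 0 7 v ≠ 0 := by
    have h31 := hd 3 1
    have h23 := hd 2 3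
    have h15 := hd 1 5
    have h07 := hd 0 7
    refine ContinuousAt.eventually_ne (by fun_prop) ?_
    rw [hd0 (by norm_num), hd0 (by norm_num), hd0 (by norm_num), hd0 (by norm_num)]
    simp only [coeffZ10]
    norm_num
    intro h
    exact hs (by linear_combination -h)
  have hnear := hdF.and hdisc
  rw [← Prod.mk_zero_zero, nhds_prod_eq] at hnear
  obtain ⟨U, hU, A, hA, hUA⟩ := eventually_prod_iff.1 hnear
  obtain ⟨δ', hδ', hA'⟩ := Metric.eventually_nhds_iff.1 hA
  obtain ⟨δ, hδ, hδ1, hδA⟩ : ∃ δ > (0 : ℝ), δ ≤ 1 ∧ ∀ a : ℂ, ‖a‖ < δ → A a :=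
    ⟨min δ' 1, lt_min hδ' one_pos, min_le_right _ _, fun a ha =>
      hA' (by simpa using ha.trans_le (min_le_left _ _))⟩
  have hsmall : ∀ i j : ℕ, i + j < 9 → coeffZ10 s t i j = 0 →
      ∀ᶠ u in 𝓝 (0 : E), ‖c i j u‖ < δ ^ 3 / 20 := fun i j hij h0 => by
    refine (hc i j).norm.eventually_lt continuousAt_const ?_
    rw [hc0 hij, h0, norm_zero]
    positivity
  have hlarge : ∀ᶠ u in 𝓝 (0 : E), 1 / 2 < ‖c 3 1 u‖ := by
    refine continuousAt_const.eventually_lt (hc 3 1).norm ?_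
    rw [hc0 (by norm_num)]
    simp only [coeffZ10]
    norm_num
  have hev : ∀ᶠ u in 𝓝 (0 : E), ∀ b c : ℂ, ¬ RightEquiv (fun p => F (p, u)) (J30 b c) := by
    filter_upwards [hcF, hU, hlarge, hsmall 2 2 (by norm_num) (by simp [coeffZ10]),
      hsmall 1 3 (by norm_num) (by simp [coeffZ10]),
      hsmall 0 4 (by norm_num) (by simp [coeffZ10])] with u hu hUu h31 h22 h13 h04 b e hR
    rcases hR.exists_curves with hcurve | ⟨a, η, hcurve, hcurve'⟩
    · have h1 := ((hu 6).swap.quartic_double_root (a := 0) (by simpa using hcurve)).2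
      simp only [ne_eq, OfNat.ofNat_ne_zero, not_false_eq_true, zero_pow, mul_zero, zero_add] at h1
      rw [h1, norm_zero] at h31
      norm_num at h31
    · obtain ⟨h1, h2⟩ := (hu 6).quartic_double_root hcurve
      have ha : ‖a‖ < δ :=
        norm_lt_of_cubic_eq_zero hδ hδ1 h31 h22 h13 h04 (by linear_combination 4 * h1 - a * h2)
      obtain ⟨hTaylor, hne⟩ := hUA hUu (hδA a ha)
      obtain ⟨h3, h4⟩ := (hTaylor 9).weight_seven_double_root (η := η) hcurve'
      exact hne (cubic_discr_eq_zero_of_double_root h3 h4)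
  obtain ⟨ε, hε, h⟩ := Metric.eventually_nhds_iff.1 hev
  exact ⟨ε, hε, fun u _ hu b c _ => h (by simpa using hu) b c⟩
end
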